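/- For every integer ℓ ≥ 2 there exist a constant c > 0 and a real X₀ such that for all X ≥ X₀, the number of squarefree positive integers d ≤ X whose 2-class group Cl₂(−d) is isomorphic to (ℤ/2ℤ) × (ℤ/2^ℓℤ) is at least c · X^{1/2 + 1/2^{ℓ+1}} / (log X)². -/

import Mathlib

open NumberField

/-- `twoClassGroupIso d G` says: for any realization `K` of the imaginary quadratic field
`ℚ(√-d)` (i.e. a number field generated over `ℚ` by a square root of `-d`), every Sylow
2-subgroup of the ideal class group of its ring of integers (the 2-class group `Cl₂(-d)`)
is isomorphic to `G`. -/
def twoClassGroupIso (d : ℕ) (G : Type) [Group G] : Prop :=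
  ∀ (K : Type) [Field K] [NumberField K] (α : K),
    α ^ 2 = -(d : K) →
    IntermediateField.adjoin ℚ {α} = ⊤ →
    ∀ P : Sylow 2 (ClassGroup (NumberField.RingOfIntegers K)),
      Nonempty ((P : Subgroup (ClassGroup (NumberField.RingOfIntegers K))) ≃* G)

lemma F_group {C : Type*} [CommGroup C] [Finite C] (l : ℕ) (hl : 2 ≤ l) (P : Sylow 2 C)
    (x t a : C) (hx : x ^ (2 ^ l) = 1) (hx' : x ^ (2 ^ (l - 1)) ≠ 1) (ht : t ^ 2 = 1)
    (h2 : ∀ c : C, c ^ 2 = 1 → c = 1 ∨ c = a ∨ c = t ∨ c = a * t)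
    (htn : ∀ y : C, y ^ 2 ≠ t)
    (hxn : ∀ s : C, s ^ 2 = 1 → ∀ y : C, y ^ 2 ≠ x * s) :
    Nonempty ((P : Subgroup C) ≃* Multiplicative (ZMod 2 × ZMod (2 ^ l))) := by
  classical
  have hPmem : ∀ g : C, (∃ m, g ^ (2 ^ m) = 1) → g ∈ P := by
    intro g ⟨m, hm⟩
    have hpg : IsPGroup 2 (Subgroup.zpowers g) := by
      rw [IsPGroup.iff_card]
      have : orderOf g ∣ 2 ^ m := orderOf_dvd_of_pow_eq_one hm
      obtain ⟨k, -, hk⟩ := (Nat.dvd_prime_pow Nat.prime_two).1 this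
      exact ⟨k, by rw [Nat.card_zpowers, hk]⟩
    obtain ⟨Q, hQ⟩ := hpg.exists_le_sylow
    have : Q = P := by
      obtain ⟨g', hg'⟩ := MulAction.exists_smul_eq C Q P
      rw [← hg']
      exact (Sylow.smul_eq_of_normal).symm
    rw [← this]
    exact hQ (Subgroup.mem_zpowers g)
  have hxP : x ∈ P := hPmem x ⟨l, hx⟩
  have htP : t ∈ P := hPmem t ⟨1, by simpa using ht⟩
  -- surjectivity
  have key1 : ∀ c : C, c ^ 2 = 1 → ∃ i j : ℤ, c = t ^ j * x ^ i := by
    have hxk : (x ^ (2 ^ (l-1))) ^ 2 = 1 := by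
      rw [← pow_mul, ← pow_succ, show l - 1 + 1 = l by omega, hx]
    have ha : ∃ i j : ℤ, a = t ^ j * x ^ i := by
      rcases h2 _ hxk with h | h | h | h
      · exact absurd h hx'
      · exact ⟨2 ^ (l-1), 0, by rw [← h]; norm_cast; simp⟩
      · exfalso
        apply htn (x ^ (2 ^ (l-2)))
        rw [← h, ← pow_mul, ← pow_succ, show l - 2 + 1 = l - 1 by omega]
      · refine ⟨2 ^ (l-1), -1, ?_⟩
        have : a = t⁻¹ * x ^ (2 ^ (l-1)) := by rw [h]; simp
        rw [this, zpow_neg_one]; norm_cast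
    obtain ⟨i, j, rfl⟩ := ha
    intro c hc
    rcases h2 c hc with h | h | h | h
    · exact ⟨0, 0, by simpa using h⟩
    · exact ⟨i, j, h⟩
    · exact ⟨0, 1, by simpa using h⟩
    · exact ⟨i, j + 1, by rw [h, zpow_add]; simp [mul_comm, mul_left_comm]⟩
  have htj : ∀ j : ℤ, (t ^ j) ^ 2 = 1 := by
    intro j
    rw [← zpow_natCast, ← zpow_mul, mul_comm, zpow_mul, zpow_natCast, ht, one_zpow]
  have teven : ∀ j : ℤ, Even j → t ^ j = 1 := by
    rintro j ⟨r, rfl⟩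
    rw [zpow_add, ← sq, htj]
  have tcases : ∀ j : ℤ, Odd j → t ^ j = t := by
    rintro j ⟨r, rfl⟩
    rw [zpow_add, zpow_one, teven _ (even_two_mul r), one_mul]
  have key2 : ∀ m : ℕ, ∀ g : C, g ^ (2 ^ m) = 1 → ∃ i j : ℤ, g = t ^ j * x ^ i := by
    intro m
    induction m with
    | zero => intro g hg; exact ⟨0, 0, by simpa using hg⟩
    | succ m ih =>
      intro g hg
      obtain ⟨i, j, hij⟩ := ih (g ^ 2) (by rw [← pow_mul, ← pow_succ', hg])
      rcases Int.even_or_odd i with ⟨r, rfl⟩ | ⟨r, rfl⟩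
      · have h3 : (g * x ^ (-r)) ^ 2 = t ^ j := by
          rw [mul_pow, hij, zpow_add, zpow_neg, sq]; group
          
        rcases Int.even_or_odd j with hj | hj
        · rw [teven j hj] at h3
          obtain ⟨i', j', h'⟩ := key1 _ h3
          refine ⟨i' + r, j', ?_⟩
          rw [zpow_add, ← mul_assoc, ← h']; simp
        · rw [tcases j hj] at h3
          exact absurd h3 (htn _)
      · exfalso
        apply hxn (t ^ j) (htj j) (g * x ^ (-r))
        have h6 : x ^ (2 * r + 1) = x ^ r * x ^ r * x := by rw [two_mul, zpow_add, zpow_add, zpow_one]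
        rw [mul_pow, hij, h6, zpow_neg, sq (x^r)⁻¹]
        generalize x ^ r = y
        generalize t ^ j = z
        rw [← mul_inv, mul_inv_eq_iff_eq_mul]
        simp only [mul_comm, mul_left_comm]
  let xP : P := ⟨x, hxP⟩
  let tP : P := ⟨t, htP⟩
  have hxP1 : xP ^ (2 ^ l) = 1 := by ext; simpa [xP] using hx
  have htP1 : tP ^ 2 = 1 := by ext; simpa [tP] using ht
  let f1 : ZMod 2 →+ Additive P := ZMod.lift 2 ⟨zmultiplesHom _ (Additive.ofMul tP), by
    rw [zmultiplesHom_apply, natCast_zsmul, ← ofMul_pow, htP1]; rfl⟩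
  let f2 : ZMod (2 ^ l) →+ Additive P := ZMod.lift (2 ^ l) ⟨zmultiplesHom _ (Additive.ofMul xP), by
    rw [zmultiplesHom_apply, natCast_zsmul, ← ofMul_pow, hxP1]; rfl⟩
  let f : ZMod 2 × ZMod (2 ^ l) →+ Additive P := AddMonoidHom.coprod f1 f2
  have hf : ∀ i j : ℤ, ((f ((j : ZMod 2), (i : ZMod (2 ^ l)))).toMul : C) = t ^ j * x ^ i := by
    intro i j
    simp only [f, AddMonoidHom.coprod_apply, f1, f2, ZMod.lift_coe]
    simp [xP, tP]
  have hinj : Function.Injective f := by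
    rw [injective_iff_map_eq_zero]
    rintro ⟨j, i⟩ hij
    obtain ⟨j, rfl⟩ := ZMod.intCast_surjective j
    obtain ⟨i, rfl⟩ := ZMod.intCast_surjective i
    have h1 : t ^ j * x ^ i = 1 := by rw [← hf, hij]; rfl
    rcases Int.even_or_odd j with hj | hj
    · rw [teven j hj, one_mul] at h1
      have hord : orderOf x = 2 ^ l := by
        have := orderOf_eq_prime_pow (p := 2) (n := l - 1) hx' (by rw [show l - 1 + 1 = l by omega]; exact hx)
        rw [this, show l - 1 + 1 = l by omega]
      have := orderOf_dvd_iff_zpow_eq_one.2 h1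
      rw [hord] at this
      ext
      · simpa using (ZMod.intCast_zmod_eq_zero_iff_dvd j 2).2 hj.two_dvd
      · simpa using (ZMod.intCast_zmod_eq_zero_iff_dvd i (2 ^ l)).2 (by simpa using this)
    · exfalso
      rw [tcases j hj] at h1
      rcases Int.even_or_odd i with ⟨r, rfl⟩ | ⟨r, rfl⟩
      · apply htn (x ^ (-r))
        rw [zpow_neg, sq, eq_comm, ← mul_inv, ← zpow_add]
        exact eq_inv_of_mul_eq_one_left h1
      · apply hxn t ht (x ^ (-r))
        have h5 : t = (x ^ (2 * r + 1))⁻¹ := eq_inv_of_mul_eq_one_left h1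
        have h6 : x ^ (2 * r + 1) = x ^ r * x ^ r * x := by rw [two_mul, zpow_add, zpow_add, zpow_one]
        rw [h5, h6, zpow_neg, sq, ← mul_inv, eq_mul_inv_iff_mul_eq, inv_mul_eq_iff_eq_mul]
  have hsurj : Function.Surjective f := by
    intro g
    obtain ⟨m, hm⟩ := P.isPGroup' g.toMul
    obtain ⟨i, j, hij⟩ := key2 m (g.toMul : C) (by
      have := congrArg (fun z : P => (z : C)) hm
      simpa using this)
    refine ⟨((j : ZMod 2), (i : ZMod (2 ^ l))), ?_⟩
    apply Additive.toMul.injective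
    apply Subtype.ext
    rw [hf, hij]
  let e := AddEquiv.ofBijective f ⟨hinj, hsurj⟩
  exact ⟨(AddEquiv.toMultiplicative e).symm⟩

structure IsQuad (R : Type*) [CommRing R] (d : ℕ) (w : R) : Prop where
  sq : w * w = -(d : R)
  rep : ∀ x : R, ∃ u v : ℤ, x = u + v * w
  inj : ∀ u v : ℤ, (u : R) + v * w = 0 → u = 0 ∧ v = 0

section quad
variable {R : Type*} [CommRing R] {d : ℕ} {w : R}

lemma IsQuad.ext (h : IsQuad R d w) {u v u' v' : ℤ} (e : (u : R) + v * w = u' + v' * w) :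
    u = u' ∧ v = v' := by
  have := h.inj (u - u') (v - v') (by push_cast; linear_combination e)
  omega

lemma IsQuad.dvd (h : IsQuad R d w) {l u v : ℤ} (e : (l : R) ∣ (u : R) + v * w) :
    l ∣ u ∧ l ∣ v := by
  obtain ⟨y, hy⟩ := e
  obtain ⟨a, b, rfl⟩ := h.rep y
  have := h.ext (u := u) (v := v) (u' := l * a) (v' := l * b) (by push_cast; linear_combination hy)
  exact ⟨⟨a, this.1⟩, ⟨b, this.2⟩⟩

lemma IsQuad.cast_inj (h : IsQuad R d w) {u v : ℤ} (e : (u : R) = v) : u = v :=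
  (h.ext (u := u) (v := 0) (u' := v) (v' := 0) (by simpa using e)).1

lemma IsQuad.norm (h : IsQuad R d w) (u v : ℤ) :
    Algebra.norm ℤ ((u : R) + v * w) = u ^ 2 + d * v ^ 2 := by
  classical
  have hli : LinearIndependent ℤ ![(1 : R), w] := by
    rw [LinearIndependent.pair_iff]
    intro s t hst
    exact h.inj s t (by simpa using hst)
  let b : Module.Basis (Fin 2) ℤ R := Module.Basis.mk hli (by
    rintro x -
    obtain ⟨u, v, rfl⟩ := h.rep x
    rw [Matrix.range_cons, Matrix.range_cons, Matrix.range_empty]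
    simp only [Set.union_empty, Set.singleton_union]
    rw [Submodule.mem_span_pair]
    exact ⟨u, v, by simp⟩)
  have hb0 : b 0 = 1 := by simp [b]
  have hb1 : b 1 = w := by simp [b]
  have hr : ∀ u v : ℤ, b.repr ((u : R) + v * w) = Finsupp.single 0 u + Finsupp.single 1 v := by
    intro u v
    apply b.repr.symm.injective
    rw [LinearEquiv.symm_apply_apply, map_add]
    simp [hb0, hb1]
  rw [Algebra.norm_eq_matrix_det b, Matrix.det_fin_two]
  simp only [Algebra.leftMulMatrix_eq_repr_mul, hb0, hb1, mul_one]
  rw [show ((u : R) + v * w) * w = ((-(d : ℤ) * v : ℤ) : R) + (u : ℤ) * w by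
    push_cast; linear_combination v * h.sq, hr, hr]
  simp
  ring

/-- class of an ideal -/
noncomputable def icl [IsDedekindDomain R] (I : Ideal R) : ClassGroup R :=
  open Classical in if h : I ∈ nonZeroDivisors (Ideal R) then ClassGroup.mk0 ⟨I, h⟩ else 1

variable [IsDedekindDomain R]

lemma icl_mul {I J : Ideal R} (hI : I ≠ 0) (hJ : J ≠ 0) : icl (I * J) = icl I * icl J := by
  have h1 := mem_nonZeroDivisors_of_ne_zero hI
  have h2 := mem_nonZeroDivisors_of_ne_zero hJ
  have h3 := mem_nonZeroDivisors_of_ne_zero (mul_ne_zero hI hJ)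
  rw [icl, icl, icl, dif_pos h1, dif_pos h2, dif_pos h3, ← map_mul]
  rfl

lemma icl_span (x : R) : icl (Ideal.span {x}) = 1 := by
  rw [icl]
  split_ifs with h
  · rw [ClassGroup.mk0_eq_one_iff]
    exact ⟨x, rfl⟩
  · rfl

lemma icl_one : icl (1 : Ideal R) = 1 := by
  rw [Ideal.one_eq_top, ← Ideal.span_singleton_one]; exact icl_span 1

lemma icl_eq_one {I : Ideal R} (hI : I ≠ 0) (h : icl I = 1) : ∃ x, x ≠ 0 ∧ I = Ideal.span {x} := by
  rw [icl, dif_pos (mem_nonZeroDivisors_of_ne_zero hI), ClassGroup.mk0_eq_one_iff] at h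
  obtain ⟨x, hx⟩ := h
  refine ⟨x, ?_, hx⟩
  rintro rfl
  apply hI
  rw [hx]; simp

lemma icl_pow {I : Ideal R} (hI : I ≠ 0) (n : ℕ) : icl (I ^ n) = icl I ^ n := by
  induction n with
  | zero => rw [pow_zero, pow_zero, icl_one]
  | succ n ih => rw [pow_succ, pow_succ, icl_mul (pow_ne_zero _ hI) hI, ih]

lemma icl_surj (c : ClassGroup R) : ∃ I : Ideal R, I ≠ 0 ∧ icl I = c := by
  obtain ⟨⟨I, hI⟩, rfl⟩ := ClassGroup.mk0_surjective c
  exact ⟨I, nonZeroDivisors.ne_zero hI, by rw [icl, dif_pos hI]⟩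

lemma icl_eq {I J : Ideal R} (hI : I ≠ 0) (hJ : J ≠ 0) (h : icl I = icl J) :
    ∃ x y : R, x ≠ 0 ∧ y ≠ 0 ∧ Ideal.span {x} * I = Ideal.span {y} * J := by
  rw [icl, icl, dif_pos (mem_nonZeroDivisors_of_ne_zero hI), dif_pos (mem_nonZeroDivisors_of_ne_zero hJ),
    ClassGroup.mk0_eq_mk0_iff] at h
  obtain ⟨x, y, hx, hy, e⟩ := h
  exact ⟨x, y, hx, hy, e⟩

end quad

section quad
variable {R : Type*} [CommRing R] {d : ℕ} {w : R}

lemma span_pair_mul_eq {a b a' b' c : R} (h1 : c ∣ a * a') (h2 : c ∣ a * b') (h3 : c ∣ b * a')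
    (h4 : c ∣ b * b') (x y z t : R) (h : c = x * (a * a') + y * (a * b') + z * (b * a') + t * (b * b')) :
    Ideal.span {a, b} * Ideal.span {a', b'} = Ideal.span {c} := by
  rw [Ideal.span_pair_mul_span_pair]
  apply le_antisymm
  · rw [Ideal.span_le]
    intro s hs
    simp only [Set.mem_insert_iff, Set.mem_singleton_iff] at hs
    rw [SetLike.mem_coe, Ideal.mem_span_singleton]
    rcases hs with rfl | rfl | rfl | rfl <;> assumption
  · rw [Ideal.span_le, Set.singleton_subset_iff, h]
    refine add_mem (add_mem (add_mem ?_ ?_) ?_) ?_ <;> apply Ideal.mul_mem_left <;>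
      apply Ideal.subset_span <;> simp

lemma IsQuad.sq_two (h : IsQuad R d w) (hd : d % 4 = 1) :
    Ideal.span {(2 : R), 1 + w} * Ideal.span {(2 : R), 1 + w} = Ideal.span {(2 : R)} := by
  obtain ⟨m, rfl⟩ : ∃ m, d = 4 * m + 1 := ⟨d / 4, by omega⟩
  have := h.sq
  push_cast at this
  refine span_pair_mul_eq ⟨2, rfl⟩ ⟨1 + w, rfl⟩ ⟨1 + w, by ring⟩ ⟨-2 * m + w, by linear_combination this⟩
    (-m) 1 0 (-1) ?_
  linear_combination this

lemma IsQuad.mul_pq (h : IsQuad R d w) {a b : ℕ} (hab : a.Coprime b) (hd : d = a * b) :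
    Ideal.span {(a : R), w} * Ideal.span {(b : R), w} = Ideal.span {w} := by
  obtain ⟨x, y, hxy⟩ := Nat.isCoprime_iff_coprime.2 hab
  have hxy' := congrArg (Int.cast : ℤ → R) hxy
  push_cast at hxy'
  have := h.sq
  rw [hd] at this
  push_cast at this
  refine span_pair_mul_eq ⟨-w, by linear_combination this⟩ ⟨a, by ring⟩ ⟨b, by ring⟩ ⟨w, rfl⟩ 0 x y 0 ?_
  linear_combination -w * hxy'

lemma IsQuad.sq_p (h : IsQuad R d w) {a b : ℕ} (hab : a.Coprime b) (hd : d = a * b) :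
    Ideal.span {(a : R), w} * Ideal.span {(a : R), w} = Ideal.span {(a : R)} := by
  obtain ⟨x, y, hxy⟩ := Nat.isCoprime_iff_coprime.2 hab
  have hxy' := congrArg (Int.cast : ℤ → R) hxy
  push_cast at hxy'
  have := h.sq
  rw [hd] at this
  push_cast at this
  refine span_pair_mul_eq ⟨a, rfl⟩ ⟨w, rfl⟩ ⟨w, by ring⟩ ⟨-b, by linear_combination this⟩ x 0 0 (-y) ?_
  linear_combination -a * hxy' + y * this

variable [IsDedekindDomain R]

set_option maxHeartbeats 1000000 in
/-- ideals with square generated by an integer -/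
lemma IsQuad.two_tors_aux (h : IsQuad R d w) {p q : ℕ} (hp : p.Prime) (hq : q.Prime) (hpq : p ≠ q)
    (hd : d = p * q) (hd4 : d % 4 = 1) (n : ℕ) :
    ∀ (I : Ideal R), n ≠ 0 → I * I = Ideal.span {(n : R)} →
      icl I = 1 ∨ icl I = icl (Ideal.span {(p : R), w}) ∨ icl I = icl (Ideal.span {(2 : R), 1 + w}) ∨
      icl I = icl (Ideal.span {(p : R), w}) * icl (Ideal.span {(2 : R), 1 + w}) := by
  have hcop : p.Coprime q := (Nat.coprime_primes hp hq).2 hpq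
  have hz : ∀ m : ℕ, m ≠ 0 → (m : R) ≠ 0 := by
    intro m hm h0
    exact hm (by exact_mod_cast h.cast_inj (u := m) (v := 0) (by simpa using h0))
  have hPP := h.sq_p hcop hd
  have hQQ := h.sq_p hcop.symm (hd.trans (mul_comm _ _))
  have hTT := h.sq_two hd4
  have hPQ := h.mul_pq hcop hd
  have hw0 : w ≠ 0 := by
    intro h0
    have := h.inj 0 1 (by simp [h0])
    omega
  set P := Ideal.span {(p : R), w}
  set Q := Ideal.span {(q : R), w}
  set T := Ideal.span {(2 : R), 1 + w}
  have spz : ∀ x : R, x ≠ 0 → Ideal.span {x} ≠ 0 := by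
    intro x hx; simpa [Ideal.zero_eq_bot, Ideal.span_singleton_eq_bot] using hx
  have nz : ∀ I : Ideal R, ∀ x : R, x ≠ 0 → I * I = Ideal.span {x} → I ≠ 0 := by
    rintro I x hx hI rfl
    exact spz x hx (by rw [← hI]; simp)
  have hP0 := nz P _ (hz p hp.ne_zero) hPP
  have hQ0 := nz Q _ (hz q hq.ne_zero) hQQ
  have hT0 := nz T 2 (by exact_mod_cast hz 2 two_ne_zero) hTT
  have cP : icl P * icl P = 1 := by rw [← icl_mul hP0 hP0, hPP, icl_span]
  have cT : icl T * icl T = 1 := by rw [← icl_mul hT0 hT0, hTT, icl_span]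
  have cPQ : icl Q = icl P := by
    have : icl P * icl Q = 1 := by rw [← icl_mul hP0 hQ0, hPQ, icl_span]
    have := this.trans cP.symm
    exact mul_left_cancel this
  induction n using Nat.strong_induction_on with
  | _ n ih =>
  intro I hn hI
  by_cases hn1 : n = 1
  · left
    rw [hn1, Nat.cast_one, Ideal.span_singleton_one] at hI
    have : I = ⊤ := by
      rw [eq_top_iff, ← hI]
      exact Ideal.mul_le_left
    rw [this, ← Ideal.one_eq_top, icl_one]
  obtain ⟨l, hl, hln⟩ := Nat.exists_prime_and_dvd hn1
  obtain ⟨m, rfl⟩ := hln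
  have hI0 := nz I _ (hz _ hn) hI
  have hsq : ∀ x ∈ I, (l : R) ∣ x * x := by
    intro x hx
    have : x * x ∈ Ideal.span {((l * m : ℕ) : R)} := by rw [← hI]; exact Ideal.mul_mem_mul hx hx
    rw [Ideal.mem_span_singleton] at this
    exact (Dvd.intro (m : R) (by push_cast; ring)).trans this
  have hcoef : ∀ u v : ℤ, (u : R) + v * w ∈ I → (l : ℤ) ∣ u ^ 2 - d * v ^ 2 ∧ (l : ℤ) ∣ 2 * u * v := by
    intro u v hx
    have := hsq _ hx
    apply h.dvd
    push_cast
    convert this using 1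
    linear_combination (-v^2 : R) * h.sq
  have hl' : Prime (l : ℤ) := Nat.prime_iff_prime_int.1 hl
  have hm0 : m ≠ 0 := by rintro rfl; simp at hn
  have hmlt : m < l * m := by
    have := hl.one_lt
    have := Nat.pos_of_ne_zero hm0
    nlinarith
  -- ramified step
  have ram : ∀ L : Ideal R, L * L = Ideal.span {(l : R)} → I ≤ L →
      ∃ J : Ideal R, J * J = Ideal.span {(m : R)} ∧ icl I = icl L * icl J := by
    intro L hL hIL
    obtain ⟨J, rfl⟩ := Ideal.dvd_iff_le.2 hIL
    refine ⟨J, ?_, icl_mul (left_ne_zero_of_mul hI0) (right_ne_zero_of_mul hI0)⟩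
    have h1 : L * L * (J * J) = L * L * Ideal.span {(m : R)} := by
      rw [hL, Ideal.span_singleton_mul_span_singleton, ← Nat.cast_mul, ← hI, ← hL]
      ring
    exact mul_left_cancel₀ (by rw [hL]; exact spz _ (hz _ hl.ne_zero)) h1
  by_cases hlp : l = p
  · obtain ⟨J, hJ, hc⟩ := ram P (by rw [hPP, hlp]) (by
      intro x hx
      obtain ⟨u, v, rfl⟩ := h.rep x
      have h1 := (hcoef u v hx).1
      have h2 : (l : ℤ) ∣ u := by
        apply hl'.dvd_of_dvd_pow (n := 2)
        have h3 : (l : ℤ) ∣ d * v ^ 2 := by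
          rw [hd, hlp]; push_cast; exact ⟨q * v ^ 2, by ring⟩
        simpa using dvd_add h1 h3
      obtain ⟨u', rfl⟩ := h2
      rw [Ideal.mem_span_pair]
      exact ⟨u', v, by rw [← hlp]; push_cast; ring⟩)
    rw [hc]
    rcases ih m hmlt J hm0 hJ with e | e | e | e <;> rw [e]
    · simp
    · left; exact cP
    · simp
    · right; right; left; rw [← mul_assoc, cP, one_mul]
  by_cases hlq : l = q
  · obtain ⟨J, hJ, hc⟩ := ram Q (by rw [hQQ, hlq]) (by
      intro x hx
      obtain ⟨u, v, rfl⟩ := h.rep x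
      have h1 := (hcoef u v hx).1
      have h2 : (l : ℤ) ∣ u := by
        apply hl'.dvd_of_dvd_pow (n := 2)
        have h3 : (l : ℤ) ∣ d * v ^ 2 := by
          rw [hd, hlq]; push_cast; exact ⟨p * v ^ 2, by ring⟩
        simpa using dvd_add h1 h3
      obtain ⟨u', rfl⟩ := h2
      rw [Ideal.mem_span_pair]
      exact ⟨u', v, by rw [← hlq]; push_cast; ring⟩)
    rw [hc, cPQ]
    rcases ih m hmlt J hm0 hJ with e | e | e | e <;> rw [e]
    · simp
    · left; exact cP
    · simp
    · right; right; left; rw [← mul_assoc, cP, one_mul]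
  by_cases hl2 : l = 2
  · obtain ⟨J, hJ, hc⟩ := ram T (by rw [hTT, hl2]; norm_num) (by
      intro x hx
      obtain ⟨u, v, rfl⟩ := h.rep x
      have h1 := (hcoef u v hx).1
      have h2 : ∃ e, u = v + 2 * e := by
        have hdd : ¬ Even (d : ℤ) := by rw [Int.even_iff]; omega
        rw [hl2] at h1
        have h5 : Even (u ^ 2 - d * v ^ 2) := even_iff_two_dvd.2 (by exact_mod_cast h1)
        simp only [Int.even_sub, Int.even_mul, Int.even_pow, hdd, ne_eq, OfNat.ofNat_ne_zero, not_false_eq_true, and_true, false_or] at h5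
        refine ⟨(u - v) / 2, ?_⟩
        rw [Int.even_iff, Int.even_iff] at h5
        omega
      obtain ⟨e, rfl⟩ := h2
      rw [Ideal.mem_span_pair]
      exact ⟨e, v, by push_cast; ring⟩)
    rw [hc]
    rcases ih m hmlt J hm0 hJ with e | e | e | e <;> rw [e]
    · simp
    · right; right; right; rw [mul_comm]
    · left; exact cT
    · right; left; rw [mul_comm (icl P), ← mul_assoc, cT, one_mul]
  -- unramified
  have hle : I ≤ Ideal.span {(l : R)} := by
    intro x hx
    obtain ⟨u, v, rfl⟩ := h.rep x
    obtain ⟨h1, h2⟩ := hcoef u v hx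
    have hn2 : ¬ (l : ℤ) ∣ 2 := by
      intro h3
      have : l ∣ 2 := by exact_mod_cast h3
      exact hl2 ((Nat.prime_dvd_prime_iff_eq hl Nat.prime_two).1 this)
    have hnd : ¬ (l : ℤ) ∣ d := by
      intro h3
      have : l ∣ p * q := by rw [← hd]; exact_mod_cast h3
      rcases hl.dvd_mul.1 this with h | h
      · exact hlp ((Nat.prime_dvd_prime_iff_eq hl hp).1 h)
      · exact hlq ((Nat.prime_dvd_prime_iff_eq hl hq).1 h)
    have huv : (l : ℤ) ∣ u ∧ (l : ℤ) ∣ v := by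
      rcases hl'.dvd_or_dvd h2 with h3 | h3
      · have hu : (l : ℤ) ∣ u := (hl'.dvd_or_dvd h3).resolve_left hn2
        refine ⟨hu, ?_⟩
        have h4 : (l : ℤ) ∣ d * v ^ 2 := by
          have := dvd_sub (dvd_pow hu two_ne_zero) h1
          simpa using this
        exact hl'.dvd_of_dvd_pow ((hl'.dvd_or_dvd h4).resolve_left hnd)
      · refine ⟨?_, h3⟩
        have h4 : (l : ℤ) ∣ u ^ 2 := by
          have := dvd_add h1 (Dvd.dvd.mul_left (dvd_pow h3 two_ne_zero) (d : ℤ))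
          simpa using this
        exact hl'.dvd_of_dvd_pow h4
    obtain ⟨⟨u', rfl⟩, ⟨v', rfl⟩⟩ := huv
    rw [Ideal.mem_span_singleton]
    exact ⟨u' + v' * w, by push_cast; ring⟩
  obtain ⟨J, rfl⟩ := Ideal.dvd_iff_le.2 hle
  have hJ : Ideal.span {(l : R)} * (J * J) = Ideal.span {(m : R)} := by
    apply mul_left_cancel₀ (spz _ (hz _ hl.ne_zero))
    rw [Ideal.span_singleton_mul_span_singleton, ← Nat.cast_mul, ← hI]
    ring
  have hlm : l ∣ m := by
    have h7 : (m : R) ∈ Ideal.span {(l : R)} * (J * J) := by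
      rw [hJ]; exact Ideal.mem_span_singleton_self _
    have h8 : (m : R) ∈ Ideal.span {(l : R)} := (Ideal.dvd_iff_le.1 (Dvd.intro _ rfl) : Ideal.span {(l : R)} * (J * J) ≤ Ideal.span {(l : R)}) h7
    rw [Ideal.mem_span_singleton] at h8
    have h9 := (h.dvd (l := l) (u := m) (v := 0) (by push_cast; rw [zero_mul, add_zero]; exact h8)).1
    exact Int.natCast_dvd_natCast.1 h9
  obtain ⟨m', rfl⟩ := hlm
  have hJ' : J * J = Ideal.span {(m' : R)} := by
    apply mul_left_cancel₀ (spz _ (hz _ hl.ne_zero))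
    rw [hJ, Ideal.span_singleton_mul_span_singleton, ← Nat.cast_mul]
  have hm'0 : m' ≠ 0 := by rintro rfl; simp at hm0
  have hcI : icl (Ideal.span {(l : R)} * J) = icl J := by
    rw [icl_mul (left_ne_zero_of_mul hI0) (right_ne_zero_of_mul hI0), icl_span, one_mul]
  rw [hcI]
  apply ih m' _ J hm'0 hJ'
  have := hl.one_lt
  have := Nat.pos_of_ne_zero hm'0
  nlinarith

end quad

lemma int_desc {A : ℤ → ℤ → ℤ → Prop} {m : ℕ} (hm : 1 < m)
    (h : ∀ u v w, A u v w → ∃ u' v' w', A u' v' w' ∧ w = m * w') (u v w : ℤ) (hA : A u v w) : w = 0 := by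
  have : ∀ N : ℕ, ∀ u v w, A u v w → w.natAbs < N → w = 0 := by
    intro N
    induction N with
    | zero => intro u v w _ h; omega
    | succ N ih =>
      intro u v w hA hw
      obtain ⟨u', v', w', hA', rfl⟩ := h u v w hA
      by_cases h0 : w' = 0
      · simp [h0]
      rw [ih u' v' w' hA' ?_, mul_zero]
      have h1 : 0 < w'.natAbs := Int.natAbs_pos.2 h0
      rw [Int.natAbs_mul, Int.natAbs_natCast] at hw
      nlinarith
  exact this _ u v w hA (Nat.lt_succ_self _)

lemma desc4 {d E : ℤ} (hd : d % 4 = 1) (hE : E % 4 = 3) (u v w : ℤ) (h : u ^ 2 + d * v ^ 2 = E * w ^ 2) :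
    w = 0 := by
  refine int_desc (A := fun u v w => u ^ 2 + d * v ^ 2 = E * w ^ 2) one_lt_two ?_ u v w h
  clear h u v w
  intro u v w h
  obtain ⟨d', rfl⟩ : ∃ d', d = 4 * d' + 1 := ⟨d / 4, by omega⟩
  obtain ⟨E', rfl⟩ : ∃ d', E = 4 * d' + 3 := ⟨E / 4, by omega⟩
  have sq : ∀ x : ℤ, (∃ y, x = 2 * y) ∨ ∃ z, x ^ 2 = 4 * z + 1 := by
    intro x
    rcases Int.even_or_odd' x with ⟨y, rfl | rfl⟩
    · exact Or.inl ⟨y, rfl⟩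
    · exact Or.inr ⟨y ^ 2 + y, by ring⟩
  rcases sq u with ⟨u, rfl⟩ | ⟨z1, h1⟩ <;> rcases sq v with ⟨v, rfl⟩ | ⟨z2, h2⟩ <;>
    rcases sq w with ⟨w, rfl⟩ | ⟨z3, h3⟩
  · exact ⟨u, v, w, by linarith, rfl⟩
  all_goals exfalso; ring_nf at h; try rw [h1] at h
  all_goals try rw [h2] at h
  all_goals try rw [h3] at h
  all_goals ring_nf at h; omega

lemma desc8 {d E : ℤ} (hd : d % 8 = 1) (hE : E % 8 = 6) (u v w : ℤ) (h : u ^ 2 + d * v ^ 2 = E * w ^ 2) :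
    w = 0 := by
  refine int_desc (A := fun u v w => u ^ 2 + d * v ^ 2 = E * w ^ 2) one_lt_two ?_ u v w h
  clear h u v w
  intro u v w h
  obtain ⟨d', rfl⟩ : ∃ d', d = 8 * d' + 1 := ⟨d / 8, by omega⟩
  obtain ⟨E', rfl⟩ : ∃ d', E = 8 * d' + 6 := ⟨E / 8, by omega⟩
  have sq : ∀ x : ℤ, (∃ y, x = 2 * y) ∨ ∃ z, x ^ 2 = 8 * z + 1 := by
    intro x
    rcases Int.even_or_odd' x with ⟨y, rfl | rfl⟩
    · exact Or.inl ⟨y, rfl⟩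
    · rcases Int.even_or_odd' y with ⟨y, rfl | rfl⟩
      · exact Or.inr ⟨2 * y ^ 2 + y, by ring⟩
      · exact Or.inr ⟨2 * y ^ 2 + 3 * y + 1, by ring⟩
  have sq2 : ∀ x : ℤ, ∃ z, x ^ 2 = 2 * z ∨ x ^ 2 = 2 * z + 1 := by
    intro x
    exact ⟨x ^ 2 / 2, by omega⟩
  rcases sq u with ⟨u, rfl⟩ | ⟨z1, h1⟩ <;> rcases sq v with ⟨v, rfl⟩ | ⟨z2, h2⟩ <;>
    rcases sq w with ⟨w, rfl⟩ | ⟨z3, h3⟩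
  · exact ⟨u, v, w, by linarith, rfl⟩
  all_goals exfalso; ring_nf at h; try rw [h1] at h
  all_goals try rw [h2] at h
  all_goals try rw [h3] at h
  all_goals ring_nf at h; omega

lemma descp {p q : ℕ} (hp : p.Prime) (hq : q.Prime) (hpq : p ≠ q) (hp5 : p % 8 = 5) (u v w : ℤ)
    (h : u ^ 2 + (p * q : ℕ) * v ^ 2 = 2 * w ^ 2) : w = 0 := by
  refine int_desc (A := fun u v w => u ^ 2 + (p * q : ℕ) * v ^ 2 = 2 * w ^ 2) hp.one_lt ?_ u v w h
  clear h u v w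
  intro u v w h
  have := Fact.mk hp
  have hp' : Prime (p : ℤ) := Nat.prime_iff_prime_int.1 hp
  push_cast at h
  have hpw : (p : ℤ) ∣ w := by
    by_contra hw
    have hw' : (w : ZMod p) ≠ 0 := by
      rwa [Ne, ZMod.intCast_zmod_eq_zero_iff_dvd]
    have : IsSquare (2 : ZMod p) := by
      have h2 := congrArg (Int.cast : ℤ → ZMod p) h
      push_cast at h2
      rw [ZMod.natCast_self, zero_mul, zero_mul, add_zero] at h2
      refine ⟨u / w, ?_⟩
      field_simp
      exact h2.symm
    rw [ZMod.exists_sq_eq_two_iff (by omega)] at this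
    omega
  obtain ⟨w', rfl⟩ := hpw
  have hu : (p : ℤ) ∣ u := by
    apply hp'.dvd_of_dvd_pow (n := 2)
    exact ⟨2 * p * w' ^ 2 - q * v ^ 2, by linear_combination h⟩
  obtain ⟨u', rfl⟩ := hu
  have hv : (p : ℤ) ∣ v := by
    have h1 : (p : ℤ) ∣ q * v ^ 2 := by
      refine ⟨2 * w' ^ 2 - u' ^ 2, ?_⟩
      have : (p : ℤ) * (q * v ^ 2) = p * (p * (2 * w' ^ 2 - u' ^ 2)) := by linear_combination h
      exact mul_left_cancel₀ hp'.ne_zero this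
    rcases hp'.dvd_or_dvd h1 with h2 | h2
    · exfalso
      have : p ∣ q := by exact_mod_cast h2
      exact hpq ((Nat.prime_dvd_prime_iff_eq hp hq).1 this)
    · exact hp'.dvd_of_dvd_pow h2
  obtain ⟨v', rfl⟩ := hv
  refine ⟨u', v', w', ?_, rfl⟩
  have : ((p : ℤ) ^ 2) * (u' ^ 2 + (p * q : ℕ) * v' ^ 2) = p ^ 2 * (2 * w' ^ 2) := by
    push_cast
    linear_combination h
  exact mul_left_cancel₀ (pow_ne_zero 2 hp'.ne_zero) this

section quad
variable {R : Type*} [CommRing R] {d : ℕ} {w : R} [IsDedekindDomain R]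

lemma IsQuad.spz {x : R} (hx : x ≠ 0) : Ideal.span {x} ≠ 0 := by
  simpa [Ideal.zero_eq_bot, Ideal.span_singleton_eq_bot] using hx

lemma IsQuad.natCast_ne (h : IsQuad R d w) (m : ℕ) (hm : m ≠ 0) : (m : R) ≠ 0 := by
  intro h0
  exact hm (by exact_mod_cast h.cast_inj (u := m) (v := 0) (by simpa using h0))

variable [Module.Free ℤ R] [Module.Finite ℤ R]

lemma IsQuad.absNorm (h : IsQuad R d w) (u v : ℤ) :
    ((Ideal.absNorm (Ideal.span {(u : R) + v * w}) : ℕ) : ℤ) = u ^ 2 + d * v ^ 2 := by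
  rw [Ideal.absNorm_span_singleton, h.norm]
  exact Int.natAbs_of_nonneg (by positivity)

lemma IsQuad.absNorm_sq (h : IsQuad R d w) {I : Ideal R} {a : ℕ} (hI : I * I = Ideal.span {(a : R)}) :
    Ideal.absNorm I = a := by
  have h1 := congrArg Ideal.absNorm hI
  rw [map_mul] at h1
  have h2 := h.absNorm a 0
  simp only [Int.cast_natCast, Int.cast_zero, zero_mul, add_zero] at h2
  rw [← h1] at h2
  push_cast at h2
  have : (Ideal.absNorm I) ^ 2 = a ^ 2 := by
    zify; linear_combination h2
  exact Nat.pow_left_injective two_ne_zero this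

lemma IsQuad.two_tors (h : IsQuad R d w) {p q : ℕ} (hp : p.Prime) (hq : q.Prime) (hpq : p ≠ q)
    (hd : d = p * q) (hd4 : d % 4 = 1) (c : ClassGroup R) (hc : c ^ 2 = 1) :
      c = 1 ∨ c = icl (Ideal.span {(p : R), w}) ∨ c = icl (Ideal.span {(2 : R), 1 + w}) ∨
      c = icl (Ideal.span {(p : R), w}) * icl (Ideal.span {(2 : R), 1 + w}) := by
  obtain ⟨I, hI, rfl⟩ := icl_surj c
  rw [pow_two, ← icl_mul hI hI] at hc
  have hA0 : Ideal.absNorm I ≠ 0 := by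
    rw [Ne, Ideal.absNorm_eq_zero_iff]; exact hI
  set A := Ideal.absNorm I with hA
  have hg : ∃ γ : R, I * I = Ideal.span {γ} ∧ γ + (A : R) ≠ 0 := by
    obtain ⟨γ, -, hγ⟩ := icl_eq_one (mul_ne_zero hI hI) hc
    by_cases h0 : γ + (A : R) = 0
    · refine ⟨-γ, by rw [Ideal.span_singleton_neg, hγ], ?_⟩
      have : γ = -(A : R) := by linear_combination h0
      rw [this, neg_neg, ← Nat.cast_add]
      exact h.natCast_ne _ (by omega)
    · exact ⟨γ, hγ, h0⟩
  obtain ⟨γ, hγ, hδ⟩ := hg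
  obtain ⟨u, v, rfl⟩ := h.rep γ
  have hN : u ^ 2 + d * v ^ 2 = (A : ℤ) ^ 2 := by
    rw [← h.absNorm u v, ← hγ, map_mul]; push_cast; ring
  have hNR := congrArg (Int.cast : ℤ → R) hN
  push_cast at hNR
  set δ := (u : R) + v * w + (A : R) with hδdef
  have hδ2 : δ * δ = ((u : R) + v * w) * ((2 * u + 2 * A : ℤ) : R) := by
    rw [hδdef]; push_cast
    linear_combination (-1 : R) * hNR + ((v:R) ^ 2) * h.sq
  have hdiv : I ∣ Ideal.span {δ} := by
    rw [← UniqueFactorizationMonoid.pow_dvd_pow_iff_dvd two_ne_zero, pow_two, pow_two, hγ, Ideal.span_singleton_mul_span_singleton, hδ2,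
      ← Ideal.span_singleton_mul_span_singleton]
    exact Dvd.intro _ rfl
  obtain ⟨J, hJ⟩ := hdiv
  have hJ0 : J ≠ 0 := by
    rintro rfl
    rw [mul_zero] at hJ
    exact IsQuad.spz hδ hJ
  have hJJ : J * J = Ideal.span {(((2 * u + 2 * A : ℤ).natAbs : ℕ) : R)} := by
    have h1 : Ideal.span {(((2 * u + 2 * A : ℤ).natAbs : ℕ) : R)} = Ideal.span {((2 * u + 2 * A : ℤ) : R)} := by
      rcases Int.natAbs_eq (2 * u + 2 * A : ℤ) with h2 | h2
      · conv_rhs => rw [h2]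
        rw [Int.cast_natCast]
      · conv_rhs => rw [h2]
        rw [Int.cast_neg, Ideal.span_singleton_neg, Int.cast_natCast]
    rw [h1]
    apply mul_left_cancel₀ (mul_ne_zero hI hI)
    have : I * I * (J * J) = Ideal.span {δ} * Ideal.span {δ} := by rw [hJ]; ring
    rw [this, Ideal.span_singleton_mul_span_singleton, hδ2, ← Ideal.span_singleton_mul_span_singleton, hγ]
  have hm : (2 * u + 2 * A : ℤ).natAbs ≠ 0 := by
    intro h0
    rw [h0, Nat.cast_zero] at hJJ
    have : J * J = 0 := by rw [hJJ]; simp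
    exact hJ0 (mul_self_eq_zero.1 this)
  have hIJ : icl I = icl J := by
    have h1 : icl I * icl J = 1 := by rw [← icl_mul hI hJ0, ← hJ, icl_span]
    rw [icl_mul hI hI] at hc
    exact mul_left_cancel (hc.trans h1.symm)
  rw [hIJ]
  exact h.two_tors_aux hp hq hpq hd hd4 _ J hm hJJ

lemma IsQuad.nonsq (h : IsQuad R d w) {I : Ideal R} (hI : I ≠ 0) (y : ClassGroup R) (hy : y ^ 2 = icl I) :
    ∃ u v W : ℤ, W ≠ 0 ∧ u ^ 2 + d * v ^ 2 = (Ideal.absNorm I : ℤ) * W ^ 2 := by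
  obtain ⟨J, hJ, rfl⟩ := icl_surj y
  rw [pow_two, ← icl_mul hJ hJ] at hy
  obtain ⟨a, b, ha, hb, e⟩ := icl_eq hI (mul_ne_zero hJ hJ) hy.symm
  have e1 := congrArg Ideal.absNorm e
  rw [map_mul, map_mul, map_mul] at e1
  set E := Ideal.absNorm I
  obtain ⟨u, v, huv⟩ := h.rep ((E : R) * (a * b))
  refine ⟨u, v, (Ideal.absNorm (Ideal.span {b}) * Ideal.absNorm J : ℕ), ?_, ?_⟩
  · have h1 : Ideal.absNorm (Ideal.span {b}) ≠ 0 := by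
      rw [Ne, Ideal.absNorm_eq_zero_iff]; exact IsQuad.spz hb
    have h2 : Ideal.absNorm J ≠ 0 := by
      rw [Ne, Ideal.absNorm_eq_zero_iff]; exact hJ
    exact_mod_cast mul_ne_zero h1 h2
  · rw [← h.absNorm u v, ← huv, ← Ideal.span_singleton_mul_span_singleton,
      ← Ideal.span_singleton_mul_span_singleton, map_mul, map_mul]
    have h3 := h.absNorm E 0
    simp only [Int.cast_natCast, Int.cast_zero, zero_mul, add_zero] at h3
    push_cast
    rw [h3]
    have e2 := congrArg (Nat.cast : ℕ → ℤ) e1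
    push_cast at e2
    linear_combination (E * Ideal.absNorm (Ideal.span {b}) : ℤ) * e2

end quad

section quad
variable {R : Type*} [CommRing R] {d : ℕ} {w : R} [IsDedekindDomain R]
variable [Module.Free ℤ R] [Module.Finite ℤ R]

lemma IsQuad.unit (h : IsQuad R d w) (hd : 2 ≤ d) (x : Rˣ) : (x : R) = 1 ∨ (x : R) = -1 := by
  have h1 : Ideal.absNorm (Ideal.span {(x : R)}) = 1 := by
    rw [Ideal.absNorm_eq_one_iff, Ideal.span_singleton_eq_top]; exact x.isUnit
  obtain ⟨u, v, huv⟩ := h.rep (x : R)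
  rw [huv] at h1 ⊢
  have h2 := h.absNorm u v
  rw [h1] at h2
  have hd' : (2 : ℤ) ≤ d := by exact_mod_cast hd
  have hv : v = 0 := by
    by_contra hv
    have : 1 ≤ v ^ 2 := by
      have := sq_pos_of_ne_zero hv; linarith
    push_cast at h2
    nlinarith [sq_nonneg u]
  subst hv
  have hu : u ^ 2 = 1 := by push_cast at h2; linarith
  rcases (mul_self_eq_one_iff.1 (by rw [← pow_two]; exact hu) : u = 1 ∨ u = -1) with h3 | h3
  · left; simp [h3]
  · right; simp [h3]

lemma IsQuad.main (h : IsQuad R d w) [Finite (ClassGroup R)] {p q n l : ℕ} (hp : p.Prime) (hq : q.Prime)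
    (hd : d = p * q) (hp5 : p % 8 = 5) (hq5 : q % 8 = 5) (hn : n % 4 = 3) (hl : 2 ≤ l)
    (hpq : p + q = 2 * n ^ (2 ^ (l - 1))) (P : Sylow 2 (ClassGroup R)) :
    Nonempty ((P : Subgroup (ClassGroup R)) ≃* Multiplicative (ZMod 2 × ZMod (2 ^ l))) := by
  have hne : p ≠ q := by
    rintro rfl
    have h1 : p = n ^ (2 ^ (l - 1)) := by omega
    rw [h1] at hp
    exact Nat.Prime.not_prime_pow (Nat.one_lt_two_pow (by omega)) hp
  have hcop : p.Coprime q := (Nat.coprime_primes hp hq).2 hne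
  have hd8 : d % 8 = 1 := by rw [hd, Nat.mul_mod, hp5, hq5]
  have hd2 : 2 ≤ d := by
    by_contra h0
    have : d = 1 := by omega
    rw [this] at hd
    have := Nat.eq_one_of_mul_eq_one_right hd.symm
    omega
  set k := 2 ^ (l - 1) with hk
  have hk2 : 2 ^ l = 2 * k := by rw [hk, ← pow_succ', show l - 1 + 1 = l by omega]
  obtain ⟨e, he⟩ : ∃ e : ℤ, (p : ℤ) = q + 2 * e := ⟨((p : ℤ) - q) / 2, by omega⟩
  have hpqz : (p : ℤ) + q = 2 * n ^ k := by exact_mod_cast hpq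
  have hnorm : e ^ 2 + d = (n : ℤ) ^ (2 * k) := by
    have h1 : (n : ℤ) ^ k = q + e := by linarith
    rw [mul_comm, pow_mul, h1, hd]; push_cast; rw [he]; ring
  have hnormR := congrArg (Int.cast : ℤ → R) hnorm
  push_cast at hnormR
  have hcopen : IsCoprime (2 * e) ((n : ℤ) ^ (2 * k)) := by
    apply IsCoprime.pow_right
    rw [Int.isCoprime_iff_gcd_eq_one]
    by_contra hg
    obtain ⟨r, hr, hrg⟩ := Nat.exists_prime_and_dvd hg
    have h1 : (r : ℤ) ∣ 2 * e := (Int.natCast_dvd_natCast.2 hrg).trans (Int.gcd_dvd_left _ _)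
    have h2 : (r : ℤ) ∣ n := (Int.natCast_dvd_natCast.2 hrg).trans (Int.gcd_dvd_right _ _)
    have h3 : (r : ℤ) ∣ p + q := by
      rw [hpqz]; exact Dvd.dvd.mul_left (dvd_pow h2 (by rw [hk]; positivity)) _
    have h4 : (r : ℤ) ∣ 2 * p := by
      have := dvd_add h3 h1
      rwa [show (p : ℤ) + q + 2 * e = 2 * p by linarith] at this
    have h5 : (r : ℤ) ∣ 2 * q := by
      have := dvd_sub h3 h1
      rwa [show (p : ℤ) + q - 2 * e = 2 * q by linarith] at this
    have h4' : r ∣ 2 * p := by exact_mod_cast h4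
    have h5' : r ∣ 2 * q := by exact_mod_cast h5
    have h2' : r ∣ n := by exact_mod_cast h2
    have hr2 : ¬ r ∣ 2 := by
      intro h6
      rw [(Nat.prime_dvd_prime_iff_eq hr Nat.prime_two).1 h6] at h2'
      omega
    have h7 := (hr.dvd_mul.1 h4').resolve_left hr2
    have h8 := (hr.dvd_mul.1 h5').resolve_left hr2
    have := Nat.dvd_gcd h7 h8
    rw [hcop] at this
    exact hr.one_lt.ne' (Nat.dvd_one.1 this)
  obtain ⟨a, b, hab⟩ := hcopen
  have habR := congrArg (Int.cast : ℤ → R) hab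
  push_cast at habR
  have hIc : IsCoprime (Ideal.span {(e : R) + w}) (Ideal.span {(e : R) - w}) := by
    rw [Ideal.isCoprime_span_singleton_iff]
    refine ⟨a + b * (e - w), a, ?_⟩
    linear_combination habR + b * hnormR - b * h.sq
  have hmul : Ideal.span {(e : R) + w} * Ideal.span {(e : R) - w} = (Ideal.span {(n : R)}) ^ (2 * k) := by
    rw [Ideal.span_singleton_mul_span_singleton, Ideal.span_singleton_pow, ← hnormR]
    congr 2
    linear_combination -h.sq
  obtain ⟨N, hN⟩ := exists_eq_pow_of_mul_eq_pow_of_coprime hIc hmul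
  have hk0 : k ≠ 0 := by rw [hk]; positivity
  have hβ0 : (e : R) + w ≠ 0 := by
    intro h0
    have := h.inj e 1 (by simpa using h0)
    omega
  have hN0 : N ≠ 0 := by
    rintro rfl
    rw [zero_pow (by omega)] at hN
    exact IsQuad.spz hβ0 hN
  have hNn : Ideal.absNorm N = n := by
    have h1 := h.absNorm e 1
    rw [Int.cast_one, one_mul, hN, map_pow, one_pow, mul_one, hnorm] at h1
    have h2 : (Ideal.absNorm N) ^ (2 * k) = n ^ (2 * k) := by exact_mod_cast h1
    exact Nat.pow_left_injective (n := 2 * k) (by omega) h2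
  set Pp := Ideal.span {(p : R), w} with hPp
  set T := Ideal.span {(2 : R), 1 + w} with hT
  have hPP := h.sq_p hcop hd
  have hTT := h.sq_two (by omega)
  have nPp : Ideal.absNorm Pp = p := h.absNorm_sq hPP
  have nT : Ideal.absNorm T = 2 := h.absNorm_sq (by simpa using hTT)
  have hP0 : Pp ≠ 0 := by
    intro h0
    rw [h0, Ideal.zero_eq_bot, Ideal.absNorm_bot] at nPp
    exact hp.ne_zero nPp.symm
  have hT0 : T ≠ 0 := by
    intro h0
    rw [h0, Ideal.zero_eq_bot, Ideal.absNorm_bot] at nT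
    omega
  refine F_group l hl P (icl N) (icl T) (icl Pp) ?_ ?_ ?_ ?_ ?_ ?_
  · rw [← icl_pow hN0, hk2, ← hN, icl_span]
  · intro h1
    rw [← hk, ← icl_pow hN0] at h1
    obtain ⟨γ, -, hγ⟩ := icl_eq_one (pow_ne_zero _ hN0) h1
    have h2 : Ideal.span {γ * γ} = Ideal.span {(e : R) + w} := by
      rw [← Ideal.span_singleton_mul_span_singleton, ← hγ, hN, ← pow_add, two_mul]
    rw [Ideal.span_singleton_eq_span_singleton] at h2
    obtain ⟨x, hx⟩ := h2
    obtain ⟨s, t, rfl⟩ := h.rep γ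
    rcases h.unit hd2 x with h3 | h3
    · have := (h.ext (u := s ^ 2 - d * t ^ 2) (v := 2 * s * t) (u' := e) (v' := 1) (by
        rw [h3] at hx
        push_cast
        linear_combination hx - (t ^ 2 : R) * h.sq)).2
      rw [mul_assoc] at this
      omega
    · have := (h.ext (u := s ^ 2 - d * t ^ 2) (v := 2 * s * t) (u' := -e) (v' := -1) (by
        rw [h3] at hx
        push_cast
        linear_combination -hx - (t ^ 2 : R) * h.sq)).2
      rw [mul_assoc] at this
      omega
  · rw [pow_two, ← icl_mul hT0 hT0, hTT, icl_span]
  · intro c hc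
    exact h.two_tors hp hq hne hd (by omega) c hc
  · intro y hy
    obtain ⟨u, v, W, hW, e⟩ := h.nonsq hT0 y hy
    rw [nT, hd] at e
    exact hW (descp hp hq hne hp5 u v W (by simpa using e))
  · intro s hs y hy
    have hdz : (d : ℤ) % 8 = 1 := by exact_mod_cast congrArg (Nat.cast : ℕ → ℤ) hd8
    rcases h.two_tors hp hq hne hd (by omega) s hs with h1 | h1 | h1 | h1
    · rw [h1, mul_one] at hy
      obtain ⟨u, v, W, hW, e⟩ := h.nonsq hN0 y hy
      rw [hNn] at e
      exact hW (desc4 (by omega) (by omega) u v W e)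
    · rw [h1, ← icl_mul hN0 hP0] at hy
      obtain ⟨u, v, W, hW, e⟩ := h.nonsq (mul_ne_zero hN0 hP0) y hy
      rw [map_mul, hNn, nPp] at e
      refine hW (desc4 (by omega) ?_ u v W e)
      have : (n * p) % 4 = 3 := by rw [Nat.mul_mod, hn, show p % 4 = 1 by omega]
      omega
    · rw [h1, ← icl_mul hN0 hT0] at hy
      obtain ⟨u, v, W, hW, e⟩ := h.nonsq (mul_ne_zero hN0 hT0) y hy
      rw [map_mul, hNn, nT] at e
      exact hW (desc8 (by omega) (by omega) u v W e)
    · rw [h1, ← icl_mul hP0 hT0, ← icl_mul hN0 (mul_ne_zero hP0 hT0)] at hy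
      obtain ⟨u, v, W, hW, e⟩ := h.nonsq (mul_ne_zero hN0 (mul_ne_zero hP0 hT0)) y hy
      rw [map_mul, map_mul, hNn, nT, nPp, ← mul_assoc] at e
      refine hW (desc8 (by omega) ?_ u v W e)
      have : (n * p) % 4 = 3 := by rw [Nat.mul_mod, hn, show p % 4 = 1 by omega]
      omega

end quad

lemma K_isQuad {d : ℕ} (hd : Squarefree d) (hd4 : d % 4 = 1) (hd2 : 2 ≤ d) (K : Type) [Field K] [NumberField K] (α : K)
    (hα : α ^ 2 = -(d : K)) (htop : IntermediateField.adjoin ℚ {α} = ⊤) :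
    ∃ w : 𝓞 K, IsQuad (𝓞 K) d w := by
  have hint : IsIntegral ℤ α := by
    refine ⟨Polynomial.X ^ 2 + Polynomial.C (d : ℤ), Polynomial.monic_X_pow_add_C _ two_ne_zero, ?_⟩
    simp [hα]
  have hintQ : IsIntegral ℚ α := hint.tower_top
  have hrep : ∀ x : K, ∃ a b : ℚ, x = a + b * α := by
    intro x
    have hx : x ∈ Algebra.adjoin ℚ {α} := by
      rw [← IntermediateField.adjoin_simple_toSubalgebra_of_isAlgebraic hintQ.isAlgebraic, htop]
      trivial
    induction hx using Algebra.adjoin_induction with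
    | mem x hx => exact ⟨0, 1, by simpa using hx⟩
    | algebraMap r => exact ⟨r, 0, by simp⟩
    | add x y _ _ hx hy =>
      obtain ⟨a, b, rfl⟩ := hx
      obtain ⟨a', b', rfl⟩ := hy
      exact ⟨a + a', b + b', by push_cast; ring⟩
    | mul x y _ _ hx hy =>
      obtain ⟨a, b, rfl⟩ := hx
      obtain ⟨a', b', rfl⟩ := hy
      exact ⟨a * a' - d * b * b', a * b' + a' * b, by push_cast; linear_combination (b * b' : K) * hα⟩
  have hposs : ∀ r : ℚ, r ^ 2 ≠ (-(d : ℚ)) + 0 * r := by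
    intro r hr
    have : (2 : ℚ) ≤ d := by exact_mod_cast hd2
    nlinarith [sq_nonneg r]
  haveI : Fact (∀ r : ℚ, r ^ 2 ≠ (-(d : ℚ)) + 0 * r) := ⟨hposs⟩
  let φ : QuadraticAlgebra ℚ (-(d : ℚ)) 0 →ₐ[ℚ] K := QuadraticAlgebra.lift ⟨α, by
    rw [← pow_two, hα]; simp [Algebra.smul_def]⟩
  have hφ : ∀ a b : ℚ, φ ⟨a, b⟩ = a + b * α := by
    intro a b
    simp [φ, QuadraticAlgebra.lift, Algebra.smul_def]
    rfl
  have hinj : Function.Injective φ := φ.toRingHom.injective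
  have hsurj : Function.Surjective φ := by
    intro x
    obtain ⟨a, b, rfl⟩ := hrep x
    exact ⟨⟨a, b⟩, hφ a b⟩
  have hinj' : ∀ a b : ℚ, (a : K) + b * α = 0 → a = 0 ∧ b = 0 := by
    intro a b h0
    have h1 : (⟨a, b⟩ : QuadraticAlgebra ℚ (-(d : ℚ)) 0) = 0 := hinj (by rw [hφ, h0, map_zero])
    exact ⟨congrArg QuadraticAlgebra.re h1, congrArg QuadraticAlgebra.im h1⟩
  let e := AlgEquiv.ofBijective φ ⟨hinj, hsurj⟩
  let ψ : QuadraticAlgebra ℚ (-(d : ℚ)) 0 →ₐ[ℚ] K := QuadraticAlgebra.lift ⟨-α, by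
    rw [← pow_two, neg_sq, hα]; simp [Algebra.smul_def]⟩
  have hψ : ∀ a b : ℚ, ψ ⟨a, b⟩ = a - b * α := by
    intro a b
    simp [ψ, QuadraticAlgebra.lift, Algebra.smul_def, sub_eq_add_neg]
    rfl
  let σ : K →ₐ[ℚ] K := ψ.comp e.symm.toAlgHom
  have hσ : ∀ a b : ℚ, σ (a + b * α) = a - b * α := by
    intro a b
    rw [← hφ, ← hψ]
    have : e.symm (φ ⟨a, b⟩) = ⟨a, b⟩ := e.symm_apply_apply _
    simp only [σ, AlgHom.comp_apply]
    exact congrArg ψ this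
  have hIntCast : ∀ r : ℚ, IsIntegral ℤ (r : K) → ∃ z : ℤ, r = z := by
    intro r hr
    have h1 : IsIntegral ℤ r := by
      rw [← isIntegral_algebraMap_iff (algebraMap ℚ K).injective]
      simpa using hr
    obtain ⟨z, hz⟩ := IsIntegrallyClosed.isIntegral_iff.1 h1
    exact ⟨z, by simpa using hz.symm⟩
  obtain ⟨w, hw⟩ : ∃ w : 𝓞 K, (w : K) = α := ⟨⟨α, hint⟩, rfl⟩
  refine ⟨w, ?_, ?_, ?_⟩
  · apply RingOfIntegers.ext
    rw [pow_two] at hα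
    simpa [hw] using hα
  · intro x
    obtain ⟨a, b, hab⟩ := hrep (x : K)
    have hx : IsIntegral ℤ (x : K) := x.2
    have hx2 : IsIntegral ℤ (σ (x : K)) := hx.map (σ.restrictScalars ℤ)
    rw [hab] at hx hx2
    rw [hσ] at hx2
    obtain ⟨m, hm⟩ := hIntCast (2 * a) (by
      have e1 : ((2 * a : ℚ) : K) = (a + b * α) + (a - b * α) := by push_cast; ring
      rw [e1]; exact hx.add hx2)
    obtain ⟨N, hN⟩ := hIntCast (a ^ 2 + d * b ^ 2) (by
      have e1 : ((a ^ 2 + d * b ^ 2 : ℚ) : K) = (a + b * α) * (a - b * α) := by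
        push_cast; linear_combination (b ^ 2 : K) * hα
      rw [e1]; exact hx.mul hx2)
    have hr : (d : ℚ) * (2 * b) ^ 2 = (4 * N - m ^ 2 : ℤ) := by
      push_cast
      rw [← hN, ← hm]; ring
    obtain ⟨t, ht⟩ : ∃ t : ℤ, 2 * b = t := by
      set r := 2 * b
      have h1 : (d : ℤ) * r.num ^ 2 = (4 * N - m ^ 2) * (r.den : ℤ) ^ 2 := by
        have h2 : (d : ℚ) * (r.num : ℚ) ^ 2 = (4 * N - m ^ 2 : ℤ) * (r.den : ℚ) ^ 2 := by
          rw [← hr]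
          have h9 : r * (r.den : ℚ) = r.num := Rat.mul_den_eq_num r
          rw [← h9]; ring
        exact_mod_cast h2
      have h3 : (r.den : ℤ) ^ 2 ∣ (d : ℤ) * r.num ^ 2 := ⟨4 * N - m ^ 2, by rw [h1]; ring⟩
      have hc : IsCoprime ((r.den : ℤ) ^ 2) (r.num ^ 2) := by
        apply IsCoprime.pow
        rw [Int.isCoprime_iff_gcd_eq_one, Int.gcd_comm]
        exact r.reduced
      have h4 := hc.dvd_of_dvd_mul_right h3
      have h5 : r.den * r.den ∣ d := by
        rw [← pow_two]; exact_mod_cast h4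
      have h6 := Nat.isUnit_iff.1 (hd _ h5)
      exact ⟨r.num, by rw [eq_comm]; exact (Rat.den_eq_one_iff r).1 h6⟩
    rw [ht] at hr
    have h7 : (d : ℤ) * t ^ 2 = 4 * N - m ^ 2 := by exact_mod_cast hr
    obtain ⟨m', rfl⟩ : ∃ m', m = 2 * m' := by
      rcases Int.even_or_odd' m with ⟨y, rfl | rfl⟩
      · exact ⟨y, rfl⟩
      · exfalso
        obtain ⟨d', hd'⟩ : ∃ d', d = 4 * d' + 1 := ⟨d / 4, by omega⟩
        rw [hd'] at h7
        rcases Int.even_or_odd' t with ⟨z, rfl | rfl⟩ <;> push_cast at h7 <;> ring_nf at h7 <;> omega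
    obtain ⟨t', rfl⟩ : ∃ t', t = 2 * t' := by
      rcases Int.even_or_odd' t with ⟨y, rfl | rfl⟩
      · exact ⟨y, rfl⟩
      · exfalso
        obtain ⟨d', hd'⟩ : ∃ d', d = 4 * d' + 1 := ⟨d / 4, by omega⟩
        rw [hd'] at h7
        push_cast at h7; ring_nf at h7; omega
    refine ⟨m', t', ?_⟩
    apply RingOfIntegers.ext
    push_cast
    rw [hab]
    have ha : a = m' := by push_cast at hm; linarith
    have hb : b = t' := by push_cast at ht; linarith
    rw [ha, hb]; simp [hw]
  · intro u v huv
    have h1 := congrArg (algebraMap (𝓞 K) K) huv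
    have := hinj' u v (by simpa [hw] using h1)
    exact_mod_cast this

lemma F_main {p q n l : ℕ} (hp : p.Prime) (hq : q.Prime)
    (hp5 : p % 8 = 5) (hq5 : q % 8 = 5) (hn : n % 4 = 3) (hl : 2 ≤ l)
    (hpq : p + q = 2 * n ^ (2 ^ (l - 1))) : Squarefree (p * q) ∧
      twoClassGroupIso (p * q) (Multiplicative (ZMod 2 × ZMod (2 ^ l))) := by
  have hne : p ≠ q := by
    rintro rfl
    have h1 : p = n ^ (2 ^ (l - 1)) := by omega
    rw [h1] at hp
    exact Nat.Prime.not_prime_pow (Nat.one_lt_two_pow (by omega)) hp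
  have hcop : p.Coprime q := (Nat.coprime_primes hp hq).2 hne
  have hsf : Squarefree (p * q) := (Nat.squarefree_mul hcop).2 ⟨hp.squarefree, hq.squarefree⟩
  refine ⟨hsf, ?_⟩
  intro K _ _ α hα htop P
  have hd8 : (p * q) % 8 = 1 := by rw [Nat.mul_mod, hp5, hq5]
  obtain ⟨w, hw⟩ := K_isQuad hsf (by omega) (by nlinarith [hp.two_le, hq.two_le]) K α hα htop
  exact hw.main hp hq rfl hp5 hq5 hn hl hpq P

noncomputable def fK (x : ℝ) : ℝ := if x = 0 then 1 else 2 * (1 - Real.cos x) / x ^ 2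

lemma fK_nonneg (x : ℝ) : 0 ≤ fK x := by
  unfold fK
  split_ifs
  · norm_num
  · have := Real.cos_le_one x
    have : 0 ≤ 1 - Real.cos x := by linarith
    positivity

lemma fK_le_one (x : ℝ) : fK x ≤ 1 := by
  unfold fK
  split_ifs with h
  · norm_num
  · have := Real.one_sub_sq_div_two_le_cos (x := x)
    rw [div_le_one (by positivity)]
    linarith

lemma fK_le (x : ℝ) (h : x ≠ 0) : fK x ≤ 4 / x ^ 2 := by
  unfold fK
  rw [if_neg h]
  have := Real.neg_one_le_cos x
  gcongr
  linarith

lemma fK_ge (x : ℝ) (h : |x| ≤ 1) : 1 / 2 ≤ fK x := by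
  unfold fK
  split_ifs with h0
  · norm_num
  · have h1 := Real.cos_bound h
    have h2 := (abs_le.1 h1).2
    have h4 : |x| ^ 4 ≤ x ^ 2 := by
      rw [← sq_abs x]
      have := abs_nonneg x
      nlinarith [pow_le_one₀ this h (n := 2), sq_nonneg |x|]
    have h3 : 0 < x ^ 2 := by positivity
    rw [le_div_iff₀ h3]
    linarith

lemma fK_integral (x : ℝ) :
    ∫ t in (-1 : ℝ)..1, ((1 - |t| : ℝ) : ℂ) * Complex.exp (Complex.I * t * x) = fK x := by
  have hcont : Continuous (fun t : ℝ => ((1 - |t| : ℝ) : ℂ) * Complex.exp (Complex.I * t * x)) := by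
    fun_prop
  rw [← intervalIntegral.integral_add_adjacent_intervals (b := 0)
    (hcont.intervalIntegrable _ _) (hcont.intervalIntegrable _ _)]
  have e1 : ∫ t in (-1 : ℝ)..0, ((1 - |t| : ℝ) : ℂ) * Complex.exp (Complex.I * t * x)
      = ∫ t in (-1 : ℝ)..0, (1 + t : ℂ) * Complex.exp (Complex.I * t * x) := by
    apply intervalIntegral.integral_congr
    intro t ht
    rw [Set.uIcc_of_le (by norm_num)] at ht
    simp [abs_of_nonpos ht.2]
  have e2 : ∫ t in (0 : ℝ)..1, ((1 - |t| : ℝ) : ℂ) * Complex.exp (Complex.I * t * x)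
      = ∫ t in (0 : ℝ)..1, (1 - t : ℂ) * Complex.exp (Complex.I * t * x) := by
    apply intervalIntegral.integral_congr
    intro t ht
    rw [Set.uIcc_of_le (by norm_num)] at ht
    simp [abs_of_nonneg ht.1]
  rw [e1, e2]
  have hid : ∀ t : ℝ, HasDerivAt (fun t : ℝ => (t : ℂ)) 1 t := fun t => Complex.ofRealCLM.hasDerivAt
  by_cases hx : x = 0
  · subst hx
    have d1 : ∀ t : ℝ, HasDerivAt (fun t : ℝ => (t : ℂ) + t ^ 2 / 2) (1 + t : ℂ) t := by
      intro t
      have := (hid t).add (((hid t).pow 2).div_const 2)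
      convert! this using 1
      simp
    have d2 : ∀ t : ℝ, HasDerivAt (fun t : ℝ => (t : ℂ) - t ^ 2 / 2) (1 - t : ℂ) t := by
      intro t
      have := (hid t).sub (((hid t).pow 2).div_const 2)
      convert! this using 1
      simp
    simp only [Complex.ofReal_zero, mul_zero, Complex.exp_zero, mul_one]
    rw [intervalIntegral.integral_eq_sub_of_hasDerivAt (fun t _ => d1 t)
      (Continuous.intervalIntegrable (by fun_prop) _ _),
      intervalIntegral.integral_eq_sub_of_hasDerivAt (fun t _ => d2 t)
      (Continuous.intervalIntegrable (by fun_prop) _ _)]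
    simp [fK]; norm_num
  · have hx' : (x : ℂ) ≠ 0 := by exact_mod_cast hx
    have hix : Complex.I * x ≠ 0 := mul_ne_zero Complex.I_ne_zero hx'
    have dE : ∀ t : ℝ, HasDerivAt (fun t : ℝ => Complex.exp (Complex.I * t * x))
        (Complex.exp (Complex.I * t * x) * (Complex.I * x)) t := by
      intro t
      have := (((hid t).const_mul Complex.I).mul_const (x : ℂ)).cexp
      simpa using this
    have d1 : ∀ t : ℝ, HasDerivAt (fun t : ℝ => (1 + t : ℂ) * (Complex.exp (Complex.I * t * x) / (Complex.I * x)) - Complex.exp (Complex.I * t * x) / (Complex.I * x) ^ 2) ((1 + t : ℂ) * Complex.exp (Complex.I * t * x)) t := by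
      intro t
      have := (((hid t).const_add 1).mul ((dE t).div_const (Complex.I * x))).sub
        ((dE t).div_const ((Complex.I * x) ^ 2))
      convert! this using 1
      field_simp
      ring
    have d2 : ∀ t : ℝ, HasDerivAt (fun t : ℝ => (1 - t : ℂ) * (Complex.exp (Complex.I * t * x) / (Complex.I * x)) + Complex.exp (Complex.I * t * x) / (Complex.I * x) ^ 2) ((1 - t : ℂ) * Complex.exp (Complex.I * t * x)) t := by
      intro t
      have := (((hid t).const_sub 1).mul ((dE t).div_const (Complex.I * x))).add
        ((dE t).div_const ((Complex.I * x) ^ 2))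
      convert! this using 1
      field_simp
      ring
    rw [intervalIntegral.integral_eq_sub_of_hasDerivAt (fun t _ => d1 t)
      (Continuous.intervalIntegrable (by fun_prop) _ _),
      intervalIntegral.integral_eq_sub_of_hasDerivAt (fun t _ => d2 t)
      (Continuous.intervalIntegrable (by fun_prop) _ _)]
    rw [fK, if_neg hx]
    push_cast
    rw [Complex.cos, mul_pow, Complex.I_sq]
    have e1 : Complex.I * (1 : ℂ) * x = x * Complex.I := by ring
    have e2 : Complex.I * (-1 : ℂ) * x = -x * Complex.I := by ring
    rw [e1, e2]
    simp only [mul_zero, zero_mul, Complex.exp_zero]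
    field_simp
    ring

noncomputable def wE (H : ℂ → ℂ) (u σ : ℝ) : ℂ :=
  ∫ t in (-1 : ℝ)..1, ((1 - |t| : ℝ) : ℂ) * Complex.exp (Complex.I * t * u) * H (σ + Complex.I * t)

lemma wi_id (b : ℕ → ℝ) (H : ℂ → ℂ) 
    (hs : ∀ s : ℂ, 1 < s.re → LSeriesSummable (fun n => (b n : ℂ)) s)
    (hH : ∀ s : ℂ, 1 < s.re → LSeries (fun n => (b n : ℂ)) s = H s)
    (u σ : ℝ) (hσ : 1 < σ) :
    HasSum (fun n : ℕ => b n * (n : ℝ) ^ (-σ) * fK (u - Real.log n)) (wE H u σ).re := by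
  have key : HasSum (fun n : ℕ => ∫ t in (-1 : ℝ)..1, ((1 - |t| : ℝ) : ℂ) *
      Complex.exp (Complex.I * t * u) * LSeries.term (fun n => (b n : ℂ)) (σ + Complex.I * t) n)
      (wE H u σ) := by
    unfold wE
    apply intervalIntegral.hasSum_integral_of_dominated_convergence
      (fun n _ => ‖LSeries.term (fun n => (b n : ℂ)) σ n‖)
    · intro n
      apply Continuous.aestronglyMeasurable
      by_cases hn : n = 0
      · subst hn; simp; fun_prop
      · simp only [LSeries.term_of_ne_zero hn]
        have : ∀ t : ℝ, (n : ℂ) ^ ((σ : ℂ) + Complex.I * t) ≠ 0 := fun t => by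
          simp [Complex.cpow_eq_zero_iff, hn]
        have h2 : Continuous (fun t : ℝ => (n : ℂ) ^ ((σ : ℂ) + Complex.I * t)) := by
          apply Continuous.const_cpow (by fun_prop)
          left; exact_mod_cast hn
        exact Continuous.mul (by fun_prop) (Continuous.div₀ continuous_const h2 this)
    · intro n
      refine Filter.Eventually.of_forall fun t ht => ?_
      rw [Set.uIoc_of_le (by norm_num)] at ht
      rw [norm_mul, norm_mul, mul_assoc Complex.I, mul_comm Complex.I]
      have e1 : ‖Complex.exp (((t : ℂ) * u) * Complex.I)‖ = 1 := by
        rw [← Complex.ofReal_mul]; exact Complex.norm_exp_ofReal_mul_I _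
      rw [e1, mul_one, LSeries.norm_term_eq, LSeries.norm_term_eq]
      have e2 : ((σ : ℂ) + Complex.I * t).re = (σ : ℂ).re := by simp
      rw [e2, Complex.norm_real]
      apply mul_le_of_le_one_left
      · split_ifs <;> positivity
      · have : |t| ≤ 1 := abs_le.2 ⟨ht.1.le, ht.2⟩
        rw [Real.norm_eq_abs, abs_of_nonneg (by linarith)]
        linarith [abs_nonneg t]
    · refine Filter.Eventually.of_forall fun t ht => ?_
      exact (hs σ (by simpa using hσ)).norm
    · exact intervalIntegrable_const
    · refine Filter.Eventually.of_forall fun t ht => ?_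
      have hr : 1 < ((σ : ℂ) + Complex.I * t).re := by simpa using hσ
      rw [← hH _ hr]
      exact (hs _ hr).hasSum.mul_left _
  have := Complex.hasSum_re key
  convert! this using 1
  ext n
  by_cases hn : n = 0
  · subst hn
    rw [Nat.cast_zero, Real.zero_rpow (by linarith)]; simp
  · have hn' : (n : ℂ) ≠ 0 := by exact_mod_cast hn
    have hpos : (0 : ℝ) < n := by exact_mod_cast Nat.pos_of_ne_zero hn
    have : ∀ t : ℝ, ((1 - |t| : ℝ) : ℂ) *
      Complex.exp (Complex.I * t * u) * LSeries.term (fun n => (b n : ℂ)) (σ + Complex.I * t) n =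
      ((b n * (n : ℝ) ^ (-σ) : ℝ) : ℂ) * (((1 - |t| : ℝ) : ℂ) * Complex.exp (Complex.I * t * (u - Real.log n : ℝ))) := by
      intro t
      rw [LSeries.term_of_ne_zero hn, div_eq_mul_inv, ← Complex.cpow_neg, Complex.ofReal_mul,
        Complex.ofReal_cpow hpos.le, Complex.ofReal_natCast,
        Complex.cpow_def_of_ne_zero hn', Complex.cpow_def_of_ne_zero hn']
      have h1 : Complex.exp (Complex.log n * -((σ : ℂ) + Complex.I * t)) = Complex.exp (Complex.log n * ((-σ : ℝ) : ℂ)) * Complex.exp (-(Complex.log n * Complex.I * t)) := by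
        rw [← Complex.exp_add]; congr 1; push_cast; ring
      have h2 : Complex.exp (Complex.I * t * (u - Real.log n : ℝ)) = Complex.exp (Complex.I * t * u) * Complex.exp (-(Complex.log n * Complex.I * t)) := by
        rw [← Complex.exp_add, ← Complex.natCast_log]; congr 1; push_cast; ring
      rw [h1, h2]; ring
    simp_rw [this]
    rw [intervalIntegral.integral_const_mul, fK_integral, ← Complex.ofReal_mul, Complex.ofReal_re]

lemma wi_RL (H : ℂ → ℂ) (hH : ContinuousOn H {s | 1 ≤ s.re}) :
    (∃ M : ℝ, 0 < M ∧ ∀ u σ : ℝ, 1 ≤ σ → σ ≤ 2 → ‖wE H u σ‖ ≤ M) ∧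
    ∀ ε > 0, ∃ v0 : ℝ, ∃ η : ℝ, 0 < η ∧ ∀ v σ : ℝ, v0 ≤ v → 1 ≤ σ → σ ≤ 1 + η → ‖wE H v σ‖ ≤ ε := by
  have hcomp : IsCompact ((Set.Icc 1 2 : Set ℝ) ×ˢ (Set.Icc (-1) 1 : Set ℝ)) :=
    isCompact_Icc.prod isCompact_Icc
  have hG : ContinuousOn (fun z : ℝ × ℝ => H (z.1 + Complex.I * z.2))
      ((Set.Icc 1 2 : Set ℝ) ×ˢ (Set.Icc (-1) 1 : Set ℝ)) := by
    apply hH.comp (by fun_prop)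
    rintro ⟨x, y⟩ ⟨h1, h2⟩
    simpa using h1.1
  have hker : ∀ t : ℝ, ∀ u : ℝ, t ∈ Set.Ioc (-1 : ℝ) 1 →
      ‖((1 - |t| : ℝ) : ℂ) * Complex.exp (Complex.I * t * u)‖ ≤ 1 := by
    intro t u ht
    rw [norm_mul, mul_assoc Complex.I, mul_comm Complex.I]
    have e1 : ‖Complex.exp (((t : ℂ) * u) * Complex.I)‖ = 1 := by
      rw [← Complex.ofReal_mul]; exact Complex.norm_exp_ofReal_mul_I _
    have : |t| ≤ 1 := abs_le.2 ⟨ht.1.le, ht.2⟩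
    rw [e1, mul_one, Complex.norm_real, Real.norm_eq_abs, abs_of_nonneg (by linarith)]
    linarith [abs_nonneg t]
  have hcE : ∀ σ u : ℝ, 1 ≤ σ → σ ≤ 2 → ContinuousOn (fun t : ℝ => ((1 - |t| : ℝ) : ℂ) * Complex.exp (Complex.I * t * u) * H (σ + Complex.I * t)) (Set.Icc (-1) 1) := by
    intro σ u h1 h2
    apply ContinuousOn.mul (by fun_prop)
    exact hH.comp (by fun_prop) (fun t _ => by simpa using h1)
  constructor
  · obtain ⟨M, hM⟩ := hcomp.exists_bound_of_continuousOn hG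
    refine ⟨(|M| + 1) * 2, by positivity, ?_⟩
    intro u σ h1 h2
    have := intervalIntegral.norm_integral_le_of_norm_le_const (a := (-1 : ℝ)) (b := 1) (C := |M| + 1)
      (f := fun t : ℝ => ((1 - |t| : ℝ) : ℂ) * Complex.exp (Complex.I * t * u) * H (σ + Complex.I * t)) ?_
    · refine this.trans (le_of_eq ?_)
      norm_num
    · intro t ht
      rw [Set.uIoc_of_le (by norm_num)] at ht
      rw [norm_mul]
      have := hM (σ, t) ⟨⟨h1, h2⟩, ⟨ht.1.le, ht.2⟩⟩
      calc _ ≤ 1 * M := mul_le_mul (hker t u ht) this (norm_nonneg _) zero_le_one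
        _ ≤ |M| + 1 := by linarith [le_abs_self M]
  · intro ε hε
    have hU := hcomp.uniformContinuousOn_of_continuous hG
    rw [Metric.uniformContinuousOn_iff_le] at hU
    obtain ⟨δ, hδ, hU⟩ := hU (ε / 4) (by positivity)
    have hRL : Filter.Tendsto (fun v : ℝ => wE H v 1) Filter.atTop (nhds 0) := by
      have h0 := Real.tendsto_integral_exp_smul_cocompact
        (Set.indicator (Set.Ioc (-1 : ℝ) 1) fun t : ℝ => ((1 - |t| : ℝ) : ℂ) * H ((1 : ℝ) + Complex.I * t))
      have h1 : Filter.Tendsto (fun v : ℝ => v * (-(2 * Real.pi)⁻¹)) Filter.atTop (Filter.cocompact ℝ) := by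
        apply Filter.Tendsto.mono_right _ atBot_le_cocompact
        exact Filter.tendsto_id.atTop_mul_const_of_neg (by simp [Real.pi_pos])
      refine (h0.comp h1).congr fun v => ?_
      simp only [Function.comp]
      rw [wE, intervalIntegral.integral_of_le (by norm_num), ← MeasureTheory.integral_indicator measurableSet_Ioc]
      congr 1
      ext t
      by_cases ht : t ∈ Set.Ioc (-1 : ℝ) 1
      · rw [Set.indicator_of_mem ht, Set.indicator_of_mem ht, Circle.smul_def, Real.fourierChar_apply]
        have : ((2 * Real.pi * -(t * (v * -(2 * Real.pi)⁻¹)) : ℝ) : ℂ) * Complex.I = Complex.I * t * v := by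
          have h : (2 * Real.pi * -(t * (v * -(2 * Real.pi)⁻¹)) : ℝ) = t * v := by
            field_simp
          rw [h]; push_cast; ring
        rw [this, smul_eq_mul]; ring
      · rw [Set.indicator_of_notMem ht, Set.indicator_of_notMem ht, smul_zero]
    have hev := (Metric.tendsto_nhds.1 hRL (ε / 2) (by positivity))
    obtain ⟨v0, hv0⟩ := Filter.eventually_atTop.1 hev
    refine ⟨v0, min δ 1, by positivity, ?_⟩
    intro v σ hv h1 h2
    have hσ2 : σ ≤ 2 := by linarith [min_le_right δ 1]
    have h3 := hv0 v hv
    rw [dist_zero_right] at h3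
    have h4 : ‖wE H v σ - wE H v 1‖ ≤ ε / 4 * |1 - (-1)| := by
      unfold wE
      rw [← intervalIntegral.integral_sub]
      · apply intervalIntegral.norm_integral_le_of_norm_le_const
        intro t ht
        rw [Set.uIoc_of_le (by norm_num)] at ht
        rw [← mul_sub, norm_mul]
        have := hU (σ, t) ⟨⟨h1, hσ2⟩, ⟨ht.1.le, ht.2⟩⟩ (1, t) ⟨⟨le_refl _, by norm_num⟩, ⟨ht.1.le, ht.2⟩⟩ (by
          rw [Prod.dist_eq, dist_self, max_eq_left dist_nonneg, Real.dist_eq, abs_of_nonneg (by linarith)]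
          linarith [min_le_left δ 1])
        rw [dist_eq_norm] at this
        calc _ ≤ 1 * (ε / 4) := mul_le_mul (hker t v ht) this (norm_nonneg _) zero_le_one
          _ = _ := one_mul _
      · exact (hcE σ v h1 hσ2).intervalIntegrable_of_Icc (by norm_num)
      · exact (hcE 1 v le_rfl (by norm_num)).intervalIntegrable_of_Icc (by norm_num)
    have h5 : wE H v σ = (wE H v σ - wE H v 1) + wE H v 1 := by ring
    rw [h5]
    refine (norm_add_le _ _).trans ?_
    norm_num at h4
    linarith

lemma sq_tail (ε : ℝ) (hε : 0 < ε) : ∃ B : ℕ, 1 ≤ B ∧ ∀ J : Finset ℤ, (∀ j ∈ J, (B : ℤ) ≤ |j|) →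
    ∑ j ∈ J, 1 / (j : ℝ) ^ 2 ≤ ε := by
  have h1 : Summable (fun j : ℤ => 1 / (j : ℝ) ^ 2) := Real.summable_one_div_int_pow.2 (by norm_num)
  rw [summable_iff_vanishing_norm] at h1
  obtain ⟨s, hs⟩ := h1 ε hε
  refine ⟨s.sup Int.natAbs + 1, by omega, fun J hJ => ?_⟩
  have := hs J ?_
  · exact (le_abs_self _).trans this.le
  · rw [Finset.disjoint_left]
    intro j hj hjs
    have h2 := hJ j hj
    have h3 : j.natAbs ≤ s.sup Int.natAbs := Finset.le_sup hjs
    push_cast at h2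
    rw [Int.abs_eq_natAbs] at h2
    omega

lemma wY_upper : ∃ C0 : ℝ, 0 < C0 ∧ ∀ (v : ℝ) (F : Finset ℕ),
    ∑ n ∈ F, (n : ℝ)⁻¹ * fK (v - Real.log n) ≤ C0 := by
  have hsum : Summable (fun j : ℤ => 1 / (1 + (j : ℝ) ^ 2)) := by
    have h1 : Summable (fun j : ℤ => 1 / (j : ℝ) ^ 2) := Real.summable_one_div_int_pow.2 (by norm_num)
    have h2 : Summable (fun j : ℤ => if j = 0 then (1 : ℝ) else 0) :=
      summable_of_hasFiniteSupport (Set.Finite.subset (Set.finite_singleton 0) (by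
        intro j; simp))
    refine Summable.of_nonneg_of_le (fun j => by positivity) (fun j => ?_) (h1.add h2)
    by_cases hj : j = 0
    · subst hj; simp
    · have : 0 < (j : ℝ) ^ 2 := by positivity
      rw [if_neg hj, add_zero]
      gcongr
      linarith
  set T := ∑' j : ℤ, 1 / (1 + (j : ℝ) ^ 2) with hT
  have hT0 : 0 ≤ T := tsum_nonneg (fun j => by positivity)
  refine ⟨Real.exp 1 * 20 * T + 1, by positivity, fun v F => ?_⟩
  let m : ℕ → ℤ := fun n => ⌊Real.log n - v⌋
  have hK : ∀ n : ℕ, fK (v - Real.log n) ≤ 20 * (1 / (1 + (m n : ℝ) ^ 2)) := by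
    intro n
    have h1 : (m n : ℝ) ≤ Real.log n - v := Int.floor_le _
    have h2 : Real.log n - v < m n + 1 := Int.lt_floor_add_one _
    set x := Real.log n - v
    have hx : v - Real.log n = -x := by simp [x]
    rw [hx, mul_one_div]
    by_cases h3 : 1 ≤ m n
    · have h3' : (1 : ℝ) ≤ m n := by exact_mod_cast h3
      refine (fK_le _ (by linarith)).trans ?_
      rw [neg_sq, div_le_div_iff₀ (by nlinarith) (by positivity)]
      nlinarith
    · by_cases h4 : m n ≤ -2
      · have h4' : (m n : ℝ) ≤ -2 := by exact_mod_cast h4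
        refine (fK_le _ (by linarith)).trans ?_
        rw [neg_sq, div_le_div_iff₀ (by nlinarith) (by positivity)]
        nlinarith [sq_nonneg (x - m n - 1)]
      · have h5 : m n = 0 ∨ m n = -1 := by omega
        refine (fK_le_one _).trans ?_
        rcases h5 with h5 | h5 <;> rw [h5] <;> norm_num
  have hblock : ∀ j : ℤ, ∑ n ∈ F.filter (fun n => m n = j), (n : ℝ)⁻¹ ≤ Real.exp 1 := by
    intro j
    have h1 : ∀ n ∈ (F.filter (fun n => m n = j)).filter (fun n => n ≠ 0),
        (n : ℝ)⁻¹ ≤ Real.exp (-(v + j)) := by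
      intro n hn
      simp only [Finset.mem_filter] at hn
      obtain ⟨⟨_, h1⟩, h0⟩ := hn
      have hpos : (0 : ℝ) < n := by exact_mod_cast Nat.pos_of_ne_zero h0
      have h2 : (m n : ℝ) ≤ Real.log n - v := Int.floor_le _
      rw [h1] at h2
      rw [Real.exp_neg]
      gcongr
      calc Real.exp (v + j) ≤ Real.exp (Real.log n) := by gcongr; linarith
        _ = n := Real.exp_log hpos
    have h2 : ((F.filter (fun n => m n = j)).filter (fun n => n ≠ 0)) ⊆ Finset.Icc 1 ⌊Real.exp (v + j + 1)⌋₊ := by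
      intro n hn
      simp only [Finset.mem_filter] at hn
      obtain ⟨⟨_, h1⟩, h0⟩ := hn
      have hpos : (0 : ℝ) < n := by exact_mod_cast Nat.pos_of_ne_zero h0
      have h2 : Real.log n - v < m n + 1 := Int.lt_floor_add_one _
      rw [h1] at h2
      rw [Finset.mem_Icc]
      refine ⟨Nat.pos_of_ne_zero h0, Nat.le_floor ?_⟩
      calc (n : ℝ) = Real.exp (Real.log n) := (Real.exp_log hpos).symm
        _ ≤ _ := by gcongr; linarith
    have h3 : ∑ n ∈ F.filter (fun n => m n = j), (n : ℝ)⁻¹ =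
        ∑ n ∈ (F.filter (fun n => m n = j)).filter (fun n => n ≠ 0), (n : ℝ)⁻¹ := by
      symm
      apply Finset.sum_filter_of_ne
      intro n _ hn h0
      simp [h0] at hn
    rw [h3]
    calc _ ≤ ∑ n ∈ (F.filter (fun n => m n = j)).filter (fun n => n ≠ 0), Real.exp (-(v + j)) :=
          Finset.sum_le_sum h1
      _ = (((F.filter (fun n => m n = j)).filter (fun n => n ≠ 0)).card : ℝ) * Real.exp (-(v + j)) := by
          rw [Finset.sum_const, nsmul_eq_mul]
      _ ≤ Real.exp (v + j + 1) * Real.exp (-(v + j)) := by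
          gcongr
          have := Finset.card_le_card h2
          rw [Nat.card_Icc, Nat.add_sub_cancel] at this
          calc (_ : ℝ) ≤ (⌊Real.exp (v + j + 1)⌋₊ : ℝ) := by exact_mod_cast this
            _ ≤ _ := Nat.floor_le (Real.exp_pos _).le
      _ = Real.exp 1 := by rw [← Real.exp_add]; congr 1; ring
  calc ∑ n ∈ F, (n : ℝ)⁻¹ * fK (v - Real.log n)
      ≤ ∑ n ∈ F, (n : ℝ)⁻¹ * (20 * (1 / (1 + (m n : ℝ) ^ 2))) := by
        gcongr with n _; exact hK n
    _ = ∑ j ∈ F.image m, ∑ n ∈ F.filter (fun n => m n = j), (n : ℝ)⁻¹ * (20 * (1 / (1 + (m n : ℝ) ^ 2))) := by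
        rw [Finset.sum_fiberwise_of_maps_to]
        intro n hn; exact Finset.mem_image_of_mem _ hn
    _ = ∑ j ∈ F.image m, (∑ n ∈ F.filter (fun n => m n = j), (n : ℝ)⁻¹) * (20 * (1 / (1 + (j : ℝ) ^ 2))) := by
        apply Finset.sum_congr rfl
        intro j _
        rw [Finset.sum_mul]
        apply Finset.sum_congr rfl
        intro n hn
        rw [(Finset.mem_filter.1 hn).2]
    _ ≤ ∑ j ∈ F.image m, Real.exp 1 * (20 * (1 / (1 + (j : ℝ) ^ 2))) := by
        gcongr with j _; exact hblock j
    _ = Real.exp 1 * 20 * ∑ j ∈ F.image m, (1 / (1 + (j : ℝ) ^ 2)) := by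
        rw [Finset.mul_sum]; simp only [mul_assoc]
    _ ≤ Real.exp 1 * 20 * T := by
        gcongr
        exact hsum.sum_le_tsum _ (fun j _ => by positivity)
    _ ≤ _ := by linarith

lemma wY_lower (v σ : ℝ) (hv : 2 ≤ v) (hσ : 1 < σ) (hσ2 : (σ - 1) * v ≤ 1) :
    1 / 24 ≤ ∑ n ∈ Finset.Ioc ⌊Real.exp (v - 1)⌋₊ ⌊Real.exp v⌋₊, (n : ℝ) ^ (-σ) * fK (v - Real.log n) := by
  have he1 := Real.exp_one_gt_d9
  have he2 := Real.exp_one_lt_d9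
  have hev : Real.exp v = Real.exp 1 * Real.exp (v - 1) := by rw [← Real.exp_add]; congr 1; ring
  have hv1 : Real.exp 1 ≤ Real.exp (v - 1) := by gcongr; linarith
  have hterm : ∀ n ∈ Finset.Ioc ⌊Real.exp (v - 1)⌋₊ ⌊Real.exp v⌋₊,
      Real.exp (-v - 1) * (1 / 2) ≤ (n : ℝ) ^ (-σ) * fK (v - Real.log n) := by
    intro n hn
    rw [Finset.mem_Ioc] at hn
    have h1 : Real.exp (v - 1) < n := (Nat.floor_lt (Real.exp_pos _).le).1 hn.1
    have h2 : (n : ℝ) ≤ Real.exp v := (Nat.le_floor_iff (Real.exp_pos _).le).1 hn.2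
    have hpos : (0 : ℝ) < n := (Real.exp_pos _).trans h1
    have h3 : v - 1 < Real.log n := (Real.lt_log_iff_exp_lt hpos).2 h1
    have h4 : Real.log n ≤ v := (Real.log_le_iff_le_exp hpos).2 h2
    apply mul_le_mul
    · rw [Real.rpow_def_of_pos hpos]
      gcongr
      nlinarith
    · apply fK_ge
      rw [abs_le]; constructor <;> linarith
    · norm_num
    · positivity
  refine le_trans ?_ (Finset.sum_le_sum hterm)
  rw [Finset.sum_const, nsmul_eq_mul, Nat.card_Ioc]
  have hle : ⌊Real.exp (v - 1)⌋₊ ≤ ⌊Real.exp v⌋₊ := Nat.floor_mono (by gcongr; linarith)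
  rw [Nat.cast_sub hle]
  have h1 : Real.exp v - 1 < (⌊Real.exp v⌋₊ : ℝ) := Nat.sub_one_lt_floor _
  have h2 : (⌊Real.exp (v - 1)⌋₊ : ℝ) ≤ Real.exp (v - 1) := Nat.floor_le (Real.exp_pos _).le
  have h3 : Real.exp (-v - 1) = (Real.exp 1 * Real.exp v)⁻¹ := by
    rw [← Real.exp_add, ← Real.exp_neg]; congr 1; ring
  rw [h3]
  set y := Real.exp (v - 1)
  have hy : 0 < y := Real.exp_pos _
  rw [hev] at h1 ⊢
  have : (1 : ℝ) / 24 = (Real.exp 1 * (Real.exp 1 * y) / 12) * ((Real.exp 1 * (Real.exp 1 * y))⁻¹ * (1 / 2)) := by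
    field_simp; norm_num
  rw [this]
  gcongr
  nlinarith

theorem wi_main : ∃ (B : ℕ) (c : ℝ), 0 < c ∧ ∀ (a : ℕ → ℝ) (A : ℝ) (H : ℂ → ℂ), (∀ n, 0 ≤ a n) → 0 < A →
    (∀ s : ℂ, 1 < s.re → LSeriesSummable (fun n => (a n : ℂ)) s) →
    ContinuousOn H {s | 1 ≤ s.re} →
    (∀ s : ℂ, 1 < s.re → LSeries (fun n => (a n : ℂ)) s = A * riemannZeta s + H s) →
    ∃ u0 : ℝ, ∀ u : ℝ, u0 ≤ u → c * A ≤ ∑ n ∈ Finset.Icc ⌈Real.exp (u - B)⌉₊ ⌊Real.exp (u + B)⌋₊, a n / n := by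
  obtain ⟨C0, hC0, hY⟩ := wY_upper
  obtain ⟨B, hB1, hB⟩ := sq_tail (1 / (48 * 32 * (C0 + 1) * 2)) (by positivity)
  refine ⟨B, 1 / 192, by norm_num, ?_⟩
  intro a A H ha hA hs hH hL
  -- difference
  have hs' : ∀ s : ℂ, 1 < s.re → LSeriesSummable (fun n => ((a n - A : ℝ) : ℂ)) s := by
    intro s h1
    have h2 := (LSeriesSummable_one_iff.2 h1).smul (A : ℂ)
    have h3 := (hs s h1).sub h2
    convert! h3 using 1
    ext n; simp
  have hL' : ∀ s : ℂ, 1 < s.re → LSeries (fun n => ((a n - A : ℝ) : ℂ)) s = H s := by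
    intro s h1
    have h2 := (LSeriesSummable_one_iff.2 h1).smul (A : ℂ)
    have h3 := LSeries_sub (hs s h1) h2
    rw [LSeries_smul, LSeries_one_eq_riemannZeta h1, hL s h1] at h3
    have h4 : (fun n => ((a n - A : ℝ) : ℂ)) = (fun n => (a n : ℂ)) - (A : ℂ) • (1 : ℕ → ℂ) := by
      ext n; simp
    rw [h4, h3]; ring
  have hid := wi_id (fun n => a n - A) H hs' hL'
  obtain ⟨⟨M, hM0, hM⟩, hRL⟩ := wi_RL H hH
  obtain ⟨v0, η, hη, hE⟩ := hRL (A / 96) (by positivity)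
  -- summability
  have hYs : ∀ v σ : ℝ, 1 < σ → Summable (fun n : ℕ => (n : ℝ) ^ (-σ) * fK (v - Real.log n)) := by
    intro v σ hσ
    refine Summable.of_nonneg_of_le (fun n => mul_nonneg (by positivity) (fK_nonneg _))
      (fun n => mul_le_of_le_one_right (by positivity) (fK_le_one _)) (Real.summable_nat_rpow.2 (by linarith))
  have hYu : ∀ v σ : ℝ, 1 < σ → ∑' n : ℕ, (n : ℝ) ^ (-σ) * fK (v - Real.log n) ≤ C0 := by
    intro v σ hσ
    apply (hYs v σ hσ).tsum_le_of_sum_le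
    intro F
    refine le_trans (Finset.sum_le_sum fun n _ => ?_) (hY v F)
    gcongr
    · exact fK_nonneg _
    · by_cases hn : n = 0
      · subst hn; rw [Nat.cast_zero, Real.zero_rpow (by linarith)]; simp
      · rw [← Real.rpow_neg_one]
        apply Real.rpow_le_rpow_of_exponent_le
        · exact_mod_cast Nat.one_le_iff_ne_zero.2 hn
        · linarith
  have hX : ∀ v σ : ℝ, 1 < σ → HasSum (fun n : ℕ => a n * (n : ℝ) ^ (-σ) * fK (v - Real.log n))
      ((wE H v σ).re + A * ∑' n : ℕ, (n : ℝ) ^ (-σ) * fK (v - Real.log n)) := by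
    intro v σ hσ
    have := (hid v σ hσ).add ((hYs v σ hσ).hasSum.mul_left A)
    convert! this using 1
    ext n; ring
  have hw0 : ∀ σ v : ℝ, ∀ n : ℕ, 0 ≤ a n * (n : ℝ) ^ (-σ) * fK (v - Real.log n) := fun σ v n =>
    mul_nonneg (mul_nonneg (ha n) (by positivity)) (fK_nonneg _)
  obtain ⟨B2, hB21, hB2⟩ := sq_tail (A / (192 * 32 * 2 * M)) (by positivity)
  refine ⟨max (max v0 2) (v0 + B2), ?_⟩
  intro u hu
  have hu0 : v0 ≤ u := le_trans (le_trans (le_max_left _ _) (le_max_left _ _)) hu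
  have hu2 : 2 ≤ u := le_trans (le_trans (le_max_right _ _) (le_max_left _ _)) hu
  have huB : v0 + B2 ≤ u := le_trans (le_max_right _ _) hu
  -- choose σ
  obtain ⟨σ, hσ1, hση, hσ2, hσu⟩ : ∃ σ : ℝ, 1 < σ ∧ σ ≤ 1 + η ∧ σ ≤ 2 ∧ (σ - 1) * u ≤ 1 := by
    refine ⟨1 + min η (min 1 (1 / u)), ?_, ?_, ?_, ?_⟩
    · have : 0 < min η (min 1 (1 / u)) := by positivity
      linarith
    · linarith [min_le_left η (min 1 (1 / u))]
    · linarith [(min_le_right η (min 1 (1 / u))).trans (min_le_left _ _)]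
    · have := (min_le_right η (min 1 (1 / u))).trans (min_le_right _ _)
      calc _ = min η (min 1 (1 / u)) * u := by ring
        _ ≤ 1 / u * u := by gcongr
        _ = 1 := by field_simp
  have hre : ∀ z : ℂ, -‖z‖ ≤ z.re ∧ z.re ≤ ‖z‖ := fun z => abs_le.1 (Complex.abs_re_le_norm z)
  set w : ℕ → ℝ := fun n => a n * (n : ℝ) ^ (-σ) with hw
  have hXup : ∀ (j : ℤ) (F : Finset ℕ), ∑ n ∈ F, w n * fK (u - j - Real.log n) ≤
      A * (C0 + 1) + (if u - j < v0 then M else 0) := by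
    intro j F
    refine (sum_le_hasSum F (fun n _ => hw0 σ _ n) (hX (u - j) σ hσ1)).trans ?_
    have h1 := hYu (u - j) σ hσ1
    have h2 := (hre (wE H (u - j) σ)).2
    have h3 : A * ∑' n : ℕ, (n : ℝ) ^ (-σ) * fK (u - j - Real.log n) ≤ A * C0 := by gcongr
    split_ifs with hj
    · have h4 := hM (u - j) σ hσ1.le hσ2
      linarith
    · have h4 := hE (u - j) σ (not_lt.1 hj) hσ1.le hση
      linarith
  -- tail bound
  have htail : ∀ F : Finset ℕ, (∀ n ∈ F, (B : ℝ) < |u - Real.log n|) →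
      ∑ n ∈ F, w n * fK (u - Real.log n) ≤ A / 96 + A / 192 := by
    intro F hF
    set J := F.image (fun n : ℕ => round (u - Real.log n)) with hJ
    have hround : ∀ n : ℕ, |u - Real.log n - round (u - Real.log n)| ≤ 1 / 2 := fun n => abs_sub_round _
    have hJB : ∀ j ∈ J, (B : ℤ) ≤ |j| := by
      intro j hj
      obtain ⟨n, hn, rfl⟩ := Finset.mem_image.1 hj
      have h1 := hF n hn
      have h2 := hround n
      by_contra h3
      have h4 : |round (u - Real.log n)| + 1 ≤ (B : ℤ) := by omega
      have h5 : (|(round (u - Real.log n) : ℝ)|) + 1 ≤ B := by exact_mod_cast h4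
      have h6 := abs_sub_abs_le_abs_sub (u - Real.log n) (round (u - Real.log n))
      linarith
    have hdom : ∀ n ∈ F, w n * fK (u - Real.log n) ≤
        ∑ j ∈ J, 32 * (1 / (j : ℝ) ^ 2) * (w n * fK (u - j - Real.log n)) := by
      intro n hn
      have hjJ : round (u - Real.log n) ∈ J := Finset.mem_image_of_mem _ hn
      have h9 := Finset.single_le_sum (f := fun j : ℤ => 32 * (1 / (j : ℝ) ^ 2) * (w n * fK (u - j - Real.log n)))
        (fun j _ => mul_nonneg (by positivity) (hw0 σ _ n)) hjJ
      refine le_trans ?_ h9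
      have h1 := hJB _ hjJ
      have h2 := hround n
      set j := round (u - Real.log n)
      have h3 : 1 ≤ |(j : ℝ)| := by
        have : (1 : ℤ) ≤ |j| := by omega
        exact_mod_cast this
      have h4 : 1 / 2 ≤ fK (u - j - Real.log n) := by
        apply fK_ge
        have : u - j - Real.log n = u - Real.log n - j := by ring
        rw [this]; linarith
      set x := u - Real.log n
      have h5 : |(j : ℝ)| / 2 ≤ |x| := by
        have := abs_sub_abs_le_abs_sub (j : ℝ) x
        rw [abs_sub_comm (j : ℝ) x] at this
        linarith
      have h6 : x ≠ 0 := by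
        intro h; rw [h, abs_zero] at h5; linarith
      have h7 : fK x ≤ 16 * (1 / (j : ℝ) ^ 2) := by
        refine (fK_le x h6).trans ?_
        rw [mul_one_div, ← sq_abs x, ← sq_abs (j : ℝ)]
        rw [div_le_div_iff₀ (by positivity) (by positivity)]
        nlinarith [abs_nonneg x]
      have hwn : 0 ≤ w n := mul_nonneg (ha n) (by positivity)
      calc w n * fK x ≤ w n * (16 * (1 / (j : ℝ) ^ 2)) := by gcongr
        _ = 32 * (1 / (j : ℝ) ^ 2) * (w n * (1 / 2)) := by ring
        _ ≤ _ := by gcongr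
    calc ∑ n ∈ F, w n * fK (u - Real.log n)
        ≤ ∑ n ∈ F, ∑ j ∈ J, 32 * (1 / (j : ℝ) ^ 2) * (w n * fK (u - j - Real.log n)) :=
          Finset.sum_le_sum hdom
      _ = ∑ j ∈ J, 32 * (1 / (j : ℝ) ^ 2) * ∑ n ∈ F, (w n * fK (u - j - Real.log n)) := by
          rw [Finset.sum_comm]; simp only [Finset.mul_sum]
      _ ≤ ∑ j ∈ J, 32 * (1 / (j : ℝ) ^ 2) * (A * (C0 + 1) + (if u - j < v0 then M else 0)) := by
          gcongr with j _; exact hXup j F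
      _ = 32 * (A * (C0 + 1)) * ∑ j ∈ J, 1 / (j : ℝ) ^ 2 +
          32 * M * ∑ j ∈ J.filter (fun j : ℤ => u - j < v0), 1 / (j : ℝ) ^ 2 := by
          rw [Finset.sum_filter, Finset.mul_sum, Finset.mul_sum, ← Finset.sum_add_distrib]
          apply Finset.sum_congr rfl
          intro j _
          split_ifs <;> ring
      _ ≤ 32 * (A * (C0 + 1)) * (1 / (48 * 32 * (C0 + 1) * 2)) + 32 * M * (A / (192 * 32 * 2 * M)) := by
          gcongr
          · exact hB J hJB
          · apply hB2
            intro j hj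
            have h1 := (Finset.mem_filter.1 hj).2
            have h2 : (B2 : ℝ) < j := by linarith
            have h3 : (B2 : ℤ) < j := by exact_mod_cast h2
            exact h3.le.trans (le_abs_self _)
      _ = A / 96 + A / 384 := by field_simp; norm_num
      _ ≤ _ := by linarith
  -- lower bound for the full sum
  have hlow : A / 24 - A / 96 ≤ ∑' n : ℕ, w n * fK (u - Real.log n) := by
    rw [(hX u σ hσ1).tsum_eq]
    have h1 := (hre (wE H u σ)).1
    have h2 := hE u σ hu0 hσ1.le hση
    have h3 := wY_lower u σ hu2 hσ1 hσu
    have h4 := (hYs u σ hσ1).sum_le_tsum (Finset.Ioc ⌊Real.exp (u - 1)⌋₊ ⌊Real.exp u⌋₊)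
      (fun n _ => mul_nonneg (by positivity) (fK_nonneg _))
    have h5 : A * (1 / 24) ≤ A * ∑' n : ℕ, (n : ℝ) ^ (-σ) * fK (u - Real.log n) := by
      gcongr; linarith
    linarith
  set S := Finset.Icc ⌈Real.exp (u - B)⌉₊ ⌊Real.exp (u + B)⌋₊ with hS
  have hfull : ∑' n : ℕ, w n * fK (u - Real.log n) ≤ (∑ n ∈ S, w n * fK (u - Real.log n)) + (A / 96 + A / 192) := by
    apply (hX u σ hσ1).summable.tsum_le_of_sum_le
    intro F
    classical
    rw [← Finset.sum_filter_add_sum_filter_not F (fun n => n ∈ S ∨ n = 0)]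
    apply add_le_add
    · calc _ = ∑ n ∈ (F.filter (fun n => n ∈ S ∨ n = 0)).filter (fun n => n ∈ S), w n * fK (u - Real.log n) := by
            symm
            apply Finset.sum_filter_of_ne
            intro n hn h0
            rcases (Finset.mem_filter.1 hn).2 with h | h
            · exact h
            · exfalso; apply h0
              simp only [hw]
              rw [h, Nat.cast_zero, Real.zero_rpow (by linarith)]; simp
        _ ≤ _ := by
          apply Finset.sum_le_sum_of_subset_of_nonneg
          · intro n hn; exact (Finset.mem_filter.1 hn).2
          · intro n _ _; exact hw0 σ u n
    · apply htail
      intro n hn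
      obtain ⟨_, h1⟩ := Finset.mem_filter.1 hn
      push Not at h1
      obtain ⟨h1, h0⟩ := h1
      have hpos : (0 : ℝ) < n := by exact_mod_cast Nat.pos_of_ne_zero h0
      by_contra h2
      rw [not_lt, abs_le] at h2
      apply h1
      rw [hS, Finset.mem_Icc]
      constructor
      · apply Nat.ceil_le.2
        rw [← Real.le_log_iff_exp_le hpos]; linarith
      · apply Nat.le_floor
        rw [← Real.log_le_iff_le_exp hpos]; linarith
  have hfin : ∑ n ∈ S, w n * fK (u - Real.log n) ≤ ∑ n ∈ S, a n / n := by
    apply Finset.sum_le_sum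
    intro n hn
    have hwn : 0 ≤ w n := mul_nonneg (ha n) (by positivity)
    refine (mul_le_of_le_one_right hwn (fK_le_one _)).trans ?_
    rw [hw, div_eq_mul_inv]
    have := ha n
    beta_reduce
    gcongr
    by_cases hn : n = 0
    · subst hn; rw [Nat.cast_zero, Real.zero_rpow (by linarith)]; simp
    · rw [← Real.rpow_neg_one]
      apply Real.rpow_le_rpow_of_exponent_le
      · exact_mod_cast Nat.one_le_iff_ne_zero.2 hn
      · linarith
  linarith

open ArithmeticFunction.vonMangoldt in
theorem PAP : ∃ (c1 C1 : ℝ), 0 < c1 ∧ 1 < C1 ∧ ∀ (W : ℕ), W ≠ 0 → ∀ c : ZMod W, IsUnit c →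
    ∃ N0 : ℝ, ∀ N : ℝ, N0 ≤ N → c1 * N / (W.totient * Real.log N) ≤
      (((Finset.Icc ⌈N⌉₊ ⌊C1 * N⌋₊).filter (fun p : ℕ => p.Prime ∧ ((p : ℕ) : ZMod W) = c)).card : ℝ) := by
  obtain ⟨B, c, hc, hmain⟩ := wi_main
  refine ⟨c / 4, Real.exp (2 * B + 1), by positivity, by
    rw [← Real.exp_zero]; apply Real.exp_lt_exp.2; positivity, ?_⟩
  intro W hW a ha
  haveI : NeZero W := ⟨hW⟩
  have hφ : (0 : ℝ) < W.totient := by exact_mod_cast Nat.totient_pos.2 (Nat.pos_of_ne_zero hW)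
  set Hz : ℂ → ℂ := Function.update (fun s : ℂ => riemannZeta s - 1 / (s - 1)) 1 Real.eulerMascheroniConstant with hHz
  have hHzc : Continuous Hz := by
    rw [continuous_iff_continuousAt]
    intro s
    by_cases hs : s = 1
    · subst hs
      exact continuousAt_update_same.2 tendsto_riemannZeta_sub_one_div
    · rw [hHz, continuousAt_update_of_ne hs]
      apply ContinuousAt.sub
      · exact (differentiableAt_riemannZeta hs).continuousAt
      · exact ContinuousAt.div (f := fun _ => (1:ℂ)) (g := fun s : ℂ => s - 1) continuousAt_const (by fun_prop) (sub_ne_zero.2 hs)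
  obtain ⟨u0, hu0⟩ := hmain (residueClass a) ((W.totient : ℝ)⁻¹)
    (fun s => LFunctionResidueClassAux a s - (W.totient : ℂ)⁻¹ * Hz s)
    (residueClass_nonneg a) (by positivity)
    (by
      intro s hs
      apply LSeriesSummable_of_abscissaOfAbsConv_lt_re
      exact lt_of_le_of_lt (abscissaOfAbsConv_residueClass_le_one a) (by exact_mod_cast hs))
    ((continuousOn_LFunctionResidueClassAux a).sub (by fun_prop))
    (by
      intro s hs
      have h1 := eqOn_LFunctionResidueClassAux ha hs
      have hs1 : s ≠ 1 := by rintro rfl; simp at hs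
      simp only [hHz, Function.update_of_ne hs1] 
      beta_reduce at h1
      rw [h1]
      push_cast
      ring)
  have hsm := summable_residueClass_non_primes_div (a := a)
  set g : ℕ → ℝ := fun n => (if n.Prime then 0 else residueClass a n) / n with hg
  have hg0 : ∀ n, 0 ≤ g n := by
    intro n
    have := residueClass_nonneg a n
    simp only [hg]; split_ifs <;> positivity
  rw [summable_iff_vanishing_norm] at hsm
  obtain ⟨s, hs⟩ := hsm (c * (W.totient : ℝ)⁻¹ / 2) (by positivity)
  refine ⟨max (max (Real.exp (u0)) (s.sup id + 1)) (Real.exp (2 * B + 1)), ?_⟩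
  intro N hN
  have hN1 : Real.exp u0 ≤ N := le_trans (le_trans (le_max_left _ _) (le_max_left _ _)) hN
  have hN2 : ((s.sup id : ℕ) : ℝ) + 1 ≤ N := le_trans (le_trans (le_max_right _ _) (le_max_left _ _)) hN
  have hN3 : Real.exp (2 * B + 1) ≤ N := le_trans (le_max_right _ _) hN
  have hNpos : 0 < N := (Real.exp_pos _).trans_le hN1
  have hlog : 2 * B + 1 ≤ Real.log N := (Real.le_log_iff_exp_le hNpos).2 hN3
  have hlogpos : 0 < Real.log N := lt_of_lt_of_le (by positivity) hlog
  have h1 := hu0 (Real.log N + B) (by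
    have := (Real.le_log_iff_exp_le hNpos).2 hN1
    have : (0 : ℝ) ≤ B := by positivity
    linarith)
  rw [add_sub_cancel_right, Real.exp_log hNpos] at h1
  have h2 : Real.exp (Real.log N + B + B) ≤ Real.exp (2 * B + 1) * N := by
    rw [add_assoc, Real.exp_add, Real.exp_log hNpos, mul_comm]
    exact mul_le_mul_of_nonneg_right (Real.exp_le_exp.2 (by linarith)) hNpos.le
  set S := Finset.Icc ⌈N⌉₊ ⌊Real.exp (Real.log N + B + B)⌋₊ with hS
  have hsplit : ∑ n ∈ S, residueClass a n / n = ∑ n ∈ S, g n + ∑ n ∈ S.filter (fun p : ℕ => p.Prime ∧ ((p : ℕ) : ZMod W) = a), Real.log n / n := by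
    rw [Finset.sum_filter, ← Finset.sum_add_distrib]
    apply Finset.sum_congr rfl
    intro n _
    simp only [hg]
    by_cases hp : n.Prime
    · by_cases hna : (n : ZMod W) = a
      · simp [hp, hna, Set.indicator, ArithmeticFunction.vonMangoldt_apply_prime hp]
      · simp [hp, hna, Set.indicator]
    · simp [hp]
  have h3 : ∑ n ∈ S, g n ≤ c * (W.totient : ℝ)⁻¹ / 2 := by
    have := hs S (by
      rw [Finset.disjoint_left]
      intro n hn hns
      have h4 : n ≤ s.sup id := Finset.le_sup (f := id) hns
      have h5 := (Finset.mem_Icc.1 hn).1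
      have h6 : N ≤ n := Nat.ceil_le.1 h5
      have h7 : (n : ℝ) ≤ (s.sup id : ℕ) := by exact_mod_cast h4
      linarith)
    exact (le_abs_self _).trans this.le
  have h4 : ∑ n ∈ S.filter (fun p : ℕ => p.Prime ∧ ((p : ℕ) : ZMod W) = a), Real.log n / n ≤
      ((S.filter (fun p : ℕ => p.Prime ∧ ((p : ℕ) : ZMod W) = a)).card : ℝ) * (2 * Real.log N / N) := by
    rw [← nsmul_eq_mul, ← Finset.sum_const]
    apply Finset.sum_le_sum
    intro n hn
    have hnS := Finset.mem_Icc.1 (Finset.mem_filter.1 hn).1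
    have h5 : N ≤ n := Nat.ceil_le.1 hnS.1
    have h6 : (n : ℝ) ≤ Real.exp (Real.log N + B + B) := (Nat.le_floor_iff (Real.exp_pos _).le).1 hnS.2
    have hnpos : (0 : ℝ) < n := hNpos.trans_le h5
    have h7 : Real.log n ≤ Real.log N + B + B := (Real.log_le_iff_le_exp hnpos).2 h6
    have h8 : 0 ≤ Real.log n := hlogpos.le.trans (Real.log_le_log hNpos h5)
    gcongr
    linarith
  have h5 : ((S.filter (fun p : ℕ => p.Prime ∧ ((p : ℕ) : ZMod W) = a)).card : ℝ) ≤ (((Finset.Icc ⌈N⌉₊ ⌊Real.exp (2 * B + 1) * N⌋₊).filter (fun p : ℕ => p.Prime ∧ ((p : ℕ) : ZMod W) = a)).card : ℝ) := by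
    exact_mod_cast Finset.card_le_card (Finset.filter_subset_filter _ (Finset.Icc_subset_Icc le_rfl (Nat.floor_mono h2)))
  refine le_trans ?_ h5
  have h6 : c * (W.totient : ℝ)⁻¹ / 2 ≤ ((S.filter (fun p : ℕ => p.Prime ∧ ((p : ℕ) : ZMod W) = a)).card : ℝ) * (2 * Real.log N / N) := by
    linarith
  rw [div_le_iff₀ (by positivity)]
  have h7 : c * (W.totient : ℝ)⁻¹ / 2 * (N / 2 * W.totient) ≤ ((S.filter (fun p : ℕ => p.Prime ∧ ((p : ℕ) : ZMod W) = a)).card : ℝ) * (2 * Real.log N / N) * (N / 2 * W.totient) := by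
    gcongr
  have e1 : c * (W.totient : ℝ)⁻¹ / 2 * (N / 2 * W.totient) = c / 4 * N := by field_simp; norm_num
  have e2 : ((S.filter (fun p : ℕ => p.Prime ∧ ((p : ℕ) : ZMod W) = a)).card : ℝ) * (2 * Real.log N / N) * (N / 2 * W.totient) = ((S.filter (fun p : ℕ => p.Prime ∧ ((p : ℕ) : ZMod W) = a)).card : ℝ) * (W.totient * Real.log N) := by field_simp
  rw [e1, e2] at h7
  exact h7

/-- the additive character -/
noncomputable def ee (x : ℝ) : ℂ := Complex.exp (Complex.I * ((2 * Real.pi * x : ℝ) : ℂ))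

theorem ee_add (x y : ℝ) : ee (x + y) = ee x * ee y := by
  unfold ee; rw [← Complex.exp_add]; congr 1; push_cast; ring

theorem ee_norm (x : ℝ) : ‖ee x‖ = 1 := by
  unfold ee; rw [mul_comm]; exact Complex.norm_exp_ofReal_mul_I _

theorem ee_zero : ee 0 = 1 := by simp [ee]

theorem ee_int (z : ℤ) : ee z = 1 := by
  unfold ee; rw [Complex.exp_eq_one_iff]; exact ⟨z, by push_cast; ring⟩

theorem ee_conj (x : ℝ) : (starRingEnd ℂ) (ee x) = ee (-x) := by
  unfold ee; rw [← Complex.exp_conj]; congr 1; rw [map_mul, Complex.conj_I, Complex.conj_ofReal]; push_cast; ring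

theorem ee_nat_mul (n : ℕ) (x : ℝ) : ee (n * x) = ee x ^ n := by
  unfold ee; rw [← Complex.exp_nat_mul]; congr 1; push_cast; ring

theorem ee_sub_one_norm (x : ℝ) : ‖ee x - 1‖ = 2 * |Real.sin (Real.pi * x)| := by
  unfold ee
  rw [Complex.norm_exp_I_mul_ofReal_sub_one, norm_mul, Real.norm_eq_abs, Real.norm_eq_abs]
  rw [show 2 * Real.pi * x / 2 = Real.pi * x by ring]
  simp

theorem ee_sub_one_le (x : ℝ) : ‖ee x - 1‖ ≤ 2 * Real.pi * |x| := by
  rw [ee_sub_one_norm]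
  have := Real.abs_sin_le_abs (x := Real.pi * x)
  rw [abs_mul, abs_of_pos Real.pi_pos] at this
  linarith

theorem ee_sub_one_ge (x : ℝ) : 4 * |x - round x| ≤ ‖ee x - 1‖ := by
  have h1 : ee x = ee (x - round x) := by
    have := ee_add (x - round x) (round x)
    rw [sub_add_cancel, ee_int, mul_one] at this
    exact this
  rw [h1, ee_sub_one_norm]
  have h2 := abs_sub_round x
  set y := x - round x
  have h3 : |Real.sin (Real.pi * y)| = |Real.sin (Real.pi * |y|)| := by
    rcases abs_choice y with h | h <;> rw [h]
    rw [mul_neg, Real.sin_neg, abs_neg]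
  rw [h3]
  have h4 := Real.mul_le_sin (x := Real.pi * |y|) (by positivity) (by nlinarith [Real.pi_pos])
  have h5 : 2 / Real.pi * (Real.pi * |y|) = 2 * |y| := by field_simp
  rw [h5] at h4
  have := le_abs_self (Real.sin (Real.pi * |y|))
  linarith

/-- iterated differences -/
def PP : ℕ → ℝ → (ℕ → ℝ) → Prop
  | 0, θ, f => ∀ t, f t = θ
  | k + 1, θ, f => ∀ h : ℕ, PP k (h * θ) (fun t => f (t + h) - f t)

theorem PP_add : ∀ (k : ℕ) (a b : ℝ) (f g : ℕ → ℝ), PP k a f → PP k b g → PP k (a + b) (fun t => f t + g t)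
  | 0, a, b, f, g, hf, hg => fun t => by beta_reduce; rw [hf t, hg t]
  | k + 1, a, b, f, g, hf, hg => fun h => by
    have := PP_add k _ _ _ _ (hf h) (hg h)
    convert this using 1
    · ring
    · funext t; ring

theorem PP_smul : ∀ (k : ℕ) (a c : ℝ) (f : ℕ → ℝ), PP k a f → PP k (c * a) (fun t => c * f t)
  | 0, a, c, f, hf => fun t => by beta_reduce; rw [hf t]
  | k + 1, a, c, f, hf => fun h => by
    have := PP_smul k _ c _ (hf h)
    convert this using 1
    · ring
    · funext t; ring

theorem PP_zero : ∀ (k : ℕ), PP k 0 (fun _ => 0)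
  | 0 => fun t => rfl
  | k + 1 => fun h => by
    have := PP_zero k
    convert this using 1
    · ring
    · funext t; ring

theorem PP_sum (k : ℕ) (s : Finset ℕ) (a : ℕ → ℝ) (f : ℕ → ℕ → ℝ) (h : ∀ i ∈ s, PP k (a i) (f i)) :
    PP k (∑ i ∈ s, a i) (fun t => ∑ i ∈ s, f i t) := by
  classical
  induction s using Finset.induction_on with
  | empty => simpa using PP_zero k
  | insert i s hi ih =>
    simp only [Finset.sum_insert hi]
    exact PP_add k _ _ _ _ (h i (by simp)) (ih fun j hj => h j (by simp [hj]))

theorem PP_pow : ∀ (k j : ℕ), j ≤ k → PP k (if j = k then (k.factorial : ℝ) else 0) (fun t => (t : ℝ) ^ j)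
  | 0, j, hj => fun t => by
    obtain rfl : j = 0 := by omega
    simp
  | k + 1, j, hj => fun h => by
    have h1 := PP_sum k (Finset.range j) (fun i => ((h : ℝ) ^ (j - i) * (j.choose i)) * (if i = k then (k.factorial : ℝ) else 0))
      (fun i t => ((h : ℝ) ^ (j - i) * (j.choose i)) * (t : ℝ) ^ i)
      (fun i hi => PP_smul k _ _ _ (PP_pow k i (by have := Finset.mem_range.1 hi; omega)))
    convert h1 using 1
    · split_ifs with hjk
      · subst hjk
        rw [Finset.sum_range_succ, Finset.sum_eq_zero]
        · simp [Nat.factorial_succ]; ring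
        · intro i hi
          have := Finset.mem_range.1 hi
          rw [if_neg (by omega), mul_zero]
      · rw [Finset.sum_eq_zero, mul_zero]
        intro i hi
        have := Finset.mem_range.1 hi
        rw [if_neg (by omega), mul_zero]
    · funext t
      push_cast
      rw [add_pow, Finset.sum_range_succ]
      simp only [tsub_self, pow_zero, Nat.choose_self]
      rw [show ∀ x y : ℝ, x + y * 1 * ((1:ℕ):ℝ) - y = x by intros; push_cast; ring]
      apply Finset.sum_congr rfl
      intros; ring

theorem PP_affine : ∀ (k : ℕ) (a : ℝ) (f : ℕ → ℝ), PP k a f → PP k (4 ^ k * a) (fun t => f (4 * t + 3))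
  | 0, a, f, hf => fun t => by simpa using hf _
  | k + 1, a, f, hf => fun h => by
    have := PP_affine k _ _ (hf (4 * h))
    convert this using 1
    · push_cast; ring
    · funext t
      ring_nf

theorem PP_main (k : ℕ) (c : ℝ) : PP k (c * (4 ^ k * k.factorial)) (fun t => c * (((4 * t + 3 : ℕ) : ℝ) ^ k)) := by
  have := PP_smul k _ c _ (PP_affine k _ _ (PP_pow k k le_rfl))
  simpa using this

theorem card_le_of_diff (S : Finset ℤ) (x : ℝ) (hx : 0 ≤ x) (h : ∀ a ∈ S, ∀ b ∈ S, (a : ℝ) - b ≤ x) :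
    (S.card : ℝ) ≤ x + 1 := by
  rcases S.eq_empty_or_nonempty with rfl | hS
  · simp; linarith
  · have h1 : S ⊆ Finset.Icc (S.min' hS) (S.max' hS) := fun a ha =>
      Finset.mem_Icc.2 ⟨S.min'_le a ha, S.le_max' a ha⟩
    have h2 := Finset.card_le_card h1
    rw [Int.card_Icc] at h2
    have h3 := h _ (S.max'_mem hS) _ (S.min'_mem hS)
    have h4 : (S.card : ℤ) ≤ S.max' hS + 1 - S.min' hS := by
      have : S.min' hS ≤ S.max' hS := S.min'_le _ (S.max'_mem hS)
      omega
    have h5 : (S.card : ℝ) ≤ S.max' hS + 1 - S.min' hS := by exact_mod_cast h4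
    linarith

theorem card_le_mul_real {α β : Type*} [DecidableEq β] (S : Finset α) (f : α → β) (n : ℝ)
    (h : ∀ b ∈ S.image f, (((S.filter (fun a => f a = b)).card : ℕ) : ℝ) ≤ n) :
    (S.card : ℝ) ≤ n * (S.image f).card := by
  rw [Finset.card_eq_sum_card_image f S]
  push_cast
  calc _ ≤ ∑ b ∈ S.image f, n := Finset.sum_le_sum h
    _ = _ := by rw [Finset.sum_const, nsmul_eq_mul]; ring

theorem vino (β ε D : ℝ) (L : ℕ) (A : Finset ℕ) (hε : 0 < ε) (hD : 1 ≤ D)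
    (hA : ∀ h ∈ A, h < L) (hcard : (L : ℝ) ≤ D * A.card) (hz : ∀ h ∈ A, ∃ z : ℤ, |β * h - z| ≤ ε)
    (hεD : 16 * D * ε ≤ 1) (hL : 16 * D ^ 2 ≤ L) :
    ∃ q : ℕ, 1 ≤ q ∧ (q : ℝ) ≤ 2 * D ∧ ∃ z : ℤ, |β * q - z| ≤ 16 * ε * D ^ 2 / L := by
  have hLpos : (0 : ℝ) < L := by nlinarith
  choose! z hz using hz
  -- step 1
  obtain ⟨q, hq1, hqD, a, hqa⟩ : ∃ q : ℕ, 1 ≤ q ∧ (q : ℝ) ≤ 2 * D ∧ ∃ z : ℤ, |β * q - z| ≤ 2 * ε := by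
    set b := ⌊2 * D⌋₊ with hb
    have hb2 : 2 ≤ b := Nat.le_floor (by push_cast; linarith)
    have hb3 : (b : ℝ) ≤ 2 * D := Nat.floor_le (by linarith)
    have hb4 : 2 * D < b + 1 := Nat.lt_floor_add_one _
    have hb2' : (2 : ℝ) ≤ b := by exact_mod_cast hb2
    have h1 : (Finset.range (L / b + 1)).card < A.card := by
      rw [Finset.card_range]
      have h2 : ((L / b : ℕ) : ℝ) ≤ (L : ℝ) / b := Nat.cast_div_le
      have h3 : (L : ℝ) / b * b = L := by field_simp
      have h4 : ((L / b : ℕ) : ℝ) + 1 < A.card := by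
        by_contra hcon
        push Not at hcon
        have h5 : (A.card : ℝ) * b ≤ L + b := by
          calc (A.card : ℝ) * b ≤ (L / b + 1) * b := by gcongr; linarith
            _ = L + b := by rw [add_mul, h3, one_mul]
        have h6 : (L : ℝ) * b ≤ D * (L + b) := by
          calc (L : ℝ) * b ≤ D * A.card * b := by gcongr
            _ = D * (A.card * b) := by ring
            _ ≤ _ := by gcongr
        nlinarith
      exact_mod_cast h4
    obtain ⟨x, hx, y, hy, hxy, hxyb⟩ := Finset.exists_ne_map_eq_of_card_lt_of_maps_to h1 (f := fun h => h / b) (by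
      intro h hh
      simp only [Finset.coe_range, Set.mem_Iio]
      exact Nat.lt_succ_of_le (Nat.div_le_div_right (hA h hh).le))
    wlog hlt : x < y generalizing x y
    · exact this y hy x hx hxy.symm hxyb.symm (by omega)
    refine ⟨y - x, by omega, ?_, z y - z x, ?_⟩
    · have h2 : y - x ≤ b := by
        have h3 := Nat.div_add_mod x b
        have h4 := Nat.div_add_mod y b
        have h5 := Nat.mod_lt y (show 0 < b by omega)
        have hxyb' : x / b = y / b := hxyb
        rw [hxyb'] at h3
        omega
      have : ((y - x : ℕ) : ℝ) ≤ b := by exact_mod_cast h2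
      linarith
    · rw [Nat.cast_sub hlt.le]
      push_cast
      have h2 := abs_le.1 (hz x hx)
      have h3 := abs_le.1 (hz y hy)
      rw [abs_le]
      constructor <;> linarith [h2.1, h2.2, h3.1, h3.2]
  refine ⟨q, hq1, hqD, a, ?_⟩
  set γ := β * q - a with hγ
  by_cases hγ0 : γ = 0
  · rw [hγ0, abs_zero]; positivity
  have hγp : 0 < |γ| := abs_pos.2 hγ0
  have hqp : (0 : ℝ) < q := by exact_mod_cast hq1
  -- counting
  have hfib : ∀ s ∈ A.image (fun h => h % q), (((A.filter (fun h => h % q = s)).card : ℕ) : ℝ) ≤ (2 * ε / |γ| + 1) * (|γ| * (L / q) + 2 * ε + 1) := by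
    intro s _
    set B := A.filter (fun h => h % q = s) with hB
    set w : ℕ → ℤ := fun h => z h - (h / q : ℕ) * a with hw
    have hkey : ∀ h ∈ B, |((h / q : ℕ) : ℝ) * γ + β * s - w h| ≤ ε := by
      intro h hh
      have h1 := hz h (Finset.mem_filter.1 hh).1
      have h2 : (h : ℝ) = q * (h / q : ℕ) + s := by
        rw [← (Finset.mem_filter.1 hh).2]; exact_mod_cast (Nat.div_add_mod h q).symm
      rw [h2] at h1
      convert h1 using 2
      simp only [hw, hγ, Int.cast_sub, Int.cast_mul, Int.cast_natCast]; ring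
    have hm : ∀ h ∈ B, ((h / q : ℕ) : ℝ) ≤ L / q := by
      intro h hh
      refine Nat.cast_div_le.trans ?_
      gcongr
      exact (hA h (Finset.mem_filter.1 hh).1).le
    refine (card_le_mul_real B w (2 * ε / |γ| + 1) ?_).trans ?_
    · intro v _
      have hinj : (B.filter (fun h => w h = v)).card = ((B.filter (fun h => w h = v)).image (fun h => ((h / q : ℕ) : ℤ))).card := by
        rw [Finset.card_image_of_injOn]
        intro x hx y hy hxy
        have hx1 := (Finset.mem_filter.1 (Finset.mem_filter.1 hx).1).2
        have hy1 := (Finset.mem_filter.1 (Finset.mem_filter.1 hy).1).2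
        have hxy' : x / q = y / q := Int.natCast_inj.1 hxy
        rw [← Nat.div_add_mod x q, ← Nat.div_add_mod y q, hx1, hy1, hxy']
      rw [hinj]
      apply card_le_of_diff _ _ (by positivity)
      intro x hx y hy
      obtain ⟨x, hx0, rfl⟩ := Finset.mem_image.1 hx; clear hx; rename' hx0 => hx
      obtain ⟨y, hy0, rfl⟩ := Finset.mem_image.1 hy; clear hy; rename' hy0 => hy
      have hx2 := hkey x (Finset.mem_filter.1 hx).1
      have hy2 := hkey y (Finset.mem_filter.1 hy).1
      rw [(Finset.mem_filter.1 hx).2] at hx2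
      rw [(Finset.mem_filter.1 hy).2] at hy2
      rw [le_div_iff₀ hγp]
      have h3 : |(((x / q : ℕ) : ℝ) - (y / q : ℕ)) * γ| ≤ 2 * ε := by
        have h2 := abs_le.1 hx2
        have h3 := abs_le.1 hy2
        rw [abs_le]
        constructor <;> linarith [h2.1, h2.2, h3.1, h3.2]
      rw [abs_mul] at h3
      refine le_trans ?_ h3
      gcongr
      exact le_abs_self _
    · gcongr
      apply card_le_of_diff _ _ (by positivity)
      intro x hx y hy
      obtain ⟨x, hx0, rfl⟩ := Finset.mem_image.1 hx; clear hx; rename' hx0 => hx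
      obtain ⟨y, hy0, rfl⟩ := Finset.mem_image.1 hy; clear hy; rename' hy0 => hy
      have h2 := abs_le.1 (hkey x hx)
      have h3 := abs_le.1 (hkey y hy)
      have h4 : ((x / q : ℕ) : ℝ) * γ - ((y / q : ℕ) : ℝ) * γ ≤ |γ| * (L / q) := by
        have hx0 : (0 : ℝ) ≤ ((x / q : ℕ) : ℝ) := by positivity
        have hy0 : (0 : ℝ) ≤ ((y / q : ℕ) : ℝ) := by positivity
        have := hm x hx
        have := hm y hy
        rcases abs_cases γ with ⟨h, h'⟩ | ⟨h, h'⟩ <;> rw [h] <;> nlinarith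
      linarith [h2.1, h2.2, h3.1, h3.2]
  have h1 := card_le_mul_real A (fun h => h % q) _ hfib
  have h2 : ((A.image (fun h => h % q)).card : ℝ) ≤ q := by
    have : A.image (fun h => h % q) ⊆ Finset.range q := by
      intro s hs
      obtain ⟨x, _, rfl⟩ := Finset.mem_image.1 hs
      exact Finset.mem_range.2 (Nat.mod_lt _ hq1)
    have := Finset.card_le_card this
    rw [Finset.card_range] at this
    exact_mod_cast this
  have h3 : (L : ℝ) ≤ D * ((2 * ε / |γ| + 1) * (|γ| * (L / q) + 2 * ε + 1) * q) := by
    refine hcard.trans ?_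
    gcongr
    refine h1.trans ?_
    gcongr
  have h4 : (2 * ε / |γ| + 1) * (|γ| * (L / q) + 2 * ε + 1) * q = (2 * ε / |γ| + 1) * (|γ| * L + 2 * ε * q + q) := by
    field_simp
  rw [h4] at h3
  have h5 : |γ| * L ≤ D * ((2 * ε + |γ|) * (|γ| * L + 2 * ε * q + q)) := by
    calc |γ| * L ≤ |γ| * (D * ((2 * ε / |γ| + 1) * (|γ| * L + 2 * ε * q + q))) := by gcongr
      _ = _ := by field_simp
  rw [le_div_iff₀ hLpos]
  set G := |γ|
  -- G ≤ 2ε, 16Dε ≤ 1, q ≤ 2D, L ≥ 16D²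
  have e1 : D * ((2 * ε + G) * (G * L)) ≤ G * L / 4 := by
    have : D * (2 * ε + G) ≤ 1 / 4 := by nlinarith
    calc D * ((2 * ε + G) * (G * L)) = (D * (2 * ε + G)) * (G * L) := by ring
      _ ≤ 1 / 4 * (G * L) := by gcongr
      _ = _ := by ring
  have e2 : D * ((2 * ε + G) * (2 * ε * q + q)) ≤ D * ((4 * ε) * (2 * D * (9 / 8))) := by
    have : 2 * ε ≤ 1 / 8 := by nlinarith
    have : 2 * ε * q + q ≤ 2 * D * (9 / 8) := by nlinarith
    gcongr
    linarith
  nlinarith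

theorem vdc_id (u : ℕ → ℂ) (hu : ∀ t, ‖u t‖ = 1) (M : ℕ) :
    ‖∑ t ∈ Finset.range M, u t‖ ^ 2 = M + 2 * (∑ h ∈ Finset.range M, ∑ t ∈ Finset.range (M - (h + 1)),
      u (t + (h + 1)) * (starRingEnd ℂ) (u t)).re := by
  induction M with
  | zero => simp
  | succ M ih =>
    rw [Finset.sum_range_succ, Finset.sum_range_succ (n := M)]
    simp only [Nat.sub_self, Finset.range_zero, Finset.sum_empty, add_zero]
    have h1 : ∑ h ∈ Finset.range M, ∑ t ∈ Finset.range (M + 1 - (h + 1)),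
      u (t + (h + 1)) * (starRingEnd ℂ) (u t) = ∑ h ∈ Finset.range M, ∑ t ∈ Finset.range (M - (h + 1)),
      u (t + (h + 1)) * (starRingEnd ℂ) (u t) + u M * (starRingEnd ℂ) (∑ t ∈ Finset.range M, u t) := by
      rw [map_sum, Finset.mul_sum, ← Finset.sum_range_reflect (fun t => u M * (starRingEnd ℂ) (u t)), ← Finset.sum_add_distrib]
      apply Finset.sum_congr rfl
      intro h hh
      have hh := Finset.mem_range.1 hh
      rw [show M + 1 - (h + 1) = (M - (h + 1)) + 1 by omega, Finset.sum_range_succ]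
      congr 2
      · congr 1; omega
      · congr 2; omega
    rw [h1, Complex.add_re]
    set S := ∑ t ∈ Finset.range M, u t
    have h2 : ‖S + u M‖ ^ 2 = ‖S‖ ^ 2 + 1 + 2 * (u M * (starRingEnd ℂ) S).re := by
      rw [← Complex.normSq_eq_norm_sq, Complex.normSq_add, Complex.normSq_eq_norm_sq, Complex.normSq_eq_norm_sq, hu]
      have : (S * (starRingEnd ℂ) (u M)).re = (u M * (starRingEnd ℂ) S).re := by
        simp; ring
      rw [this]; ring
    rw [h2, ih]
    push_cast; ring

theorem vdc (u : ℕ → ℂ) (hu : ∀ t, ‖u t‖ = 1) (M : ℕ) :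
    ‖∑ t ∈ Finset.range M, u t‖ ^ 2 ≤ M + 2 * ∑ h ∈ Finset.range M, ‖∑ t ∈ Finset.range (M - (h + 1)),
      u (t + (h + 1)) * (starRingEnd ℂ) (u t)‖ := by
  rw [vdc_id u hu]
  gcongr
  exact (Complex.re_le_norm _).trans (norm_sum_le _ _)

def WeylClaim (k : ℕ) : Prop := ∃ C : ℕ, 1 ≤ C ∧ ∀ (θ : ℝ) (f : ℕ → ℝ), PP k θ f → ∀ (L' L : ℕ), L' ≤ L → 1 ≤ L →
  ∀ D : ℝ, 1 ≤ D → (L : ℝ) ≤ D * ‖∑ t ∈ Finset.range L', ee (f t)‖ →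
  ∃ r : ℕ, 1 ≤ r ∧ (r : ℝ) ≤ C * D ^ C ∧ ∃ z : ℤ, |r * θ - z| ≤ C * D ^ C / (L : ℝ) ^ k

theorem weyl_one : WeylClaim 1 := by
  refine ⟨1, le_rfl, ?_⟩
  intro θ f hf L' L hL' hL D hD hS
  refine ⟨1, le_rfl, by simpa using hD, round θ, ?_⟩
  have h1 : ∀ t, f t = f 0 + t * θ := by
    intro t
    have := hf t 0
    simp only [zero_add] at this
    linarith
  have h2 : ‖∑ t ∈ Finset.range L', ee (f t)‖ = ‖∑ t ∈ Finset.range L', ee θ ^ t‖ := by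
    have : ∑ t ∈ Finset.range L', ee (f t) = ee (f 0) * ∑ t ∈ Finset.range L', ee θ ^ t := by
      rw [Finset.mul_sum]
      apply Finset.sum_congr rfl
      intro t _
      rw [h1 t, ee_add, ee_nat_mul]
    rw [this, norm_mul, ee_norm, one_mul]
  rw [h2] at hS
  have h3 : ‖∑ t ∈ Finset.range L', ee θ ^ t‖ * ‖ee θ - 1‖ ≤ 2 := by
    rw [← norm_mul, geom_sum_mul]
    refine (norm_sub_le _ _).trans ?_
    rw [norm_pow, ee_norm]; norm_num
  have h4 := ee_sub_one_ge θ
  have hLp : (0 : ℝ) < L := by exact_mod_cast hL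
  simp only [Nat.cast_one, one_mul, pow_one]
  rw [le_div_iff₀ hLp]
  have h5 : |θ - round θ| * (4 * L) ≤ 2 * D := by
    calc |θ - round θ| * (4 * L) = (4 * |θ - round θ|) * L := by ring
      _ ≤ ‖ee θ - 1‖ * (D * ‖∑ t ∈ Finset.range L', ee θ ^ t‖) := by gcongr
      _ = D * (‖∑ t ∈ Finset.range L', ee θ ^ t‖ * ‖ee θ - 1‖) := by ring
      _ ≤ D * 2 := by gcongr
      _ = _ := by ring
  linarith

set_option maxHeartbeats 1000000 in
theorem weyl_step (k : ℕ) (hk : 1 ≤ k) (ih : WeylClaim k) : WeylClaim (k + 1) := by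
  obtain ⟨C, hC, ih⟩ := ih
  set C1 : ℕ := (256 * C ^ 3 * 8 ^ (3 * C)) ^ (k + 1) with hC1
  refine ⟨max C1 ((6 * C + 4) * (k + 1)), le_max_of_le_right (by nlinarith), ?_⟩
  set C' := max C1 ((6 * C + 4) * (k + 1)) with hC'
  intro θ f hf L' L hL' hL D hD hS
  have hLp : (0 : ℝ) < L := by exact_mod_cast hL
  have hL1 : (1 : ℝ) ≤ L := by exact_mod_cast hL
  have hC1r : (1 : ℝ) ≤ C := by exact_mod_cast hC
  set K : ℝ := C * (8 * D ^ 2) ^ C with hK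
  have hD2 : (1 : ℝ) ≤ D ^ 2 := one_le_pow₀ hD
  have hK1 : 1 ≤ K := one_le_mul_of_one_le_of_one_le hC1r (one_le_pow₀ (by linarith))
  set V : ℝ := 256 * K ^ 3 * D ^ 4 with hV
  have hV1 : 1 ≤ V := by
    have h1 : 1 ≤ K ^ 3 := one_le_pow₀ hK1
    have h2 : 1 ≤ D ^ 4 := one_le_pow₀ hD
    nlinarith
  have hVC : V ^ (k + 1) ≤ C' * D ^ C' := by
    have h1 : V ^ (k + 1) = C1 * D ^ ((6 * C + 4) * (k + 1)) := by
      rw [hV, hK, hC1]; push_cast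
      rw [pow_mul D, ← mul_pow]
      congr 1
      ring
    rw [h1]
    gcongr
    · exact le_max_left _ _
    · exact le_max_right _ _
  have hVV : V ≤ V ^ (k + 1) := by
    calc V = V ^ 1 := (pow_one V).symm
      _ ≤ _ := pow_le_pow_right₀ hV1 (by omega)
  have htriv : (L : ℝ) ≤ V → ∃ r : ℕ, 1 ≤ r ∧ (r : ℝ) ≤ C' * D ^ C' ∧ ∃ z : ℤ, |r * θ - z| ≤ C' * D ^ C' / (L : ℝ) ^ (k + 1) := by
    intro hLV
    refine ⟨1, le_rfl, ?_, round θ, ?_⟩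
    · push_cast; linarith
    · rw [le_div_iff₀ (by positivity)]
      push_cast
      rw [one_mul]
      have h1 := abs_sub_round θ
      have h2 : (L : ℝ) ^ (k + 1) ≤ V ^ (k + 1) := by gcongr
      have h3 : (0 : ℝ) < (L : ℝ) ^ (k + 1) := by positivity
      nlinarith
  by_cases hbig : (L : ℝ) ≤ V
  · exact htriv hbig
  push Not at hbig
  set S : ℕ → ℝ := fun h => ‖∑ t ∈ Finset.range (L' - (h + 1)), ee (f (t + (h + 1)) - f t)‖ with hSdef
  have hSle : ∀ h, S h ≤ L := by
    intro h
    refine (norm_sum_le _ _).trans ?_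
    simp only [ee_norm, Finset.sum_const, Finset.card_range, nsmul_eq_mul, mul_one]
    exact_mod_cast (Nat.sub_le _ _).trans hL'
  have hv : (‖∑ t ∈ Finset.range L', ee (f t)‖) ^ 2 ≤ L + 2 * ∑ h ∈ Finset.range L', S h := by
    have h1 := vdc (fun t => ee (f t)) (fun t => ee_norm _) L'
    have h2 : (L' : ℝ) ≤ L := by exact_mod_cast hL'
    have h3 : ∀ a b : ℝ, ee a * (starRingEnd ℂ) (ee b) = ee (a - b) := by
      intro a b; rw [ee_conj, ← ee_add, sub_eq_add_neg]
    simp only [h3] at h1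
    linarith
  have hKD : 4 * D ^ 2 ≤ V := by
    have h1 : 1 ≤ K ^ 3 := one_le_pow₀ hK1
    have h2 : D ^ 4 = D ^ 2 * D ^ 2 := by ring
    rw [hV, h2]
    have : D ^ 2 ≤ D ^ 2 * D ^ 2 := by nlinarith
    nlinarith
  set H := (Finset.range L').filter (fun h => (L : ℝ) ≤ 8 * D ^ 2 * S h) with hH
  have hHcard : (L : ℝ) ≤ 4 * D ^ 2 * H.card := by
    have h1 : ∑ h ∈ Finset.range L', S h ≤ ∑ h ∈ Finset.range L', ((if (L : ℝ) ≤ 8 * D ^ 2 * S h then (L : ℝ) else 0) + L / (8 * D ^ 2)) := by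
      apply Finset.sum_le_sum
      intro h _
      split_ifs with hc
      · have := hSle h
        have : 0 ≤ (L : ℝ) / (8 * D ^ 2) := by positivity
        linarith
      · push Not at hc
        rw [zero_add, le_div_iff₀ (by positivity)]
        linarith
    rw [Finset.sum_add_distrib, ← Finset.sum_filter, Finset.sum_const, Finset.sum_const, Finset.card_range, nsmul_eq_mul, nsmul_eq_mul] at h1
    have h2 : (L' : ℝ) * (L / (8 * D ^ 2)) ≤ L * (L / (8 * D ^ 2)) := by
      have h2 : (L' : ℝ) ≤ L := by exact_mod_cast hL'
      gcongr
    have h3 : (L : ℝ) ^ 2 ≤ D ^ 2 * (L + 2 * (H.card * L + L * (L / (8 * D ^ 2)))) := by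
      calc (L : ℝ) ^ 2 ≤ (D * ‖∑ t ∈ Finset.range L', ee (f t)‖) ^ 2 := by gcongr
        _ = D ^ 2 * ‖∑ t ∈ Finset.range L', ee (f t)‖ ^ 2 := by ring
        _ ≤ _ := by gcongr; linarith
    have h4 : D ^ 2 * (L + 2 * (H.card * L + L * (L / (8 * D ^ 2)))) = L * (D ^ 2 + 2 * D ^ 2 * H.card + L / 4) := by
      field_simp; ring
    rw [h4, sq] at h3
    have h5 := le_of_mul_le_mul_left h3 hLp
    linarith
  -- apply ih
  have hih : ∀ h ∈ H, ∃ r : ℕ, 1 ≤ r ∧ (r : ℝ) ≤ K ∧ ∃ z : ℤ, |r * (((h + 1 : ℕ) : ℝ) * θ) - z| ≤ K / (L : ℝ) ^ k := by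
    intro h hh
    exact ih _ _ (hf (h + 1)) (L' - (h + 1)) L ((Nat.sub_le _ _).trans hL') hL (8 * D ^ 2) (by linarith) (Finset.mem_filter.1 hh).2
  choose! r hr1 hrK hrz using hih
  -- pigeonhole
  set R := ⌊K⌋₊ with hR
  obtain ⟨r0, hr0, hr0c⟩ : ∃ r0 ∈ Finset.Icc 1 R, (H.card : ℝ) ≤ K * ((H.filter (fun h => r h = r0)).card : ℝ) := by
    by_contra hcon
    push Not at hcon
    have h1 : H.card = ∑ r0 ∈ Finset.Icc 1 R, (H.filter (fun h => r h = r0)).card :=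
      Finset.card_eq_sum_card_fiberwise (fun h hh => by
        simp only [Finset.coe_Icc, Set.mem_Icc]
        exact ⟨hr1 h hh, Nat.le_floor (hrK h hh)⟩)
    have hRne : (Finset.Icc 1 R).Nonempty := ⟨1, Finset.mem_Icc.2 ⟨le_rfl, Nat.le_floor (by simpa using hK1)⟩⟩
    have h2 : ∑ r0 ∈ Finset.Icc 1 R, K * ((H.filter (fun h => r h = r0)).card : ℝ) < ∑ r0 ∈ Finset.Icc 1 R, (H.card : ℝ) :=
      Finset.sum_lt_sum_of_nonempty hRne hcon
    rw [← Finset.mul_sum, ← Nat.cast_sum, ← h1, Finset.sum_const, nsmul_eq_mul, Nat.card_Icc] at h2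
    have h3 : ((R + 1 - 1 : ℕ) : ℝ) ≤ K := by
      rw [Nat.add_sub_cancel]; exact Nat.floor_le (by linarith)
    have : (0 : ℝ) ≤ H.card := by positivity
    nlinarith
  have hr0' := Finset.mem_Icc.1 hr0
  have hr0K : (r0 : ℝ) ≤ K := (Nat.le_floor_iff (by linarith)).1 hr0'.2
  set A := (H.filter (fun h => r h = r0)).image (fun h => h + 1) with hA
  have hAcard : A.card = (H.filter (fun h => r h = r0)).card := by
    rw [hA, Finset.card_image_of_injective _ (fun a b hab => by simpa using hab)]
  set D1 : ℝ := 4 * D ^ 2 * K with hD1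
  have hD11 : 1 ≤ D1 := by nlinarith
  have hVD : V = 16 * K * D1 ^ 2 := by rw [hV, hD1]; ring
  obtain ⟨q, hq1, hqD, z, hqz⟩ := vino (r0 * θ) (K / (L : ℝ) ^ k) D1 L A (by positivity) hD11 (by
      intro h hh
      obtain ⟨h, hh0, rfl⟩ := Finset.mem_image.1 hh
      clear hh; rename' hh0 => hh
      have h1 := (Finset.mem_filter.1 hh).1
      have h2 := (Finset.mem_filter.1 h1).2
      by_contra hcon
      have h3 : S h = 0 := by
        simp only [hSdef]
        rw [show L' - (h + 1) = 0 by omega]; simp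
      rw [h3] at h2
      linarith) (by
      rw [hAcard]
      calc (L : ℝ) ≤ 4 * D ^ 2 * H.card := hHcard
        _ ≤ 4 * D ^ 2 * (K * ((H.filter (fun h => r h = r0)).card : ℝ)) := by gcongr
        _ = _ := by rw [hD1]; ring) (by
      intro h hh
      obtain ⟨h, hh0, rfl⟩ := Finset.mem_image.1 hh
      clear hh; rename' hh0 => hh
      have h1 := (Finset.mem_filter.1 hh).1
      have h2 := (Finset.mem_filter.1 hh).2
      obtain ⟨z, hz⟩ := hrz h h1
      refine ⟨z, ?_⟩
      rw [h2] at hz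
      convert hz using 2
      ring) (by
      have h1 : (L : ℝ) ≤ (L : ℝ) ^ k := by
        calc (L : ℝ) = (L : ℝ) ^ 1 := (pow_one _).symm
          _ ≤ _ := pow_le_pow_right₀ hL1 hk
      rw [← mul_div_assoc, div_le_one (by positivity)]
      rw [hVD] at hbig
      have : D1 ≤ D1 ^ 2 := by nlinarith
      have : 16 * D1 * K ≤ 16 * K * D1 ^ 2 := by
        calc 16 * D1 * K = 16 * K * D1 := by ring
          _ ≤ _ := by gcongr
      linarith) (by
      rw [hVD] at hbig
      have h2 : 0 ≤ D1 ^ 2 := by positivity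
      nlinarith)
  refine ⟨r0 * q, ?_, ?_, z, ?_⟩
  · exact Nat.mul_pos hr0'.1 hq1
  · push_cast
    refine le_trans ?_ (hVV.trans hVC)
    calc (r0 : ℝ) * q ≤ K * (2 * D1) := by gcongr
      _ ≤ V := by
        rw [hVD]
        have h1 : D1 ≤ D1 ^ 2 := by
          rw [sq]; exact le_mul_of_one_le_left (by linarith) hD11
        have h2 : K * D1 ≤ K * D1 ^ 2 := mul_le_mul_of_nonneg_left h1 (by linarith)
        have h3 : 0 ≤ K * D1 ^ 2 := by positivity
        linarith
  · push_cast
    rw [show (r0 : ℝ) * q * θ = r0 * θ * q by ring]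
    refine hqz.trans ?_
    have h1 : 16 * (K / (L : ℝ) ^ k) * D1 ^ 2 / L = V / (L : ℝ) ^ (k + 1) := by
      rw [hVD]; field_simp; ring
    rw [h1]
    have := hVV.trans hVC
    gcongr

theorem weyl (k : ℕ) (hk : 1 ≤ k) : WeylClaim k := by
  induction k, hk using Nat.le_induction with
  | base => exact weyl_one
  | succ k hk ih => exact weyl_step k hk ih

theorem weyl_cor (k : ℕ) (hk : 1 ≤ k) : ∃ C : ℕ, 1 ≤ C ∧ ∀ (L : ℕ) (α D : ℝ), 1 ≤ L → 1 ≤ D →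
    (L : ℝ) ≤ D * ‖∑ t ∈ Finset.range L, ee (α * (2 * ((4 * t + 3 : ℕ) : ℝ) ^ k))‖ →
    ∃ r : ℕ, 1 ≤ r ∧ (r : ℝ) ≤ C * D ^ C ∧ ∃ z : ℤ, |r * α - z| ≤ C * D ^ C / (L : ℝ) ^ k := by
  obtain ⟨C, hC, h⟩ := weyl k hk
  set B : ℕ := 2 * (4 ^ k * k.factorial) with hB
  have hB1 : 1 ≤ B := by rw [hB]; have := Nat.factorial_pos k; have : 0 < 4 ^ k := by positivity
                         nlinarith
  have hB1' : (1 : ℝ) ≤ B := by exact_mod_cast hB1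
  refine ⟨B * C, by nlinarith, ?_⟩
  intro L α D hL hD hS
  obtain ⟨r, hr1, hrC, z, hz⟩ := h _ _ (PP_main k (2 * α)) L L le_rfl hL D hD (by
    convert hS using 5
    ring_nf)
  have hpow : D ^ C ≤ D ^ (B * C) := pow_le_pow_right₀ hD (by nlinarith)
  refine ⟨r * B, Nat.mul_pos hr1 hB1, ?_, z, ?_⟩
  · push_cast
    calc (r : ℝ) * B ≤ C * D ^ (B * C) * B := by gcongr; exact hrC.trans (by gcongr)
      _ = _ := by ring
  · have h1 : ((r * B : ℕ) : ℝ) * α = r * (2 * α * (4 ^ k * k.factorial)) := by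
      rw [hB]; push_cast; ring
    rw [h1]
    refine hz.trans ?_
    gcongr
    push_cast
    have : (0 : ℝ) ≤ C := by positivity
    nlinarith

theorem ee_rat_primitive (p s : ℕ) (hs : s ≠ 0) (h : p.Coprime s) : IsPrimitiveRoot (ee ((p : ℝ) / s)) s := by
  have := Complex.isPrimitiveRoot_exp_of_coprime p s hs h
  convert! this using 1
  unfold ee; congr 1; push_cast; ring

theorem sum_primitiveRoots (s : ℕ) (hs : 0 < s) :
    ∑ ζ ∈ primitiveRoots s ℂ, ζ = (ArithmeticFunction.moebius s : ℂ) := by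
  have h1 : ∀ n > 0, ∑ i ∈ n.divisors, ∑ ζ ∈ primitiveRoots i ℂ, ζ = if n = 1 then (1 : ℂ) else 0 := by
    intro n hn
    classical
    rw [← Finset.sum_biUnion (fun a _ b _ hab => IsPrimitiveRoot.disjoint hab), ← IsPrimitiveRoot.nthRoots_one_eq_biUnion_primitiveRoots]
    have hζ := Complex.isPrimitiveRoot_exp n hn.ne'
    set ζ := Complex.exp (2 * Real.pi * Complex.I / n)
    have h2 : Polynomial.nthRootsFinset n (1 : ℂ) = (Finset.range n).image (fun i => ζ ^ i) := by
      ext x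
      simp only [Finset.mem_image, Finset.mem_range, Polynomial.mem_nthRootsFinset hn]
      haveI : NeZero n := ⟨hn.ne'⟩
      constructor
      · intro hx
        obtain ⟨i, hi, rfl⟩ := hζ.eq_pow_of_pow_eq_one hx
        exact ⟨i, hi, rfl⟩
      · rintro ⟨i, hi, rfl⟩
        rw [← pow_mul, mul_comm, pow_mul, hζ.pow_eq_one, one_pow]
    rw [h2, Finset.sum_image (fun a ha b hb hab => hζ.pow_inj (Finset.mem_range.1 ha) (Finset.mem_range.1 hb) hab)]
    split_ifs with h
    · subst h; simp
    · exact hζ.geom_sum_eq_zero (by omega)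
  have h2 := (ArithmeticFunction.sum_eq_iff_sum_mul_moebius_eq (R := ℂ)).1 h1 s hs
  rw [← h2, Finset.sum_eq_single (s, 1)]
  · simp
  · intro x hx hne
    rw [Nat.mem_divisorsAntidiagonal] at hx
    rw [if_neg, mul_zero]
    intro h
    apply hne
    ext
    · simp only; rw [← hx.1, h, mul_one]
    · exact h
  · intro h
    exact absurd (Nat.mem_divisorsAntidiagonal.2 ⟨by simp, hs.ne'⟩) h

theorem ramanujan (p s : ℕ) (hs : 0 < s) (h : p.Coprime s) :
    ∑ b ∈ (Finset.range s).filter (fun b => b.Coprime s), ee ((p : ℝ) * (b / s)) = (ArithmeticFunction.moebius s : ℂ) := by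
  rw [← sum_primitiveRoots s hs]
  have hζ := ee_rat_primitive p s hs.ne' h
  have h1 : ∀ b : ℕ, ee ((p : ℝ) * (b / s)) = ee ((p : ℝ) / s) ^ b := by
    intro b; rw [← ee_nat_mul]; congr 1; ring
  refine Finset.sum_bij (fun b _ => ee ((p : ℝ) / s) ^ b) ?_ ?_ ?_ ?_
  · intro b hb
    obtain ⟨h2, h3⟩ := Finset.mem_filter.1 hb
    rw [mem_primitiveRoots hs]
    exact hζ.pow_of_coprime b h3
  · intro a ha b hb hab
    exact hζ.pow_inj (Finset.mem_range.1 (Finset.mem_filter.1 ha).1) (Finset.mem_range.1 (Finset.mem_filter.1 hb).1) hab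
  · intro ξ hξ
    rw [mem_primitiveRoots hs] at hξ
    haveI : NeZero s := ⟨hs.ne'⟩
    obtain ⟨i, hi, hic, rfl⟩ := (hζ.isPrimitiveRoot_iff).1 hξ
    exact ⟨i, Finset.mem_filter.2 ⟨Finset.mem_range.2 hi, hic⟩, rfl⟩
  · intro b _; exact h1 b

theorem orth (Q : ℕ) (hQ : 0 < Q) (n : ℤ) :
    ∑ x ∈ Finset.range Q, ee ((n : ℝ) * (x / Q)) = if (Q : ℤ) ∣ n then (Q : ℂ) else 0 := by
  have hQr : (Q : ℝ) ≠ 0 := by positivity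
  have h1 : ∀ x : ℕ, ee ((n : ℝ) * (x / Q)) = ee ((n : ℝ) / Q) ^ x := by
    intro b; rw [← ee_nat_mul]; congr 1; ring
  simp only [h1]
  split_ifs with h
  · obtain ⟨m, rfl⟩ := h
    have : ((Q * m : ℤ) : ℝ) / Q = (m : ℤ) := by push_cast; field_simp
    rw [this, ee_int]; simp
  · have hne : ee ((n : ℝ) / Q) ≠ 1 := by
      intro h2
      apply h
      unfold ee at h2
      rw [Complex.exp_eq_one_iff] at h2
      obtain ⟨m, hm⟩ := h2
      have h3 : ((n : ℝ) : ℂ) / Q = m := by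
        have hI : (2 * Real.pi * Complex.I : ℂ) ≠ 0 := Complex.two_pi_I_ne_zero
        apply mul_right_cancel₀ hI
        rw [← hm]; push_cast; ring
      have h4 : (n : ℝ) / Q = m := by exact_mod_cast h3
      rw [div_eq_iff hQr] at h4
      exact ⟨m, by rw [mul_comm]; exact_mod_cast h4⟩
    have h2 := mul_geom_sum (ee ((n : ℝ) / Q)) Q
    rw [← ee_nat_mul, show (Q : ℝ) * ((n : ℝ) / Q) = (n : ℤ) by field_simp, ee_int, sub_self] at h2
    exact (mul_eq_zero.1 h2).resolve_left (sub_ne_zero.2 hne)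

/-- exponential sum over a finite set -/
noncomputable def SS (P : Finset ℕ) (α : ℝ) : ℂ := ∑ p ∈ P, ee ((p : ℝ) * α)

theorem SS_add_int (P : Finset ℕ) (α : ℝ) (z : ℤ) : SS P (α + z) = SS P α := by
  unfold SS
  apply Finset.sum_congr rfl
  intro p _
  rw [mul_add, ee_add, show (p : ℝ) * (z : ℝ) = ((p * z : ℤ) : ℝ) by push_cast; ring, ee_int, mul_one]

theorem parseval (P : Finset ℕ) (Q : ℕ) (hQ : ∀ p ∈ P, p < Q) (hQ0 : 0 < Q) :
    ∑ x ∈ Finset.range Q, ‖SS P ((x : ℝ) / Q)‖ ^ 2 = Q * P.card := by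
  have h1 : ∀ α : ℝ, ((‖SS P α‖ ^ 2 : ℝ) : ℂ) = ∑ p ∈ P, ∑ q ∈ P, ee ((((p : ℤ) - q : ℤ) : ℝ) * α) := by
    intro α
    push_cast
    rw [← Complex.mul_conj', SS, map_sum, Finset.sum_mul_sum]
    apply Finset.sum_congr rfl; intro p _
    apply Finset.sum_congr rfl; intro q _
    rw [ee_conj, ← ee_add]; congr 1; ring
  have h2 : ((∑ x ∈ Finset.range Q, ‖SS P ((x : ℝ) / Q)‖ ^ 2 : ℝ) : ℂ) = (Q * P.card : ℝ) := by
    rw [Complex.ofReal_sum]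
    simp only [h1]
    rw [Finset.sum_comm]
    have : ∀ p ∈ P, ∑ x ∈ Finset.range Q, ∑ q ∈ P, ee ((((p : ℤ) - q : ℤ) : ℝ) * ((x : ℝ) / Q)) = (Q : ℂ) := by
      intro p hp
      rw [Finset.sum_comm]
      simp only [orth Q hQ0]
      rw [Finset.sum_eq_single p]
      · simp
      · intro q hq hqp
        rw [if_neg]
        intro hd
        have h3 := hQ p hp
        have h4 := hQ q hq
        have := Int.eq_zero_of_abs_lt_dvd hd (by rw [abs_lt]; constructor <;> omega)
        omega
      · intro h; exact absurd hp h
    rw [Finset.sum_congr rfl this]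
    simp; ring
  exact_mod_cast h2

/-- squarefree rough numbers -/
noncomputable def RS (m Z : ℕ) : Finset ℕ := by
  classical exact (Finset.Icc 1 Z).filter (fun s => Squarefree s ∧ ∀ p : ℕ, p.Prime → p ∣ s → 2 ^ m ≤ p)

theorem mem_RS {m Z s : ℕ} : s ∈ RS m Z ↔ (1 ≤ s ∧ s ≤ Z) ∧ Squarefree s ∧ ∀ p : ℕ, p.Prime → p ∣ s → 2 ^ m ≤ p := by
  classical
  unfold RS
  rw [Finset.mem_filter, Finset.mem_Icc]

theorem RS_coprime {m Z s r : ℕ} (hs : s ∈ RS m Z) (hr : 1 ≤ r) (hr2 : r < 2 ^ m) : s.Coprime r := by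
  rw [mem_RS] at hs
  apply Nat.Coprime.symm
  apply Nat.coprime_of_dvd
  intro p hp hpr hps
  have h1 := Nat.le_of_dvd hr hpr
  have h2 := hs.2.2 p hp hps
  omega

theorem mont_point (P : Finset ℕ) (s : ℕ) (hs : 0 < s) (hsq : Squarefree s) (hP : ∀ p ∈ P, p.Coprime s) (α : ℝ) :
    ‖SS P α‖ ^ 2 * (1 / (s.totient : ℝ)) ≤ ∑ b ∈ (Finset.range s).filter (fun b => b.Coprime s), ‖SS P (α + b / s)‖ ^ 2 := by
  set B := (Finset.range s).filter (fun b => b.Coprime s) with hB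
  have hcard : B.card = s.totient := by
    rw [Nat.totient_eq_card_coprime, hB]
    congr 1; ext b; simp [Nat.coprime_comm]
  have h1 : ∑ b ∈ B, SS P (α + b / s) = (ArithmeticFunction.moebius s : ℂ) * SS P α := by
    unfold SS
    rw [Finset.sum_comm, Finset.mul_sum]
    apply Finset.sum_congr rfl
    intro p hp
    rw [← ramanujan p s hs (hP p hp), Finset.sum_mul]
    apply Finset.sum_congr rfl
    intro b _
    rw [← ee_add]; congr 1; ring
  have h2 : ‖(ArithmeticFunction.moebius s : ℂ)‖ = 1 := by
    rcases ArithmeticFunction.moebius_eq_or s with h | h | h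
    · exact absurd (ArithmeticFunction.moebius_ne_zero_iff_squarefree.2 hsq) (by simp [h])
    · simp [h]
    · simp [h]
  have h3 : ‖SS P α‖ ^ 2 ≤ B.card * ∑ b ∈ B, ‖SS P (α + b / s)‖ ^ 2 := by
    calc ‖SS P α‖ ^ 2 = ‖∑ b ∈ B, SS P (α + b / s)‖ ^ 2 := by rw [h1, norm_mul, h2, one_mul]
      _ ≤ (∑ b ∈ B, ‖SS P (α + b / s)‖) ^ 2 := by gcongr; exact norm_sum_le _ _
      _ ≤ _ := sq_sum_le_card_mul_sum_sq
  have h4 : (0 : ℝ) < s.totient := by exact_mod_cast Nat.totient_pos.2 hs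
  rw [hcard] at h3
  rw [mul_one_div, div_le_iff₀ h4]
  linarith

theorem mont_inj (m Z Q : ℕ) (κ : ℝ) (hQ : 0 < Q) (hκ : 2 * 2 ^ m * κ * (Z : ℝ) ^ 2 < 1) (hκ0 : 0 ≤ κ)
    {x x' s s' b b' : ℕ} (hx : x < Q) (hx' : x' < Q) (hs : s ∈ RS m Z) (hs' : s' ∈ RS m Z)
    (hbs : b < s) (hbs' : b' < s') (hb : b.Coprime s) (hb' : b'.Coprime s')
    (hr : ∃ r : ℕ, 1 ≤ r ∧ r < 2 ^ m ∧ ∃ z : ℤ, |(r : ℝ) * (x / Q) - z| ≤ κ)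
    (hr' : ∃ r : ℕ, 1 ≤ r ∧ r < 2 ^ m ∧ ∃ z : ℤ, |(r : ℝ) * (x' / Q) - z| ≤ κ)
    (w : ℤ) (hw : (x : ℝ) / Q + b / s - (x' / Q + b' / s') = w) : x = x' ∧ s = s' ∧ b = b' := by
  obtain ⟨r, hr1, hr2, z, hz⟩ := hr
  obtain ⟨r', hr1', hr2', z', hz'⟩ := hr'
  have hsp : 0 < s := (mem_RS.1 hs).1.1
  have hsp' : 0 < s' := (mem_RS.1 hs').1.1
  have hsr : (0 : ℝ) < s := by exact_mod_cast hsp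
  have hsr' : (0 : ℝ) < s' := by exact_mod_cast hsp'
  have hsZ : (s : ℝ) ≤ Z := by exact_mod_cast (mem_RS.1 hs).1.2
  have hsZ' : (s' : ℝ) ≤ Z := by exact_mod_cast (mem_RS.1 hs').1.2
  have hrr : (r : ℝ) ≤ 2 ^ m := by exact_mod_cast hr2.le
  have hrr' : (r' : ℝ) ≤ 2 ^ m := by exact_mod_cast hr2'.le
  -- key integer
  set Y : ℤ := r * r' * w - r' * z + r * z' with hY
  have hdist : |(r : ℝ) * r' * (b / s - b' / s') - Y| ≤ 2 * 2 ^ m * κ := by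
    have e : (r : ℝ) * r' * (b / s - b' / s') - Y = -(r' * (r * (x / Q) - z)) + r * (r' * (x' / Q) - z') := by
      rw [hY]; push_cast; rw [← hw]; ring
    rw [e]
    refine (abs_add_le _ _).trans ?_
    rw [abs_neg, abs_mul, abs_mul, Nat.abs_cast, Nat.abs_cast]
    have : (r' : ℝ) * |(r : ℝ) * (x / Q) - z| ≤ 2 ^ m * κ := by gcongr
    have : (r : ℝ) * |(r' : ℝ) * (x' / Q) - z'| ≤ 2 ^ m * κ := by gcongr
    linarith
  have hint : (r : ℤ) * r' * (b * s' - b' * s) - Y * (s * s') = 0 := by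
    have h1 : |((r : ℝ) * r' * (b / s - b' / s') - Y) * (s * s')| < 1 := by
      rw [abs_mul, abs_of_pos (by positivity : (0 : ℝ) < s * s')]
      calc |(r : ℝ) * r' * (b / s - b' / s') - Y| * (s * s') ≤ 2 * 2 ^ m * κ * (Z * Z) := by gcongr
        _ = 2 * 2 ^ m * κ * (Z : ℝ) ^ 2 := by ring
        _ < 1 := hκ
    have h2 : ((r : ℝ) * r' * (b / s - b' / s') - Y) * (s * s') = (((r : ℤ) * r' * (b * s' - b' * s) - Y * (s * s') : ℤ) : ℝ) := by
      push_cast; field_simp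
    rw [h2] at h1
    have h3 : |(r : ℤ) * r' * (b * s' - b' * s) - Y * (s * s')| < 1 := by exact_mod_cast h1
    exact Int.abs_lt_one_iff.1 h3
  have hc1 : IsCoprime (s : ℤ) (r * r') := by
    rw [show (r : ℤ) * r' = ((r * r' : ℕ) : ℤ) by push_cast; ring, Nat.isCoprime_iff_coprime]
    exact (RS_coprime hs hr1 hr2).mul_right (RS_coprime hs hr1' hr2')
  have hc2 : IsCoprime (s' : ℤ) (r * r') := by
    rw [show (r : ℤ) * r' = ((r * r' : ℕ) : ℤ) by push_cast; ring, Nat.isCoprime_iff_coprime]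
    exact (RS_coprime hs' hr1 hr2).mul_right (RS_coprime hs' hr1' hr2')
  have hss : s = s' := by
    have hd : (s : ℤ) ∣ (b * s' - b' * s) := hc1.dvd_of_dvd_mul_left ⟨Y * s', by linarith⟩
    have hd' : (s' : ℤ) ∣ (b * s' - b' * s) := hc2.dvd_of_dvd_mul_left ⟨Y * s, by linarith⟩
    have e1 : (s : ℤ) ∣ b * s' := by
      have := dvd_add hd (Dvd.intro_left (b' : ℤ) rfl : (s : ℤ) ∣ b' * s)
      simpa using this
    have e2 : (s' : ℤ) ∣ b' * s := by
      have := dvd_sub (Dvd.intro_left (b : ℤ) rfl : (s' : ℤ) ∣ b * s') hd'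
      simpa using this
    have e1' : s ∣ b * s' := by exact_mod_cast e1
    have e2' : s' ∣ b' * s := by exact_mod_cast e2
    exact Nat.dvd_antisymm (hb.symm.dvd_of_dvd_mul_left e1') (hb'.symm.dvd_of_dvd_mul_left e2')
  subst hss
  have hbb : b = b' := by
    have e0 : (s : ℤ) * ((r : ℤ) * r' * (b - b') - Y * s) = 0 := by linarith
    have e1 : (r : ℤ) * r' * (b - b') - Y * s = 0 := (mul_eq_zero.1 e0).resolve_left (by exact_mod_cast hsp.ne')
    have hd : (s : ℤ) ∣ (b - b') := hc1.dvd_of_dvd_mul_left ⟨Y, by linarith⟩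
    have := Int.eq_zero_of_abs_lt_dvd hd (by rw [abs_lt]; constructor <;> omega)
    omega
  subst hbb
  refine ⟨?_, rfl, rfl⟩
  have hQr : (0 : ℝ) < Q := by exact_mod_cast hQ
  have e : (x : ℝ) - x' = w * Q := by
    rw [← hw]; field_simp; ring
  have e' : (x : ℤ) - x' = w * Q := by exact_mod_cast e
  have := Int.eq_zero_of_abs_lt_dvd (Dvd.intro_left w e'.symm) (by rw [abs_lt]; constructor <;> omega)
  omega

theorem mont (P M : Finset ℕ) (m Z Q : ℕ) (κ : ℝ) (hQ : 0 < Q) (hκ : 2 * 2 ^ m * κ * (Z : ℝ) ^ 2 < 1) (hκ0 : 0 ≤ κ)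
    (hP : ∀ p ∈ P, p < Q) (hPZ : ∀ p ∈ P, ∀ s : ℕ, 1 ≤ s → s ≤ Z → p.Coprime s) (hQZ : ∀ s : ℕ, 1 ≤ s → s ≤ Z → s ∣ Q)
    (hM : ∀ x ∈ M, x < Q ∧ ∃ r : ℕ, 1 ≤ r ∧ r < 2 ^ m ∧ ∃ z : ℤ, |(r : ℝ) * (x / Q) - z| ≤ κ) :
    (∑ s ∈ RS m Z, 1 / (s.totient : ℝ)) * ∑ x ∈ M, ‖SS P ((x : ℝ) / Q)‖ ^ 2 ≤ Q * P.card := by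
  set U : ℕ → Finset ℕ := fun s => (Finset.range s).filter (fun b => b.Coprime s) with hU
  set T : Finset ((_ : ℕ) × (_ : ℕ) × ℕ) := M.sigma (fun _ => (RS m Z).sigma U) with hT
  have hQr : (0 : ℝ) < Q := by exact_mod_cast hQ
  set φ : ((_ : ℕ) × (_ : ℕ) × ℕ) → ℕ := fun t => (t.1 + t.2.2 * (Q / t.2.1)) % Q with hφ
  have hφZ : ∀ t ∈ T, ∃ w : ℤ, (t.1 : ℝ) / Q + t.2.2 / t.2.1 = (φ t : ℝ) / Q + w := by
    intro t ht
    have hs := (mem_RS.1 (Finset.mem_sigma.1 (Finset.mem_sigma.1 ht).2).1).1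
    have hd := hQZ _ hs.1 hs.2
    refine ⟨((t.1 + t.2.2 * (Q / t.2.1)) / Q : ℕ), ?_⟩
    have h1 := Nat.mod_add_div (t.1 + t.2.2 * (Q / t.2.1)) Q
    have h2 : ((t.1 : ℝ) + t.2.2 * (Q / t.2.1)) = (φ t : ℝ) + Q * ((t.1 + t.2.2 * (Q / t.2.1)) / Q : ℕ) := by
      have hne : ((t.2.1 : ℕ) : ℝ) ≠ 0 := by have := hs.1; positivity
      rw [← Nat.cast_div hd hne]
      exact_mod_cast h1.symm
    have h3 : (t.1 : ℝ) / Q + t.2.2 / t.2.1 = ((t.1 : ℝ) + t.2.2 * (Q / t.2.1)) / Q := by field_simp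
    rw [h3, h2]
    simp only [Int.cast_natCast]
    field_simp
  have hinj : Set.InjOn φ T := by
    intro t ht t' ht' htt
    have a1 := Finset.mem_sigma.1 ht
    have a2 := Finset.mem_sigma.1 a1.2
    have a3 := Finset.mem_filter.1 a2.2
    have b1 := Finset.mem_sigma.1 ht'
    have b2 := Finset.mem_sigma.1 b1.2
    have b3 := Finset.mem_filter.1 b2.2
    obtain ⟨w, hw⟩ := hφZ t ht
    obtain ⟨w', hw'⟩ := hφZ t' ht'
    obtain ⟨e1, e2, e3⟩ := mont_inj m Z Q κ hQ hκ hκ0 (hM _ a1.1).1 (hM _ b1.1).1 a2.1 b2.1 (Finset.mem_range.1 a3.1) (Finset.mem_range.1 b3.1) a3.2 b3.2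
      (hM _ a1.1).2 (hM _ b1.1).2 (w - w') (by rw [hw, hw', htt]; push_cast; ring)
    obtain ⟨x, s, b⟩ := t
    obtain ⟨x', s', b'⟩ := t'
    simp only at e1 e2 e3
    rw [e1, e2, e3]
  calc (∑ s ∈ RS m Z, 1 / (s.totient : ℝ)) * ∑ x ∈ M, ‖SS P ((x : ℝ) / Q)‖ ^ 2
      = ∑ x ∈ M, ∑ s ∈ RS m Z, ‖SS P ((x : ℝ) / Q)‖ ^ 2 * (1 / (s.totient : ℝ)) := by
        rw [Finset.mul_sum]
        apply Finset.sum_congr rfl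
        intro x _
        rw [← Finset.mul_sum, mul_comm]
    _ ≤ ∑ x ∈ M, ∑ s ∈ RS m Z, ∑ b ∈ U s, ‖SS P ((x : ℝ) / Q + b / s)‖ ^ 2 := by
        apply Finset.sum_le_sum; intro x _
        apply Finset.sum_le_sum; intro s hs
        have hs' := mem_RS.1 hs
        exact mont_point P s hs'.1.1 hs'.2.1 (fun p hp => hPZ p hp s hs'.1.1 hs'.1.2) _
    _ = ∑ t ∈ T, ‖SS P ((t.1 : ℝ) / Q + t.2.2 / t.2.1)‖ ^ 2 := by
        rw [hT, Finset.sum_sigma]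
        apply Finset.sum_congr rfl; intro x _
        rw [Finset.sum_sigma]
    _ = ∑ t ∈ T, ‖SS P ((φ t : ℝ) / Q)‖ ^ 2 := by
        apply Finset.sum_congr rfl
        intro t ht
        obtain ⟨w, hw⟩ := hφZ t ht
        rw [hw, SS_add_int]
    _ = ∑ y ∈ T.image φ, ‖SS P ((y : ℝ) / Q)‖ ^ 2 := by
        rw [Finset.sum_image hinj]
    _ ≤ ∑ y ∈ Finset.range Q, ‖SS P ((y : ℝ) / Q)‖ ^ 2 := by
        apply Finset.sum_le_sum_of_subset_of_nonneg
        · intro y hy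
          obtain ⟨t, _, rfl⟩ := Finset.mem_image.1 hy
          exact Finset.mem_range.2 (Nat.mod_lt _ hQ)
        · intros; positivity
    _ = _ := parseval P Q hP hQ

theorem prime_recip (m : ℕ) : ∑ p ∈ (Nat.primesBelow (2 ^ (m + 1)) : Finset ℕ), (1 : ℝ) / ((p : ℕ) : ℝ) ≤ 4 * (harmonic m : ℝ) := by
  induction m with
  | zero =>
    rw [show (2 ^ (0 + 1) : ℕ).primesBelow = ∅ by decide]; simp
  | succ m ih =>
    set A := ((2 ^ (m + 1 + 1)).primesBelow).filter (fun p => ¬ p < 2 ^ (m + 1)) with hA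
    have h1 : ∑ p ∈ (Nat.primesBelow (2 ^ (m + 1 + 1)) : Finset ℕ), (1 : ℝ) / ((p : ℕ) : ℝ) = ∑ p ∈ (Nat.primesBelow (2 ^ (m + 1)) : Finset ℕ), (1 : ℝ) / ((p : ℕ) : ℝ) + ∑ p ∈ A, (1 : ℝ) / p := by
      rw [← Finset.sum_filter_add_sum_filter_not _ (fun p => p < 2 ^ (m + 1))]
      congr 2
      ext p
      simp only [Nat.mem_primesBelow, Finset.mem_filter]
      have : 2 ^ (m + 1) < 2 ^ (m + 1 + 1) := Nat.pow_lt_pow_right (by norm_num) (by omega)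
      constructor
      · rintro ⟨⟨_, h2⟩, h3⟩; exact ⟨h3, h2⟩
      · rintro ⟨h2, h3⟩; exact ⟨⟨by omega, h3⟩, h2⟩
    have hlog2 : 0 < Real.log 2 := Real.log_pos (by norm_num)
    have h2 : ∑ p ∈ A, Real.log p ≤ Real.log 4 * (2 ^ (m + 1 + 1) : ℕ) := by
      refine le_trans ?_ (Chebyshev.theta_le_log4_mul_x (by positivity))
      rw [Chebyshev.theta_eq_sum_primesLE_log]
      apply Finset.sum_le_sum_of_subset_of_nonneg
      · intro p hp
        have := Nat.mem_primesBelow.1 (Finset.mem_filter.1 hp).1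
        rw [Nat.mem_primesLE]
        exact ⟨this.1.le, this.2⟩
      · intro p _ _
        exact Real.log_natCast_nonneg p
    have h3 : ∑ p ∈ A, (1 : ℝ) / p * ((m + 1) * Real.log 2 * 2 ^ (m + 1)) ≤ ∑ p ∈ A, Real.log p := by
      apply Finset.sum_le_sum
      intro p hp
      have hp1 := (Finset.mem_filter.1 hp).2
      push Not at hp1
      have hp2 : (2 : ℝ) ^ (m + 1) ≤ p := by exact_mod_cast hp1
      have hpp : (0 : ℝ) < p := lt_of_lt_of_le (by positivity) hp2
      have h4 : (m + 1) * Real.log 2 ≤ Real.log p := by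
        have := Real.log_le_log (by positivity) hp2
        rw [Real.log_pow] at this
        push_cast at this
        exact this
      calc (1 : ℝ) / p * ((m + 1) * Real.log 2 * 2 ^ (m + 1)) = ((m + 1) * Real.log 2) * (2 ^ (m + 1) / p) := by ring
        _ ≤ Real.log p * 1 := by
          gcongr
          exact (div_le_one hpp).2 hp2
        _ = _ := mul_one _
    rw [← Finset.sum_mul] at h3
    have h4 : ∑ p ∈ A, (1 : ℝ) / p ≤ 4 / (m + 1) := by
      rw [le_div_iff₀ (by positivity)]
      have h5 : Real.log 4 = 2 * Real.log 2 := by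
        rw [show (4 : ℝ) = 2 ^ 2 by norm_num, Real.log_pow]; norm_num
      rw [h5] at h2
      push_cast at h2
      have h6 : (∑ p ∈ A, (1 : ℝ) / p * (m + 1)) * (Real.log 2 * 2 ^ (m + 1)) ≤ 4 * (Real.log 2 * 2 ^ (m + 1)) := by
        rw [← Finset.sum_mul]
        calc _ = (∑ p ∈ A, (1 : ℝ) / p) * ((m + 1) * Real.log 2 * 2 ^ (m + 1)) := by ring
          _ ≤ _ := h3.trans h2
          _ = _ := by ring
      have := le_of_mul_le_mul_right h6 (by positivity)
      rwa [← Finset.sum_mul] at this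
    rw [h1, harmonic_succ]
    push_cast
    have : (4 : ℝ) / (m + 1) = 4 * ((m : ℝ) + 1)⁻¹ := by ring
    linarith

theorem mertens_prod (m : ℕ) (hm : 1 ≤ m) : ∏ p ∈ (Nat.primesBelow (2 ^ m) : Finset ℕ), (1 + (1 : ℝ) / ((p : ℕ) : ℝ)) ≤ Real.exp 4 * m ^ 4 := by
  obtain ⟨m, rfl⟩ : ∃ n, m = n + 1 := ⟨m - 1, by omega⟩
  refine (Real.prod_one_add_le_exp_sum _ (fun p => by positivity)).trans ?_
  have h1 : ∑ p ∈ (Nat.primesBelow (2 ^ (m + 1)) : Finset ℕ), (1 : ℝ) / ((p : ℕ) : ℝ) ≤ 4 + 4 * Real.log ((m + 1 : ℕ) : ℝ) := by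
    refine (prime_recip m).trans ?_
    have h2 := harmonic_le_one_add_log m
    have h3 : Real.log m ≤ Real.log ((m + 1 : ℕ) : ℝ) := by
      rcases Nat.eq_zero_or_pos m with rfl | hm
      · simp
      · apply Real.log_le_log (by exact_mod_cast hm); push_cast; linarith
    linarith
  refine (Real.exp_le_exp.2 h1).trans ?_
  rw [Real.exp_add, show 4 * Real.log ((m + 1 : ℕ) : ℝ) = ((4 : ℕ) : ℝ) * Real.log ((m + 1 : ℕ) : ℝ) by norm_num, Real.exp_nat_mul, Real.exp_log (by positivity)]

theorem rough_decomp (m Z n : ℕ) (hn1 : 1 ≤ n) (hn2 : n ≤ Z) :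
    ∃ (v : ℕ) (t : Finset ℕ) (s : ℕ), v ∈ Finset.Ioo 0 (Z + 1) ∧ t ∈ (2 ^ m).primesBelow.powerset ∧ s ∈ RS m Z ∧ v ^ 2 * ((∏ p ∈ t, p) * s) = n := by
  obtain ⟨u, v, hu, hv, huv, hsq⟩ := Nat.sq_mul_squarefree_of_pos hn1
  set s := ∏ p ∈ u.primeFactors.filter (fun p => ¬ p < 2 ^ m), p with hs
  have h1 : (∏ p ∈ u.primeFactors.filter (fun p => p < 2 ^ m), p) * s = u := by
    rw [hs, Finset.prod_filter_mul_prod_filter_not, Nat.prod_primeFactors_of_squarefree hsq]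
  have hsu : s ∣ u := ⟨_, by rw [mul_comm, h1]⟩
  have hun : u ≤ n := by rw [← huv]; exact Nat.le_mul_of_pos_left _ (by positivity)
  refine ⟨v, u.primeFactors.filter (fun p => p < 2 ^ m), s, ?_, ?_, ?_, ?_⟩
  · rw [Finset.mem_Ioo]
    refine ⟨hv, ?_⟩
    have : v ≤ n := by rw [← huv]; nlinarith [Nat.mul_le_mul hv hu]
    omega
  · rw [Finset.mem_powerset]
    intro p hp
    have := Finset.mem_filter.1 hp
    exact Nat.mem_primesBelow.2 ⟨this.2, Nat.prime_of_mem_primeFactors this.1⟩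
  · rw [mem_RS]
    refine ⟨⟨Nat.pos_of_dvd_of_pos hsu hu, ?_⟩, hsq.squarefree_of_dvd hsu, ?_⟩
    · have := Nat.le_of_dvd hu hsu; omega
    · intro p hp hps
      rw [hs] at hps
      obtain ⟨q, hq, hpq⟩ := (hp.prime.dvd_finsetProd_iff _).1 hps
      have hq' := Finset.mem_filter.1 hq
      rw [(Nat.prime_dvd_prime_iff_eq hp (Nat.prime_of_mem_primeFactors hq'.1)).1 hpq]
      omega
  · rw [h1, huv]

theorem rough_sum (m Z : ℕ) (hm : 1 ≤ m) :
    Real.log Z ≤ 2 * Real.exp 4 * m ^ 4 * ∑ s ∈ RS m Z, 1 / (s.totient : ℝ) := by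
  classical
  have hex : ∀ n ∈ Finset.Icc 1 Z, ∃ τ : ℕ × Finset ℕ × ℕ, τ ∈ (Finset.Ioo 0 (Z + 1)) ×ˢ ((2 ^ m).primesBelow.powerset ×ˢ RS m Z) ∧
      τ.1 ^ 2 * ((∏ p ∈ τ.2.1, p) * τ.2.2) = n := by
    intro n hn
    obtain ⟨v, t, s, h1, h2, h3, h4⟩ := rough_decomp m Z n (Finset.mem_Icc.1 hn).1 (Finset.mem_Icc.1 hn).2
    exact ⟨(v, t, s), Finset.mem_product.2 ⟨h1, Finset.mem_product.2 ⟨h2, h3⟩⟩, h4⟩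
  choose! τ hτ hτn using hex
  set T := (Finset.Ioo 0 (Z + 1)) ×ˢ ((2 ^ m).primesBelow.powerset ×ˢ RS m Z)
  set g : ℕ × Finset ℕ × ℕ → ℝ := fun x => ((x.1 : ℝ) ^ 2)⁻¹ * ((∏ p ∈ x.2.1, (1 : ℝ) / p) * (1 / x.2.2)) with hg
  have h1 : ∑ n ∈ Finset.Icc 1 Z, (n : ℝ)⁻¹ ≤ ∑ x ∈ T, g x := by
    have e : ∑ n ∈ Finset.Icc 1 Z, (n : ℝ)⁻¹ = ∑ n ∈ Finset.Icc 1 Z, g (τ n) := by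
      apply Finset.sum_congr rfl
      intro n hn
      conv_lhs => rw [← hτn n hn]
      simp only [hg]
      push_cast
      rw [mul_inv, mul_inv, Finset.prod_div_distrib, Finset.prod_const_one]
      simp only [one_div]
    rw [e, ← Finset.sum_image (f := g) (g := τ)]
    · apply Finset.sum_le_sum_of_subset_of_nonneg
      · intro x hx
        obtain ⟨n, hn, rfl⟩ := Finset.mem_image.1 hx
        exact hτ n hn
      · intro x _ _
        simp only [hg]
        have : 0 ≤ ∏ p ∈ x.2.1, (1 : ℝ) / p := Finset.prod_nonneg (fun p _ => by positivity)
        positivity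
    · intro a ha b hb hab
      rw [← hτn a ha, ← hτn b hb, hab]
  have h2 : ∑ x ∈ T, g x = (∑ v ∈ Finset.Ioo 0 (Z + 1), ((v : ℝ) ^ 2)⁻¹) * ((∏ p ∈ (Nat.primesBelow (2 ^ m) : Finset ℕ), (1 + (1 : ℝ) / ((p : ℕ) : ℝ))) * ∑ s ∈ RS m Z, 1 / (s : ℝ)) := by
    rw [Finset.prod_one_add, Finset.sum_mul_sum, Finset.sum_mul_sum, Finset.sum_product]
    apply Finset.sum_congr rfl
    intro v _
    rw [Finset.sum_product]
    apply Finset.sum_congr rfl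
    intro t _
    rw [Finset.mul_sum]
  have h3 : Real.log Z ≤ ∑ n ∈ Finset.Icc 1 Z, (n : ℝ)⁻¹ := by
    have h := log_add_one_le_harmonic Z
    rw [harmonic_eq_sum_Icc] at h
    push_cast at h
    refine le_trans ?_ h
    rcases Nat.eq_zero_or_pos Z with rfl | hZ
    · simp
    · apply Real.log_le_log (by exact_mod_cast hZ); linarith
  have h4 : ∑ v ∈ Finset.Ioo 0 (Z + 1), ((v : ℝ) ^ 2)⁻¹ ≤ 2 := by
    have := sum_Ioo_inv_sq_le (α := ℝ) 0 (Z + 1)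
    simpa using this
  have h5 : ∑ s ∈ RS m Z, 1 / (s : ℝ) ≤ ∑ s ∈ RS m Z, 1 / (s.totient : ℝ) := by
    apply Finset.sum_le_sum
    intro s hs
    have hs1 := (mem_RS.1 hs).1.1
    have : (0 : ℝ) < s.totient := by exact_mod_cast Nat.totient_pos.2 hs1
    have : (s.totient : ℝ) ≤ s := by exact_mod_cast Nat.totient_le s
    gcongr
  have h50 : 0 ≤ ∑ s ∈ RS m Z, 1 / (s : ℝ) := Finset.sum_nonneg (fun s _ => by positivity)
  calc Real.log Z ≤ _ := h3.trans h1
    _ = _ := h2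
    _ ≤ 2 * ((Real.exp 4 * m ^ 4) * ∑ s ∈ RS m Z, 1 / (s.totient : ℝ)) := by
      have h7 : 0 ≤ ∏ p ∈ (Nat.primesBelow (2 ^ m) : Finset ℕ), (1 + (1 : ℝ) / ((p : ℕ) : ℝ)) :=
        Finset.prod_nonneg (fun p _ => by positivity)
      have h8 := mertens_prod m hm
      exact mul_le_mul h4 (mul_le_mul h8 h5 h50 (by positivity)) (mul_nonneg h7 h50) (by norm_num)
    _ = _ := by ring

noncomputable def hh (M x : ℕ) : ℕ := Nat.card {c : ZMod M // IsUnit c ∧ IsUnit ((x : ZMod M) - c)}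

theorem hh_mul (A B x : ℕ) (h : A.Coprime B) : hh (A * B) x = hh A x * hh B x := by
  unfold hh
  rw [← Nat.card_prod]
  set e := ZMod.chineseRemainder h
  have key : ∀ c : ZMod (A * B), (IsUnit c ∧ IsUnit ((x : ZMod (A * B)) - c)) ↔
      ((IsUnit (e c).1 ∧ IsUnit ((x : ZMod A) - (e c).1)) ∧ (IsUnit (e c).2 ∧ IsUnit ((x : ZMod B) - (e c).2))) := by
    intro c
    have h1 : IsUnit c ↔ IsUnit (e c) := (MulEquiv.isUnit_map e).symm
    have h2 : IsUnit ((x : ZMod (A * B)) - c) ↔ IsUnit (e ((x : ZMod (A * B)) - c)) := (MulEquiv.isUnit_map e).symm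
    rw [h1, h2, map_sub, map_natCast, Prod.isUnit_iff, Prod.isUnit_iff]
    simp only [Prod.fst_sub, Prod.snd_sub, Prod.fst_natCast, Prod.snd_natCast]
    tauto
  apply Nat.card_congr
  exact (e.toEquiv.subtypeEquiv (q := fun d => (IsUnit d.1 ∧ IsUnit ((x : ZMod A) - d.1)) ∧ (IsUnit d.2 ∧ IsUnit ((x : ZMod B) - d.2))) key).trans
    (Equiv.subtypeProdEquivProd (p := fun c : ZMod A => IsUnit c ∧ IsUnit ((x : ZMod A) - c)) (q := fun c : ZMod B => IsUnit c ∧ IsUnit ((x : ZMod B) - c)))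

theorem card_isUnit (n : ℕ) [NeZero n] : Nat.card {c : ZMod n // IsUnit c} = n.totient := by
  rw [← ZMod.card_units_eq_totient n, ← Nat.card_eq_fintype_card]
  exact Nat.card_congr (Equiv.ofBijective (fun c => c.2.unit) ⟨fun a b hab => by
    have := congrArg Units.val hab
    exact Subtype.ext (by simpa using this), fun u => ⟨⟨u, u.isUnit⟩, Units.ext rfl⟩⟩)

theorem hh_lower (n x : ℕ) [NeZero n] : 2 * n.totient ≤ n + hh n x := by
  classical
  have h1 : (Finset.univ.filter (fun c : ZMod n => IsUnit c)).card = n.totient := by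
    rw [← card_isUnit n, Nat.card_eq_fintype_card, Fintype.card_subtype]
  have h2 : (Finset.univ.filter (fun c : ZMod n => IsUnit ((x : ZMod n) - c))).card = n.totient := by
    rw [← h1]
    apply Finset.card_bij (fun c _ => (x : ZMod n) - c)
    · intro a ha; simpa using ha
    · intro a _ b _ hab; simpa using hab
    · intro b hb
      exact ⟨x - b, by simpa using hb, by simp⟩
  have h3 : hh n x = (Finset.univ.filter (fun c : ZMod n => IsUnit c) ∩ Finset.univ.filter (fun c : ZMod n => IsUnit ((x : ZMod n) - c))).card := by
    unfold hh
    rw [Nat.card_eq_fintype_card, Fintype.card_subtype]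
    congr 1
    ext c; simp
  have h4 := Finset.card_union_add_card_inter (Finset.univ.filter (fun c : ZMod n => IsUnit c)) (Finset.univ.filter (fun c : ZMod n => IsUnit ((x : ZMod n) - c)))
  have h5 := Finset.card_le_univ (Finset.univ.filter (fun c : ZMod n => IsUnit c) ∪ Finset.univ.filter (fun c : ZMod n => IsUnit ((x : ZMod n) - c)))
  rw [ZMod.card] at h5
  omega

theorem hh_bound (M x : ℕ) (hM : 0 < M) : Odd M →
    (∏ r ∈ M.primeFactors, (1 - 1 / ((r : ℝ) - 1) ^ 2)) * (M.totient : ℝ) ^ 2 ≤ hh M x * M := by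
  induction M using Nat.recOnPosPrimePosCoprime with
  | zero => omega
  | one =>
    intro _
    have := hh_lower 1 x
    have h1 : 1 ≤ hh 1 x := by rw [Nat.totient_one] at this; omega
    simp; exact_mod_cast h1
  | prime_pow r e hr he =>
    intro hodd
    have hr2 : r ≠ 2 := by
      rintro rfl
      have := (Nat.odd_iff.1 hodd)
      have h2 : 2 ∣ 2 ^ e := dvd_pow_self 2 he.ne'
      omega
    have hr3 : 3 ≤ r := by have := hr.two_le; omega
    have hr3' : (3 : ℝ) ≤ r := by exact_mod_cast hr3
    have : NeZero (r ^ e) := ⟨hM.ne'⟩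
    have h1 := hh_lower (r ^ e) x
    rw [Nat.primeFactors_prime_pow he.ne' hr, Finset.prod_singleton]
    obtain ⟨f, rfl⟩ : ∃ f, e = f + 1 := ⟨e - 1, by omega⟩
    rw [Nat.totient_prime_pow hr he] at h1 ⊢
    have h2 : (2 : ℝ) * ((r ^ f : ℝ) * (r - 1)) ≤ r ^ (f + 1) + hh (r ^ (f + 1)) x := by
      have : ((2 * (r ^ (f + 1 - 1) * (r - 1)) : ℕ) : ℝ) ≤ ((r ^ (f + 1) + hh (r ^ (f + 1)) x : ℕ) : ℝ) := by exact_mod_cast h1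
      push_cast [Nat.cast_sub (show 1 ≤ r by omega)] at this
      simpa using this
    push_cast [Nat.cast_sub (show 1 ≤ r by omega)]
    try simp only [Nat.add_sub_cancel]
    have h3 : (1 - 1 / ((r : ℝ) - 1) ^ 2) * ((r : ℝ) ^ f * (r - 1)) ^ 2 = (r ^ (f + 1) - 2 * r ^ f) * r ^ (f + 1) := by
      have : (r : ℝ) - 1 ≠ 0 := by linarith
      field_simp
      ring
    rw [h3]
    apply mul_le_mul_of_nonneg_right _ (by positivity)
    have : (r : ℝ) ^ (f + 1) = r ^ f * r := pow_succ _ _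
    nlinarith
  | coprime a b ha hb hab iha ihb =>
    intro hodd
    have h1 := iha (by omega) (Nat.odd_mul.1 hodd).1
    have h2 := ihb (by omega) (Nat.odd_mul.1 hodd).2
    rw [hh_mul a b x hab, Nat.totient_mul hab, hab.primeFactors_mul, Finset.prod_union hab.disjoint_primeFactors]
    push_cast
    have nn : ∀ m : ℕ, Odd m → 0 ≤ ∏ r ∈ m.primeFactors, (1 - 1 / ((r : ℝ) - 1) ^ 2) := by
      intro m hm
      apply Finset.prod_nonneg
      intro r hr
      have hrp := Nat.prime_of_mem_primeFactors hr
      have : r ≠ 2 := by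
        rintro rfl
        have := Nat.dvd_of_mem_primeFactors hr
        rw [Nat.odd_iff] at hm; omega
      have hr3 : 3 ≤ r := by have := hrp.two_le; omega
      have hr3' : (3 : ℝ) ≤ r := by exact_mod_cast hr3
      rw [sub_nonneg, div_le_one (by nlinarith)]
      nlinarith
    have n2 := nn b (Nat.odd_mul.1 hodd).2
    calc _ = ((∏ r ∈ a.primeFactors, (1 - 1 / ((r : ℝ) - 1) ^ 2)) * (a.totient : ℝ) ^ 2) * ((∏ r ∈ b.primeFactors, (1 - 1 / ((r : ℝ) - 1) ^ 2)) * (b.totient : ℝ) ^ 2) := by ring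
      _ ≤ (hh a x * a) * (hh b x * b) := by
        apply mul_le_mul h1 h2 (by positivity) (by positivity)
      _ = _ := by ring

theorem prod_half (M : ℕ) (hodd : Odd M) : (1 : ℝ) / 2 ≤ ∏ r ∈ M.primeFactors, (1 - 1 / ((r : ℝ) - 1) ^ 2) := by
  have tele : ∀ K : ℕ, ∏ r ∈ (Finset.Ico 3 (3 + K) : Finset ℕ), (1 - 1 / (((r : ℕ) : ℝ) - 1) ^ 2) = ((K : ℝ) + 2) / (2 * ((K : ℝ) + 1)) := by
    intro K
    induction K with
    | zero => simp
    | succ K ih =>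
      rw [show 3 + (K + 1) = (3 + K) + 1 by ring, Finset.prod_Ico_succ_top (by omega), ih]
      push_cast
      have e : (3 + (K : ℝ) - 1) = K + 2 := by ring
      rw [e]
      field_simp
      ring
  have bd : ∀ r : ℕ, 3 ≤ r → 0 ≤ (1 - 1 / (((r : ℕ) : ℝ) - 1) ^ 2) ∧ (1 - 1 / (((r : ℕ) : ℝ) - 1) ^ 2) ≤ 1 := by
    intro r hr3
    have hr3' : (3 : ℝ) ≤ r := by exact_mod_cast hr3
    constructor
    · rw [sub_nonneg, div_le_one (by nlinarith)]
      nlinarith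
    · have : 0 ≤ 1 / ((r : ℝ) - 1) ^ 2 := by positivity
      linarith
  have hsub : M.primeFactors ⊆ Finset.Ico 3 (3 + M) := by
    intro r hr
    have hrp := Nat.prime_of_mem_primeFactors hr
    have hd := Nat.dvd_of_mem_primeFactors hr
    have : r ≠ 2 := by
      rintro rfl
      rw [Nat.odd_iff] at hodd; omega
    have := hrp.two_le
    have := Nat.le_of_dvd hodd.pos hd
    rw [Finset.mem_Ico]; omega
  have h1 := tele M
  rw [← Finset.prod_sdiff hsub] at h1
  have h2 : ∏ r ∈ Finset.Ico 3 (3 + M) \ M.primeFactors, (1 - 1 / (((r : ℕ) : ℝ) - 1) ^ 2) ≤ 1 := by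
    apply Finset.prod_le_one
    · intro r hr; exact (bd r (Finset.mem_Ico.1 (Finset.mem_sdiff.1 hr).1).1).1
    · intro r hr; exact (bd r (Finset.mem_Ico.1 (Finset.mem_sdiff.1 hr).1).1).2
  have h3 : 0 ≤ ∏ r ∈ M.primeFactors, (1 - 1 / ((r : ℝ) - 1) ^ 2) :=
    Finset.prod_nonneg (fun r hr => (bd r (Finset.mem_Ico.1 (hsub hr)).1).1)
  have h4 : (1 : ℝ) / 2 ≤ ((M : ℝ) + 2) / (2 * ((M : ℝ) + 1)) := by
    rw [div_le_div_iff₀ (by norm_num) (by positivity)]; linarith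
  nlinarith

theorem two_part (a M x : ℕ) (ha : 3 ≤ a) (hM : Odd M) (hx : x % 8 = 2) :
    2 ^ (a - 3) * hh M x ≤ Nat.card {c : ZMod (2 ^ a * M) // c.val % 8 = 5 ∧ IsUnit c ∧ IsUnit ((x : ZMod (2 ^ a * M)) - c)} := by
  have hM0 : M ≠ 0 := hM.pos.ne'
  have : NeZero M := ⟨hM0⟩
  have : NeZero (2 ^ a * M) := ⟨by positivity⟩
  have hco : (2 ^ a).Coprime M := Nat.Coprime.pow_left a (Nat.coprime_two_left.2 hM)
  set e := ZMod.chineseRemainder hco with he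
  have h8 : 8 ∣ 2 ^ a := by
    have := pow_dvd_pow 2 ha; simpa using this
  have hpow : 2 ^ a = 8 * 2 ^ (a - 3) := by
    conv_lhs => rw [show a = 3 + (a - 3) by omega, pow_add]
    norm_num
  have odd_unit : ∀ m : ℕ, m % 2 = 1 → IsUnit ((m : ℕ) : ZMod (2 ^ a)) := by
    intro m hm
    rw [ZMod.isUnit_iff_coprime]
    exact Nat.Coprime.pow_right a (Nat.coprime_two_right.2 (Nat.odd_iff.2 hm))
  let F : Fin (2 ^ (a - 3)) × {c : ZMod M // IsUnit c ∧ IsUnit ((x : ZMod M) - c)} →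
      {c : ZMod (2 ^ a * M) // c.val % 8 = 5 ∧ IsUnit c ∧ IsUnit ((x : ZMod (2 ^ a * M)) - c)} := fun y =>
    ⟨e.symm (((8 * y.1.val + 5 : ℕ) : ZMod (2 ^ a)), y.2.1), by
      set c := e.symm (((8 * y.1.val + 5 : ℕ) : ZMod (2 ^ a)), y.2.1) with hc
      have hec : e c = (((8 * y.1.val + 5 : ℕ) : ZMod (2 ^ a)), y.2.1) := by rw [hc]; exact e.apply_symm_apply _
      have hcv : (c.val : ZMod (2 ^ a * M)) = c := ZMod.natCast_zmod_val c
      have h1 : ((c.val : ℕ) : ZMod (2 ^ a)) = ((8 * y.1.val + 5 : ℕ) : ZMod (2 ^ a)) := by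
        have h := congrArg Prod.fst hec
        rw [← hcv, map_natCast] at h
        exact h
      refine ⟨?_, ?_, ?_⟩
      · rw [ZMod.natCast_eq_natCast_iff] at h1
        have h2 : c.val ≡ 8 * y.1.val + 5 [MOD 8] := h1.of_dvd h8
        unfold Nat.ModEq at h2
        omega
      · rw [← MulEquiv.isUnit_map e, hec, Prod.isUnit_iff]
        exact ⟨odd_unit _ (by omega), y.2.2.1⟩
      · rw [← MulEquiv.isUnit_map e, map_sub, hec, map_natCast, Prod.isUnit_iff]
        refine ⟨?_, y.2.2.2⟩
        simp only [Prod.fst_sub, Prod.fst_natCast]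
        have hl : 8 * y.1.val + 5 ≤ 2 ^ a := by have := y.1.2; omega
        have h3 : ((x : ZMod (2 ^ a)) - ((8 * y.1.val + 5 : ℕ) : ZMod (2 ^ a))) = ((x + (2 ^ a - (8 * y.1.val + 5)) : ℕ) : ZMod (2 ^ a)) := by
          rw [Nat.cast_add x, Nat.cast_sub hl, ZMod.natCast_self]; ring
        rw [h3]
        apply odd_unit
        omega⟩
  have hF : Function.Injective F := by
    rintro ⟨i, c⟩ ⟨j, d⟩ h
    have h1 := e.symm.injective (congrArg Subtype.val h)
    have h2 := congrArg Prod.fst h1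
    have h3 := congrArg Prod.snd h1
    simp only at h2 h3
    rw [ZMod.natCast_eq_natCast_iff', Nat.mod_eq_of_lt (by have := i.2; omega), Nat.mod_eq_of_lt (by have := j.2; omega)] at h2
    have hij : i = j := Fin.ext (by omega)
    rw [hij, Subtype.ext h3]
  have := Nat.card_le_card_of_injective F hF
  rw [Nat.card_prod, Nat.card_fin] at this
  exact this

theorem E_main (R : ℕ) : ∃ W : ℕ, W ≠ 0 ∧ 8 ∣ W ∧ (∀ r, 1 ≤ r → r ≤ R → r ∣ W) ∧
    ∀ x : ℕ, x % 8 = 2 → W.totient ^ 2 ≤ 4 * W * Nat.card {c : ZMod W // c.val % 8 = 5 ∧ IsUnit c ∧ IsUnit ((x : ZMod W) - c)} := by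
  have h0 : 8 * R.factorial ≠ 0 := by have := Nat.factorial_pos R; omega
  obtain ⟨a, M, hM, hW⟩ := Nat.exists_eq_two_pow_mul_odd h0
  have ha : 3 ≤ a := by
    have h1 : 2 ^ 3 ∣ 2 ^ a * M := by rw [← hW]; exact ⟨R.factorial, by norm_num⟩
    have h2 : 2 ^ 3 ∣ 2 ^ a := (Nat.Coprime.dvd_of_dvd_mul_right (Nat.Coprime.pow_left 3 (Nat.coprime_two_left.2 hM)) h1)
    exact (Nat.pow_dvd_pow_iff_le_right (by norm_num)).1 h2
  refine ⟨2 ^ a * M, by rw [← hW]; exact h0, by rw [← hW]; exact dvd_mul_right _ _, ?_, ?_⟩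
  · intro r h1 h2
    rw [← hW]
    exact dvd_mul_of_dvd_right (Nat.dvd_factorial h1 h2) _
  · intro x hx
    have h1 := two_part a M x ha hM hx
    have h2 := hh_bound M x hM.pos hM
    have h3 := prod_half M hM
    have h4 : M.totient ^ 2 ≤ 2 * (hh M x * M) := by
      have : (M.totient : ℝ) ^ 2 ≤ 2 * (hh M x * M) := by nlinarith [sq_nonneg (M.totient : ℝ)]
      exact_mod_cast this
    have hco : (2 ^ a).Coprime M := Nat.Coprime.pow_left a (Nat.coprime_two_left.2 hM)
    rw [Nat.totient_mul hco, Nat.totient_prime_pow Nat.prime_two (by omega)]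
    obtain ⟨b, rfl⟩ : ∃ b, a = b + 3 := ⟨a - 3, by omega⟩
    simp only [Nat.add_sub_cancel, show b + 3 - 1 = b + 2 by omega] at h1 ⊢
    calc _ = (2 ^ (b + 2)) ^ 2 * M.totient ^ 2 := by ring
      _ ≤ (2 ^ (b + 2)) ^ 2 * (2 * (hh M x * M)) := Nat.mul_le_mul_left _ h4
      _ = 4 * (2 ^ (b + 3) * M) * (2 ^ b * hh M x) := by ring
      _ ≤ _ := Nat.mul_le_mul_left _ h1

theorem count_four {ι : Type*} (P : Finset ℕ) (I : Finset ι) (u : ι → ℕ) (Q : ℕ)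
    (hP : ∀ p ∈ P, 2 * p < Q) (hu : ∀ y ∈ I, u y < Q) (hQ : 0 < Q) :
    ∑ x ∈ Finset.range Q, SS P ((x : ℝ) / Q) ^ 2 * ∑ y ∈ I, ee (((u y : ℕ) : ℝ) * (-((x : ℝ) / Q))) =
      Q * (((P ×ˢ P ×ˢ I).filter (fun z => z.1 + z.2.1 = u z.2.2)).card : ℂ) := by
  have h1 : ∀ x : ℕ, SS P ((x : ℝ) / Q) ^ 2 * ∑ y ∈ I, ee (((u y : ℕ) : ℝ) * (-((x : ℝ) / Q))) =
      ∑ z ∈ P ×ˢ P ×ˢ I, ee ((((z.1 + z.2.1 : ℤ) - u z.2.2 : ℤ) : ℝ) * ((x : ℝ) / Q)) := by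
    intro x
    rw [Finset.sum_product]
    simp_rw [Finset.sum_product]
    unfold SS
    rw [sq, mul_assoc, Finset.sum_mul]
    refine Finset.sum_congr rfl fun p _ => ?_
    rw [Finset.sum_mul, Finset.mul_sum]
    refine Finset.sum_congr rfl fun q _ => ?_
    rw [Finset.mul_sum, Finset.mul_sum]
    refine Finset.sum_congr rfl fun y _ => ?_
    rw [← ee_add, ← ee_add]
    congr 1
    push_cast
    ring
  simp_rw [h1]
  rw [Finset.sum_comm]
  simp_rw [orth Q hQ]
  rw [Finset.card_filter]
  push_cast
  rw [Finset.mul_sum]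
  refine Finset.sum_congr rfl fun z hz => ?_
  simp only [Finset.mem_product] at hz
  have e1 := hP _ hz.1
  have e2 := hP _ hz.2.1
  have e3 := hu _ hz.2.2
  have : ((Q : ℤ) ∣ ((z.1 + z.2.1 : ℤ) - u z.2.2)) ↔ z.1 + z.2.1 = u z.2.2 := by
    constructor
    · intro h
      have := Int.eq_zero_of_abs_lt_dvd h (by rw [abs_lt]; constructor <;> omega)
      omega
    · intro h
      rw [show ((z.1 + z.2.1 : ℤ) - u z.2.2) = 0 by omega]; exact dvd_zero _
  simp only [this]
  split_ifs <;> simp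

noncomputable def VV (k L : ℕ) (α : ℝ) : ℂ := ∑ t ∈ Finset.range L, ee (α * (2 * ((4 * t + 3 : ℕ) : ℝ) ^ k))

noncomputable def DK (W J : ℕ) (α : ℝ) : ℂ := ∑ i ∈ Finset.range J, ee (α * (W * i))

def cA (P : Finset ℕ) (k L : ℕ) : Finset (ℕ × ℕ × ℕ) :=
  (P ×ˢ P ×ˢ Finset.range L).filter (fun z => z.1 + z.2.1 = 2 * (4 * z.2.2 + 3) ^ k)

def cB (P : Finset ℕ) (k L W J : ℕ) : Finset (ℕ × ℕ × ℕ × ℕ) :=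
  (P ×ˢ P ×ˢ Finset.range L ×ˢ Finset.range J).filter (fun z => z.1 + z.2.1 = 2 * (4 * z.2.2.1 + 3) ^ k + W * z.2.2.2)

theorem VV_norm_le (k L : ℕ) (α : ℝ) : ‖VV k L α‖ ≤ L := by
  unfold VV
  refine (norm_sum_le _ _).trans ?_
  simp [ee_norm]

theorem VV_neg (k L : ℕ) (α : ℝ) : ‖VV k L (-α)‖ = ‖VV k L α‖ := by
  rw [← Complex.norm_conj]
  congr 1
  unfold VV
  rw [map_sum]
  refine Finset.sum_congr rfl fun t _ => ?_
  rw [ee_conj]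
  congr 1
  ring

theorem DK_le (W J : ℕ) (α : ℝ) : ‖(J : ℂ) - DK W J α‖ ≤ 2 * J := by
  refine (norm_sub_le _ _).trans ?_
  have : ‖DK W J α‖ ≤ J := by
    unfold DK
    refine (norm_sum_le _ _).trans ?_
    simp [ee_norm]
  simp
  linarith

theorem DK_small (W J : ℕ) (α κ : ℝ) (r : ℕ) (z : ℤ) (hr : 1 ≤ r) (hrW : r ∣ W) (h : |r * α - z| ≤ κ) :
    ‖(J : ℂ) - DK W J α‖ ≤ J * (2 * Real.pi * (J * W * κ)) := by
  have hκ : 0 ≤ κ := (abs_nonneg _).trans h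
  obtain ⟨w, rfl⟩ := hrW
  have e : (J : ℂ) - DK (r * w) J α = ∑ i ∈ Finset.range J, (1 - ee (α * (((r * w : ℕ) : ℝ) * i))) := by
    rw [Finset.sum_sub_distrib]; simp [DK]
  rw [e]
  refine (norm_sum_le _ _).trans ?_
  have : ∀ i ∈ Finset.range J, ‖1 - ee (α * (((r * w : ℕ) : ℝ) * i))‖ ≤ 2 * Real.pi * (J * ((r * w : ℕ) : ℝ) * κ) := by
    intro i hi
    have hi' : (i : ℝ) ≤ J := by exact_mod_cast (Finset.mem_range.1 hi).le
    have h1 : ee (α * (((r * w : ℕ) : ℝ) * i)) = ee ((r * α - z) * (w * i)) := by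
      have : α * (((r * w : ℕ) : ℝ) * i) = (r * α - z) * (w * i) + ((z * (w * i) : ℤ) : ℝ) := by push_cast; ring
      rw [this, ee_add, ee_int, mul_one]
    rw [h1, norm_sub_rev]
    refine (ee_sub_one_le _).trans ?_
    rw [abs_mul, abs_of_nonneg (show (0 : ℝ) ≤ w * i by positivity)]
    have h2 : (w : ℝ) ≤ ((r * w : ℕ) : ℝ) := by exact_mod_cast Nat.le_mul_of_pos_left w hr
    have h3 : |r * α - z| * (w * i) ≤ κ * (((r * w : ℕ) : ℝ) * J) := by gcongr
    have := Real.pi_pos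
    calc 2 * Real.pi * (|r * α - z| * (w * i)) ≤ 2 * Real.pi * (κ * (((r * w : ℕ) : ℝ) * J)) := by gcongr
      _ = _ := by ring
  refine (Finset.sum_le_sum this).trans ?_
  rw [Finset.sum_const, Finset.card_range, nsmul_eq_mul]

theorem fourier_diff (P : Finset ℕ) (k L W J : ℕ) : ∃ Q0 : ℕ, ∀ Q : ℕ, Q0 ≤ Q → 0 < Q →
    (Q : ℝ) * ((cB P k L W J).card - J * (cA P k L).card) ≤
      ∑ x ∈ Finset.range Q, ‖SS P ((x : ℝ) / Q)‖ ^ 2 * (‖VV k L ((x : ℝ) / Q)‖ * ‖(J : ℂ) - DK W J (-((x : ℝ) / Q))‖) := by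
  refine ⟨2 * (P.sup id) + 2 * (4 * L + 3) ^ k + W * J + 1, ?_⟩
  intro Q hQ0 hQ
  have hP : ∀ p ∈ P, 2 * p < Q := by
    intro p hp
    have : p ≤ P.sup id := Finset.le_sup (f := id) hp
    have : 0 ≤ 2 * (4 * L + 3) ^ k := Nat.zero_le _
    omega
  have hu : ∀ t ∈ Finset.range L, 2 * (4 * t + 3) ^ k ≤ 2 * (4 * L + 3) ^ k := by
    intro t ht
    have := Finset.mem_range.1 ht
    gcongr
  have hA := count_four P (Finset.range L) (fun t => 2 * (4 * t + 3) ^ k) Q hP (fun t ht => by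
    have := hu t ht
    show 2 * (4 * t + 3) ^ k < Q
    omega) hQ
  have hB := count_four P (Finset.range L ×ˢ Finset.range J) (fun t => 2 * (4 * t.1 + 3) ^ k + W * t.2) Q hP (fun t ht => by
    have h1 := hu t.1 (Finset.mem_product.1 ht).1
    have h2 : W * t.2 ≤ W * J := Nat.mul_le_mul_left _ (Finset.mem_range.1 (Finset.mem_product.1 ht).2).le
    show 2 * (4 * t.1 + 3) ^ k + W * t.2 < Q
    omega) hQ
  have eA : ∀ α : ℝ, ∑ t ∈ Finset.range L, ee (((2 * (4 * t + 3) ^ k : ℕ) : ℝ) * (-α)) = VV k L (-α) := by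
    intro α
    unfold VV
    refine Finset.sum_congr rfl fun t _ => ?_
    congr 1; push_cast; ring
  have eB : ∀ α : ℝ, ∑ t ∈ Finset.range L ×ˢ Finset.range J, ee (((2 * (4 * t.1 + 3) ^ k + W * t.2 : ℕ) : ℝ) * (-α)) = VV k L (-α) * DK W J (-α) := by
    intro α
    unfold VV DK
    rw [Finset.sum_product, Finset.sum_mul_sum]
    refine Finset.sum_congr rfl fun t _ => Finset.sum_congr rfl fun i _ => ?_
    rw [← ee_add]
    congr 1; push_cast; ring
  simp only [eA] at hA
  simp only [eB] at hB
  have hcA : ((P ×ˢ P ×ˢ Finset.range L).filter (fun z => z.1 + z.2.1 = 2 * (4 * z.2.2 + 3) ^ k)) = cA P k L := rfl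
  have hcB : ((P ×ˢ P ×ˢ Finset.range L ×ˢ Finset.range J).filter (fun z => z.1 + z.2.1 = 2 * (4 * z.2.2.1 + 3) ^ k + W * z.2.2.2)) = cB P k L W J := rfl
  rw [hcA] at hA
  rw [hcB] at hB
  have key : (((Q : ℝ) * ((cB P k L W J).card - J * (cA P k L).card) : ℝ) : ℂ) = - ∑ x ∈ Finset.range Q, SS P ((x : ℝ) / Q) ^ 2 * (VV k L (-((x : ℝ) / Q)) * ((J : ℂ) - DK W J (-((x : ℝ) / Q)))) := by
    push_cast
    rw [mul_sub, ← hB, mul_left_comm, ← hA, Finset.mul_sum, ← Finset.sum_sub_distrib, ← Finset.sum_neg_distrib]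
    refine Finset.sum_congr rfl fun x _ => ?_
    ring
  have h2 : (Q : ℝ) * ((cB P k L W J).card - J * (cA P k L).card) ≤ ‖(((Q : ℝ) * ((cB P k L W J).card - J * (cA P k L).card) : ℝ) : ℂ)‖ := by
    rw [Complex.norm_real]; exact le_abs_self _
  refine h2.trans ?_
  rw [key, norm_neg]
  refine (norm_sum_le _ _).trans ?_
  refine Finset.sum_le_sum fun x _ => ?_
  rw [norm_mul, norm_mul, norm_pow, VV_neg]

theorem tail_small (δ : ℝ) (hδ : 0 < δ) : ∃ j0 : ℕ, 2 * (1 / 2 : ℝ) ^ j0 * ((j0 : ℝ) + 2) ^ 4 ≤ δ ∧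
    ∀ s, ∑ j ∈ Finset.Ico j0 s, 2 * (1 / 2 : ℝ) ^ j * ((j : ℝ) + 2) ^ 4 ≤ δ := by
  set a : ℕ → ℝ := fun j => 2 * (1 / 2 : ℝ) ^ j * ((j : ℝ) + 2) ^ 4 with ha
  have hsum : Summable a := by
    have h1 := summable_pow_mul_geometric_of_norm_lt_one 4 (r := (1 / 2 : ℝ)) (by norm_num [abs_of_pos])
    have h2 := (summable_nat_add_iff 2).2 h1
    refine (h2.mul_left 8).congr fun j => ?_
    simp only [ha]
    push_cast
    rw [pow_add]; ring
  have hnn : ∀ j, 0 ≤ a j := fun j => by positivity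
  have ht := tendsto_sum_nat_add a
  obtain ⟨j0, hj0⟩ := ((tendsto_order.1 ht).2 δ hδ).exists
  have hs2 : Summable (fun k => a (k + j0)) := (summable_nat_add_iff j0).2 hsum
  refine ⟨j0, ?_, ?_⟩
  · have := hs2.le_tsum 0 (fun j _ => hnn _)
    simp only [zero_add] at this
    exact this.trans hj0.le
  · intro s
    rw [Finset.sum_Ico_eq_sum_range]
    refine le_trans ?_ hj0.le
    have := hs2.sum_le_tsum (Finset.range (s - j0)) (fun j _ => hnn _)
    refine le_trans (le_of_eq ?_) this
    refine Finset.sum_congr rfl fun j _ => ?_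
    simp only [ha]
    rw [add_comm]

noncomputable def MJ (k L Q j : ℕ) : Finset ℕ := by
  classical exact (Finset.range Q).filter (fun x => (L : ℝ) ≤ 2 ^ j * ‖VV k L ((x : ℝ) / Q)‖)

theorem mem_MJ {k L Q j x : ℕ} : x ∈ MJ k L Q j ↔ x < Q ∧ (L : ℝ) ≤ 2 ^ j * ‖VV k L ((x : ℝ) / Q)‖ := by
  classical
  unfold MJ
  rw [Finset.mem_filter, Finset.mem_range]

theorem arcs (k : ℕ) (hk : 1 ≤ k) : ∃ C : ℕ, 1 ≤ C ∧ ∀ (L Q j x : ℕ), 1 ≤ L → x ∈ MJ k L Q j →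
    ∃ r : ℕ, 1 ≤ r ∧ r < 2 ^ (C * (j + 1)) ∧ ∃ z : ℤ, |(r : ℝ) * (x / Q) - z| ≤ 2 ^ (C * (j + 1)) / (L : ℝ) ^ k := by
  obtain ⟨C, hC, h⟩ := weyl_cor k hk
  refine ⟨C, hC, fun L Q j x hL hx => ?_⟩
  obtain ⟨r, h1, h2, z, h3⟩ := h L ((x : ℝ) / Q) (2 ^ j) hL (one_le_pow₀ (by norm_num)) (mem_MJ.1 hx).2
  have hlt : (C : ℝ) * (2 ^ j) ^ C < 2 ^ (C * (j + 1)) := by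
    have : (C : ℝ) < 2 ^ C := by exact_mod_cast Nat.lt_two_pow_self
    calc (C : ℝ) * (2 ^ j) ^ C < 2 ^ C * (2 ^ j) ^ C := by gcongr
      _ = _ := by rw [← pow_mul, ← pow_add]; congr 1; ring
  refine ⟨r, h1, ?_, z, ?_⟩
  · have := h2.trans_lt hlt
    exact_mod_cast this
  · refine h3.trans ?_
    gcongr

theorem mass (P : Finset ℕ) (k L Q j s C : ℕ) (hC : 1 ≤ C) (hs1 : 1 ≤ s) (hL : 1 ≤ L) (hQ : 0 < Q)
    (hsL : (2 : ℝ) ^ (8 * C * s) ≤ (L : ℝ) ^ k) (hjs : j ≤ s)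
    (hP : ∀ p ∈ P, p < Q) (hPZ : ∀ p ∈ P, ∀ n, 1 ≤ n → n ≤ 2 ^ s → p.Coprime n)
    (hQZ : ∀ n, 1 ≤ n → n ≤ 2 ^ s → n ∣ Q)
    (harc : ∀ x ∈ MJ k L Q j, ∃ r : ℕ, 1 ≤ r ∧ r < 2 ^ (C * (j + 1)) ∧ ∃ z : ℤ, |(r : ℝ) * (x / Q) - z| ≤ 2 ^ (C * (j + 1)) / (L : ℝ) ^ k) :
    ∑ x ∈ MJ k L Q j, ‖SS P ((x : ℝ) / Q)‖ ^ 2 ≤ (2 * Real.exp 4 * C ^ 4 / Real.log 2) / s * (j + 1) ^ 4 * (Q * P.card) := by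
  have hLk : (0 : ℝ) < (L : ℝ) ^ k := by positivity
  have h1 := mont P (MJ k L Q j) (C * (j + 1)) (2 ^ s) Q (2 ^ (C * (j + 1)) / (L : ℝ) ^ k) hQ (by
    have e : 2 * 2 ^ (C * (j + 1)) * (2 ^ (C * (j + 1)) / (L : ℝ) ^ k) * ((2 ^ s : ℕ) : ℝ) ^ 2 = 2 ^ (1 + 2 * (C * (j + 1)) + 2 * s) / (L : ℝ) ^ k := by
      push_cast
      rw [pow_add, pow_add, pow_mul' 2 2, pow_mul' 2 2]; ring
    rw [e, div_lt_one hLk]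
    refine lt_of_lt_of_le ?_ hsL
    apply pow_lt_pow_right₀ (by norm_num)
    have e1 : C * (j + 1) ≤ C * s + C := by nlinarith
    have e2 : C ≤ C * s := by nlinarith
    have e3 : s ≤ C * s := by nlinarith
    have e4 : 8 * C * s = 8 * (C * s) := by ring
    omega) (by positivity) hP hPZ hQZ (fun x hx => ⟨(mem_MJ.1 hx).1, harc x hx⟩)
  have h2 := rough_sum (C * (j + 1)) (2 ^ s) (by nlinarith)
  have hlog : Real.log ((2 ^ s : ℕ) : ℝ) = s * Real.log 2 := by push_cast; rw [Real.log_pow]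
  rw [hlog] at h2
  push_cast at h2
  have hl2 : 0 < Real.log 2 := Real.log_pos (by norm_num)
  have hs0 : (0 : ℝ) < s := by exact_mod_cast hs1
  set T := ∑ x ∈ MJ k L Q j, ‖SS P ((x : ℝ) / Q)‖ ^ 2
  have hT : 0 ≤ T := Finset.sum_nonneg fun x _ => by positivity
  set U := ∑ n ∈ RS (C * (j + 1)) (2 ^ s), 1 / (n.totient : ℝ)
  have h3 : (s * Real.log 2) * T ≤ 2 * Real.exp 4 * ((C : ℝ) * (j + 1)) ^ 4 * (Q * P.card) := by
    calc (s * Real.log 2) * T ≤ (2 * Real.exp 4 * ((C : ℝ) * (j + 1)) ^ 4 * U) * T := by gcongr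
      _ = 2 * Real.exp 4 * ((C : ℝ) * (j + 1)) ^ 4 * (U * T) := by ring
      _ ≤ _ := by gcongr
  have h4 : (2 * Real.exp 4 * C ^ 4 / Real.log 2) / s * (j + 1) ^ 4 * (Q * P.card) = (2 * Real.exp 4 * ((C : ℝ) * (j + 1)) ^ 4 * (Q * P.card)) / (s * Real.log 2) := by
    field_simp
  rw [h4, le_div_iff₀ (by positivity)]
  linarith

theorem pointwise (k L Q W J j0 s C x : ℕ) (hx : x < Q) (hjs : j0 ≤ s)
    (hW : ∀ r, 1 ≤ r → r ≤ 2 ^ (C * (j0 + 1)) → r ∣ W)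
    (hκ : (W * J : ℝ) * (2 * Real.pi * (2 ^ (C * (j0 + 1)) / (L : ℝ) ^ k)) ≤ (1 / 2) ^ j0)
    (harc : x ∈ MJ k L Q j0 → ∃ r : ℕ, 1 ≤ r ∧ r < 2 ^ (C * (j0 + 1)) ∧ ∃ z : ℤ, |(r : ℝ) * (x / Q) - z| ≤ 2 ^ (C * (j0 + 1)) / (L : ℝ) ^ k) :
    ‖VV k L ((x : ℝ) / Q)‖ * ‖(J : ℂ) - DK W J (-((x : ℝ) / Q))‖ ≤
      L * J * ((if x ∈ MJ k L Q j0 then (1 / 2 : ℝ) ^ j0 else 0) + ∑ j ∈ Finset.Ico j0 s, (if x ∈ MJ k L Q (j + 1) then 2 * (1 / 2 : ℝ) ^ j else 0) + 2 * (1 / 2) ^ s) := by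
  classical
  have hv := VV_norm_le k L ((x : ℝ) / Q)
  have hd := DK_le W J (-((x : ℝ) / Q))
  have hS : 0 ≤ ∑ j ∈ Finset.Ico j0 s, (if x ∈ MJ k L Q (j + 1) then 2 * (1 / 2 : ℝ) ^ j else 0) :=
    Finset.sum_nonneg fun j _ => by split_ifs <;> positivity
  have hnot : ∀ j, x ∉ MJ k L Q j → ‖VV k L ((x : ℝ) / Q)‖ ≤ L * (1 / 2) ^ j := by
    intro j hj
    rw [mem_MJ] at hj
    push Not at hj
    have := hj hx
    rw [one_div, inv_pow, ← div_eq_mul_inv, le_div_iff₀ (by positivity)]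
    linarith
  by_cases h0 : x ∈ MJ k L Q j0
  · obtain ⟨r, hr1, hr2, z, hz⟩ := harc h0
    have h1 := DK_small W J (-((x : ℝ) / Q)) (2 ^ (C * (j0 + 1)) / (L : ℝ) ^ k) r (-z) hr1 (hW r hr1 hr2.le) (by
      rw [← abs_neg]
      convert hz using 2
      push_cast; ring)
    have h2 : ‖(J : ℂ) - DK W J (-((x : ℝ) / Q))‖ ≤ J * (1 / 2) ^ j0 := by
      refine h1.trans ?_
      gcongr
      linarith
    rw [if_pos h0]
    calc _ ≤ (L : ℝ) * (J * (1 / 2) ^ j0) := by gcongr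
      _ = L * J * ((1 / 2) ^ j0 + 0 + 0) := by ring
      _ ≤ _ := by gcongr; positivity
  · rw [if_neg h0]
    by_cases h1 : x ∈ MJ k L Q s
    · have hex : ∃ j, x ∈ MJ k L Q (j0 + (j + 1)) ∧ x ∉ MJ k L Q (j0 + j) := by
        by_contra hcon
        push Not at hcon
        have : ∀ i, x ∉ MJ k L Q (j0 + i) := by
          intro i
          induction i with
          | zero => exact h0
          | succ i ih => exact fun h => ih (hcon i h)
        exact this (s - j0) (by rwa [show j0 + (s - j0) = s by omega])
      obtain ⟨j, hj1, hj2⟩ := hex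
      have hjs2 : j0 + j < s := by
        by_contra hcon
        push Not at hcon
        apply hj2
        rw [mem_MJ] at h1 ⊢
        refine ⟨hx, h1.2.trans ?_⟩
        gcongr
        norm_num
      have h2 : 2 * (1 / 2 : ℝ) ^ (j0 + j) ≤ ∑ j ∈ Finset.Ico j0 s, (if x ∈ MJ k L Q (j + 1) then 2 * (1 / 2 : ℝ) ^ j else 0) := by
        have := Finset.single_le_sum (f := fun j => (if x ∈ MJ k L Q (j + 1) then 2 * (1 / 2 : ℝ) ^ j else 0)) (s := Finset.Ico j0 s)
          (fun j _ => by split_ifs <;> positivity) (Finset.mem_Ico.2 ⟨by omega, hjs2⟩ : j0 + j ∈ Finset.Ico j0 s)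
        rw [if_pos (by rwa [add_assoc])] at this
        exact this
      have h3 := hnot _ hj2
      calc _ ≤ (L * (1 / 2 : ℝ) ^ (j0 + j)) * (2 * J) := by gcongr
        _ = L * J * (0 + 2 * (1 / 2 : ℝ) ^ (j0 + j) + 0) := by ring
        _ ≤ _ := by gcongr; positivity
    · have h3 := hnot _ h1
      calc _ ≤ (L * (1 / 2 : ℝ) ^ s) * (2 * J) := by gcongr
        _ = L * J * (0 + 0 + 2 * (1 / 2 : ℝ) ^ s) := by ring
        _ ≤ _ := by gcongr

theorem err_bound (k : ℕ) (hk : 1 ≤ k) : ∃ C : ℕ, 1 ≤ C ∧ ∀ ε : ℝ, 0 < ε → ∃ (R : ℕ) (κ0 : ℝ) (s0 : ℕ), 0 < κ0 ∧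
    ∀ (P : Finset ℕ) (L W J s : ℕ), 1 ≤ L → (∀ r, 1 ≤ r → r ≤ R → r ∣ W) → (W * J : ℝ) ≤ κ0 * (L : ℝ) ^ k → s0 ≤ s → 1 ≤ s →
    (2 : ℝ) ^ (8 * C * s) ≤ (L : ℝ) ^ k → (∀ p ∈ P, ∀ n, 1 ≤ n → n ≤ 2 ^ s → p.Coprime n) →
    ((cB P k L W J).card : ℝ) ≤ J * (cA P k L).card + ε * (L * J * P.card) / s := by
  classical
  obtain ⟨C, hC, harcs⟩ := arcs k hk
  refine ⟨C, hC, fun ε hε => ?_⟩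
  have hl2 : 0 < Real.log 2 := Real.log_pos (by norm_num)
  have hC0 : (0 : ℝ) < C := by exact_mod_cast hC
  set K : ℝ := 2 * Real.exp 4 * C ^ 4 / Real.log 2 with hK
  have hK0 : 0 < K := by positivity
  obtain ⟨j0, hj0a, hj0b⟩ := tail_small (ε / (4 * K)) (by positivity)
  have hlim := tendsto_self_mul_const_pow_of_lt_one (r := (1 / 2 : ℝ)) (by norm_num) (by norm_num)
  obtain ⟨s1, hs1⟩ := Filter.eventually_atTop.1 ((tendsto_order.1 hlim).2 (ε / 4) (by positivity))
  have hpi := Real.pi_pos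
  refine ⟨2 ^ (C * (j0 + 1)), (1 / 2) ^ j0 / (2 * Real.pi * 2 ^ (C * (j0 + 1))), max j0 s1, by positivity, ?_⟩
  intro P L W J s hL hW hWJ hs0 hs hsL hPZ
  have hjs : j0 ≤ s := (le_max_left _ _).trans hs0
  have hs1' := hs1 s ((le_max_right _ _).trans hs0)
  have hsp : (0 : ℝ) < s := by exact_mod_cast hs
  have hLk : (0 : ℝ) < (L : ℝ) ^ k := by positivity
  obtain ⟨Q0, hQ0⟩ := fourier_diff P k L W J
  set Q := (2 ^ s).factorial * (Q0 + P.sup id + 1) with hQ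
  have hfp := Nat.factorial_pos (2 ^ s)
  have hQge : Q0 + P.sup id + 1 ≤ Q := Nat.le_mul_of_pos_left _ hfp
  have hQp : 0 < Q := by omega
  have hP : ∀ p ∈ P, p < Q := by
    intro p hp
    have : p ≤ P.sup id := Finset.le_sup (f := id) hp
    omega
  have hQZ : ∀ n, 1 ≤ n → n ≤ 2 ^ s → n ∣ Q := fun n h1 h2 => dvd_mul_of_dvd_left (Nat.dvd_factorial h1 h2) _
  have hmass : ∀ j, j ≤ s → ∑ x ∈ MJ k L Q j, ‖SS P ((x : ℝ) / Q)‖ ^ 2 ≤ K / s * (j + 1) ^ 4 * (Q * P.card) :=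
    fun j hj => mass P k L Q j s C hC hs hL hQp hsL hj hP hPZ hQZ (fun x hx => harcs L Q j x hL hx)
  have hpt : ∀ x ∈ Finset.range Q, _ := fun x hx => pointwise k L Q W J j0 s C x (Finset.mem_range.1 hx) hjs hW (by
    have e : (W * J : ℝ) * (2 * Real.pi * (2 ^ (C * (j0 + 1)) / (L : ℝ) ^ k)) = (W * J) / ((1 / 2) ^ j0 / (2 * Real.pi * 2 ^ (C * (j0 + 1))) * (L : ℝ) ^ k) * (1 / 2) ^ j0 := by
      field_simp
    rw [e]
    have : (W * J : ℝ) / ((1 / 2) ^ j0 / (2 * Real.pi * 2 ^ (C * (j0 + 1))) * (L : ℝ) ^ k) ≤ 1 := (div_le_one (by positivity)).2 hWJ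
    exact mul_le_of_le_one_left (by positivity) this) (fun h => harcs L Q j0 x hL h)
  have hF := hQ0 Q (by omega) hQp
  set g : ℕ → ℝ := fun x => ‖SS P ((x : ℝ) / Q)‖ ^ 2 with hg
  have hg0 : ∀ x, 0 ≤ g x := fun x => by positivity
  have hpars : ∑ x ∈ Finset.range Q, g x = Q * P.card := parseval P Q hP hQp
  have hind : ∀ (j : ℕ) (c : ℝ), ∑ x ∈ Finset.range Q, g x * (if x ∈ MJ k L Q j then c else 0) = c * ∑ x ∈ MJ k L Q j, g x := by
    intro j c
    rw [Finset.mul_sum]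
    have hsub : MJ k L Q j = (Finset.range Q).filter (fun x => x ∈ MJ k L Q j) := by
      ext x
      simp only [Finset.mem_filter, Finset.mem_range]
      exact ⟨fun h => ⟨(mem_MJ.1 h).1, h⟩, fun h => h.2⟩
    conv_rhs => rw [hsub, Finset.sum_filter]
    refine Finset.sum_congr rfl fun x _ => ?_
    split_ifs
    · ring
    · ring
  have hQP : (0 : ℝ) ≤ Q * P.card := by positivity
  have h1 : ∑ x ∈ Finset.range Q, g x * (‖VV k L ((x : ℝ) / Q)‖ * ‖(J : ℂ) - DK W J (-((x : ℝ) / Q))‖) ≤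
      L * J * ((1 / 2) ^ j0 * ∑ x ∈ MJ k L Q j0, g x + ∑ j ∈ Finset.Ico j0 s, 2 * (1 / 2 : ℝ) ^ j * ∑ x ∈ MJ k L Q (j + 1), g x + 2 * (1 / 2) ^ s * (Q * P.card)) := by
    refine (Finset.sum_le_sum fun x hx => mul_le_mul_of_nonneg_left (hpt x hx) (hg0 x)).trans (le_of_eq ?_)
    simp_rw [← hind]
    rw [← hpars, Finset.sum_comm, Finset.mul_sum (Finset.range Q) _ (2 * (1 / 2) ^ s), ← Finset.sum_add_distrib, ← Finset.sum_add_distrib, Finset.mul_sum]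
    refine Finset.sum_congr rfl fun x _ => ?_
    rw [← Finset.mul_sum]
    ring
  have h2 : (1 / 2 : ℝ) ^ j0 * ∑ x ∈ MJ k L Q j0, g x ≤ ε / (4 * s) * (Q * P.card) := by
    calc _ ≤ (1 / 2 : ℝ) ^ j0 * (K / s * (j0 + 1) ^ 4 * (Q * P.card)) := by gcongr; exact hmass j0 hjs
      _ = K / s * (1 * (1 / 2 : ℝ) ^ j0 * (j0 + 1) ^ 4) * (Q * P.card) := by ring
      _ ≤ K / s * (2 * (1 / 2 : ℝ) ^ j0 * (j0 + 2) ^ 4) * (Q * P.card) := by gcongr <;> norm_num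
      _ ≤ K / s * (ε / (4 * K)) * (Q * P.card) := by gcongr
      _ = _ := by field_simp
  have h3 : ∑ j ∈ Finset.Ico j0 s, 2 * (1 / 2 : ℝ) ^ j * ∑ x ∈ MJ k L Q (j + 1), g x ≤ ε / (4 * s) * (Q * P.card) := by
    calc _ ≤ ∑ j ∈ Finset.Ico j0 s, (K / s * (Q * P.card)) * (2 * (1 / 2 : ℝ) ^ j * (j + 2) ^ 4) := by
          refine Finset.sum_le_sum fun j hj => ?_
          have h := hmass (j + 1) (by have := (Finset.mem_Ico.1 hj).2; omega)
          calc _ ≤ 2 * (1 / 2 : ℝ) ^ j * (K / s * (((j + 1 : ℕ) : ℝ) + 1) ^ 4 * (Q * P.card)) := by gcongr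
            _ = _ := by push_cast; ring
      _ = (K / s * (Q * P.card)) * ∑ j ∈ Finset.Ico j0 s, (2 * (1 / 2 : ℝ) ^ j * (j + 2) ^ 4) := by rw [Finset.mul_sum]
      _ ≤ (K / s * (Q * P.card)) * (ε / (4 * K)) := by gcongr; exact hj0b s
      _ = _ := by field_simp
  have h4 : 2 * (1 / 2 : ℝ) ^ s * (Q * P.card) ≤ ε / (2 * s) * (Q * P.card) := by
    gcongr
    rw [le_div_iff₀ (by positivity)]
    linarith
  have h5 : (Q : ℝ) * ((cB P k L W J).card - J * (cA P k L).card) ≤ Q * (ε * (L * J * P.card) / s) := by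
    refine (hF.trans h1).trans ?_
    calc _ ≤ (L : ℝ) * J * (ε / (4 * s) * (Q * P.card) + ε / (4 * s) * (Q * P.card) + ε / (2 * s) * (Q * P.card)) := by gcongr
      _ = _ := by field_simp; ring
  have := le_of_mul_le_mul_left h5 (by exact_mod_cast hQp)
  linarith

theorem pow_diff_le (b h k : ℕ) : (b + h) ^ (k + 1) ≤ b ^ (k + 1) + (k + 1) * h * (b + h) ^ k := by
  induction k with
  | zero => simp
  | succ k ih =>
    have h1 : b ^ (k + 1) ≤ (b + h) ^ (k + 1) := Nat.pow_le_pow_left (by omega) _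
    calc (b + h) ^ (k + 1 + 1) = (b + h) * (b + h) ^ (k + 1) := by ring
      _ ≤ (b + h) * (b ^ (k + 1) + (k + 1) * h * (b + h) ^ k) := Nat.mul_le_mul_left _ ih
      _ = b ^ (k + 1 + 1) + (h * b ^ (k + 1) + (k + 1) * h * (b + h) ^ (k + 1)) := by ring
      _ ≤ b ^ (k + 1 + 1) + (h * (b + h) ^ (k + 1) + (k + 1) * h * (b + h) ^ (k + 1)) := by gcongr
      _ = _ := by ring

theorem n_count (k W L J g x i0 : ℕ) (hL : 1 ≤ L) (hW : 0 < W) (hW4 : 4 ∣ W) (hi0 : 4 * i0 + 3 < W)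
    (hg : 2 * (k + 1) * g * (8 * L) ^ k ≤ J) (hx : x ≤ 2 * (4 * L) ^ (k + 1))
    (hxm : x ≡ 2 * (4 * i0 + 3) ^ (k + 1) [MOD W]) (hlow : 2 * (W * g) ^ (k + 1) ≤ x) :
    g ≤ ((Finset.range L ×ˢ Finset.range J).filter (fun z => x = 2 * (4 * z.1 + 3) ^ (k + 1) + W * z.2 ∧ ((4 * z.1 + 3) % W) / 4 = i0)).card := by
  obtain ⟨y, hy1, hy2⟩ : ∃ y, 2 * y ^ (k + 1) ≤ x ∧ x < 2 * (y + 1) ^ (k + 1) := by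
    have h0 : 2 * (Nat.findGreatest (fun y => 2 * y ^ (k + 1) ≤ x) x) ^ (k + 1) ≤ x :=
      Nat.findGreatest_spec (P := fun y => 2 * y ^ (k + 1) ≤ x) (Nat.zero_le x) (by simp)
    refine ⟨_, h0, ?_⟩
    by_contra hcon
    push Not at hcon
    set y := Nat.findGreatest (fun y => 2 * y ^ (k + 1) ≤ x) x
    have h1 : y + 1 ≤ x := by
      have : y + 1 ≤ (y + 1) ^ (k + 1) := Nat.le_self_pow (by omega) _
      omega
    have := Nat.le_findGreatest (P := fun y => 2 * y ^ (k + 1) ≤ x) h1 hcon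
    omega
  have hyL : y ≤ 4 * L := by
    have : y ^ (k + 1) ≤ (4 * L) ^ (k + 1) := by omega
    exact (Nat.pow_le_pow_iff_left (by omega)).1 this
  have hyg : W * g ≤ y := by
    have : (W * g) ^ (k + 1) < (y + 1) ^ (k + 1) := by omega
    have := (Nat.pow_lt_pow_iff_left (by omega)).1 this
    omega
  obtain ⟨b, hb⟩ : ∃ b, y + 1 = b + W * g := ⟨y + 1 - W * g, by omega⟩
  set e := (4 * i0 + 3 + (W * b - b)) % W with he
  have heW : e < W := Nat.mod_lt _ hW
  have hbW : b ≤ W * b := Nat.le_mul_of_pos_left _ hW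
  have hmod : ∀ i, (b + e + W * i) ≡ 4 * i0 + 3 [MOD W] := by
    intro i
    have h1 : e ≡ 4 * i0 + 3 + (W * b - b) [MOD W] := Nat.mod_modEq _ _
    have h2 : b + e + W * i ≡ b + (4 * i0 + 3 + (W * b - b)) + 0 [MOD W] :=
      ((Nat.ModEq.refl b).add h1).add (Nat.modEq_zero_iff_dvd.2 (dvd_mul_right _ _))
    have h3 : b + (4 * i0 + 3 + (W * b - b)) + 0 = 4 * i0 + 3 + W * b := by omega
    rw [h3] at h2
    refine h2.trans ?_
    simp
  have key : ∀ i ∈ Finset.range g, ∃ z : ℕ × ℕ, z ∈ ((Finset.range L ×ˢ Finset.range J).filter (fun z => x = 2 * (4 * z.1 + 3) ^ (k + 1) + W * z.2 ∧ ((4 * z.1 + 3) % W) / 4 = i0)) ∧ 4 * z.1 + 3 = b + e + W * i := by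
    intro i hi
    have hi := Finset.mem_range.1 hi
    set n := b + e + W * i with hn
    have hny : n ≤ y := by
      have : W * (i + 1) ≤ W * g := Nat.mul_le_mul_left _ (by omega)
      rw [mul_add, mul_one] at this
      omega
    have hn4 : n % 4 = 3 := by
      have := (hmod i).of_dvd hW4
      unfold Nat.ModEq at this
      omega
    have hnx : 2 * n ^ (k + 1) ≤ x := (Nat.mul_le_mul_left 2 (Nat.pow_le_pow_left hny _)).trans hy1
    have hdvd : W ∣ x - 2 * n ^ (k + 1) := by
      apply (Nat.modEq_iff_dvd' hnx).1
      exact (((hmod i).pow (k + 1)).mul_left 2).trans hxm.symm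
    obtain ⟨v, hv⟩ := hdvd
    have hvJ : v < J := by
      have h1 : b ^ (k + 1) ≤ n ^ (k + 1) := Nat.pow_le_pow_left (by omega) _
      have h2 := pow_diff_le b (W * g) k
      rw [← hb] at h2
      have h3 : (y + 1) ^ k ≤ (8 * L) ^ k := Nat.pow_le_pow_left (by omega) _
      have h4 : (k + 1) * (W * g) * (y + 1) ^ k ≤ (k + 1) * (W * g) * (8 * L) ^ k := Nat.mul_le_mul_left _ h3
      have h5 : W * (2 * (k + 1) * g * (8 * L) ^ k) ≤ W * J := Nat.mul_le_mul_left _ hg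
      have h6 : W * (2 * (k + 1) * g * (8 * L) ^ k) = 2 * ((k + 1) * (W * g) * (8 * L) ^ k) := by ring
      have h7 : W * v < W * J := by omega
      exact lt_of_mul_lt_mul_left h7 (Nat.zero_le _)
    refine ⟨(n / 4, v), ?_, by show 4 * (n / 4) + 3 = n; omega⟩
    have hn' : 4 * (n / 4) + 3 = n := by omega
    simp only [Finset.mem_filter, Finset.mem_product, Finset.mem_range]
    refine ⟨⟨by omega, hvJ⟩, ?_, ?_⟩
    · rw [hn']; omega
    · rw [hn']
      have : n % W = 4 * i0 + 3 := by
        have := hmod i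
        unfold Nat.ModEq at this
        rw [Nat.mod_eq_of_lt hi0] at this
        exact this
      omega
  choose! F hF1 hF2 using key
  have := Finset.card_le_card_of_injOn (s := Finset.range g) F hF1 (by
    intro i hi j hj hij
    have h1 := hF2 i (by simpa using hi)
    have h2 := hF2 j (by simpa using hj)
    rw [hij, h2] at h1
    have : W * i = W * j := by omega
    exact Nat.eq_of_mul_eq_mul_left hW this)
  simpa using this

theorem B_lower (P : Finset ℕ) (k W L J g : ℕ) (Y : ℝ) (hY : 0 ≤ Y) (hL : 1 ≤ L) (hW : W ≠ 0) (hW8 : 8 ∣ W) (hk : Odd k)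
    (hE : ∀ x : ℕ, x % 8 = 2 → W.totient ^ 2 ≤ 4 * W * Nat.card {c : ZMod W // c.val % 8 = 5 ∧ IsUnit c ∧ IsUnit ((x : ZMod W) - c)})
    (hP : ∀ c : ZMod W, IsUnit c → c.val % 8 = 5 → Y ≤ ((P.filter (fun p => ((p : ℕ) : ZMod W) = c)).card : ℝ))
    (hg : 2 * (k + 1) * g * (8 * L) ^ k ≤ J) (hPu : ∀ p ∈ P, p ≤ (4 * L) ^ (k + 1))
    (hPl : ∀ p ∈ P, (W * g) ^ (k + 1) ≤ p) :
    (W.totient : ℝ) ^ 2 * Y ^ 2 * g ≤ 16 * (cB P (k + 1) L W J).card := by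
  classical
  have : NeZero W := ⟨hW⟩
  have hW0 : 0 < W := Nat.pos_of_ne_zero hW
  have hW4 : 4 ∣ W := (by norm_num : 4 ∣ 8).trans hW8
  set Nf : ℕ → ℕ → ℕ := fun x i => ((Finset.range L ×ˢ Finset.range J).filter (fun z => x = 2 * (4 * z.1 + 3) ^ (k + 1) + W * z.2 ∧ ((4 * z.1 + 3) % W) / 4 = i)).card with hNf
  have h1 : (cB P (k + 1) L W J).card = ∑ p ∈ P, ∑ q ∈ P, ∑ i ∈ Finset.range (W / 4), Nf (p + q) i := by
    unfold cB
    rw [Finset.card_filter, Finset.sum_product]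
    refine Finset.sum_congr rfl fun p _ => ?_
    rw [Finset.sum_product]
    refine Finset.sum_congr rfl fun q _ => ?_
    simp only
    rw [← Finset.card_filter, Finset.card_eq_sum_card_fiberwise (f := fun z : ℕ × ℕ => ((4 * z.1 + 3) % W) / 4) (t := Finset.range (W / 4))]
    · refine Finset.sum_congr rfl fun i _ => ?_
      rw [hNf, Finset.filter_filter]
    · intro z _
      have := Nat.mod_lt (4 * z.1 + 3) hW0
      simp only [Finset.coe_range, Set.mem_Iio]
      omega
  set Pc : ZMod W → Finset ℕ := fun c => P.filter (fun p => ((p : ℕ) : ZMod W) = c) with hPc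
  have h2 : ∀ i ∈ Finset.range (W / 4), (W.totient : ℝ) ^ 2 * Y ^ 2 * g ≤ 4 * W * ∑ p ∈ P, ∑ q ∈ P, (Nf (p + q) i : ℝ) := by
    intro i hi
    have hi' : 4 * i + 3 < W := by have := Finset.mem_range.1 hi; omega
    set x := 2 * (4 * i + 3) ^ (k + 1) with hx
    have hx8 : x % 8 = 2 := by
      have h4 : (4 * i + 3) ^ (k + 1) % 4 = 1 := by
        obtain ⟨m, rfl⟩ := hk
        rw [show 2 * m + 1 + 1 = 2 * (m + 1) by ring, pow_mul, Nat.pow_mod]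
        have : (4 * i + 3) ^ 2 % 4 = 1 := by
          rw [Nat.pow_mod, show (4 * i + 3) % 4 = 3 by omega]
        rw [this, one_pow]; rfl
      omega
    set G : Finset (ZMod W) := Finset.univ.filter (fun c => c.val % 8 = 5 ∧ IsUnit c ∧ IsUnit ((x : ZMod W) - c)) with hG
    have hGc : W.totient ^ 2 ≤ 4 * W * G.card := by
      have := hE x hx8
      rwa [Nat.card_eq_fintype_card, Fintype.card_subtype] at this
    have hgc : ∀ c ∈ G, Y ^ 2 * g ≤ ∑ p ∈ Pc c, ∑ q ∈ P, (Nf (p + q) i : ℝ) := by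
      intro c hc
      obtain ⟨hc1, hc2, hc3⟩ := (Finset.mem_filter.1 hc).2
      set d := (x : ZMod W) - c with hd
      have hd1 : d.val % 8 = 5 := by
        have e1 : ((c.val + d.val : ℕ) : ZMod W) = (x : ℕ) := by
          push_cast
          rw [ZMod.natCast_zmod_val, ZMod.natCast_zmod_val, hd]; ring
        rw [ZMod.natCast_eq_natCast_iff] at e1
        have e2 := e1.of_dvd hW8
        unfold Nat.ModEq at e2
        omega
      have hc4 := hP c hc2 hc1
      have hd4 := hP d hc3 hd1
      calc Y ^ 2 * g = Y * (Y * g) := by ring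
        _ ≤ ((Pc c).card : ℝ) * (((Pc d).card : ℝ) * g) := by gcongr
        _ = ∑ p ∈ Pc c, ∑ q ∈ Pc d, (g : ℝ) := by simp
        _ ≤ ∑ p ∈ Pc c, ∑ q ∈ Pc d, (Nf (p + q) i : ℝ) := by
          refine Finset.sum_le_sum fun p hp => Finset.sum_le_sum fun q hq => ?_
          obtain ⟨hp1, hp2⟩ := Finset.mem_filter.1 hp
          obtain ⟨hq1, hq2⟩ := Finset.mem_filter.1 hq
          have h3 := n_count k W L J g (p + q) i hL hW0 hW4 hi' hg (by
            have := hPu p hp1; have := hPu q hq1; omega) (by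
            rw [← ZMod.natCast_eq_natCast_iff, ← hx]
            push_cast [hp2, hq2]
            rw [hd]
            ring) (by have := hPl p hp1; have := hPl q hq1; omega)
          exact_mod_cast h3
        _ ≤ _ := by
          refine Finset.sum_le_sum fun p hp => Finset.sum_le_sum_of_subset_of_nonneg (Finset.filter_subset _ _) fun _ _ _ => by positivity
    have hsum : ∑ c ∈ G, ∑ p ∈ Pc c, ∑ q ∈ P, (Nf (p + q) i : ℝ) ≤ ∑ p ∈ P, ∑ q ∈ P, (Nf (p + q) i : ℝ) := by
      rw [← Finset.sum_fiberwise_of_maps_to (s := P) (t := Finset.univ) (g := fun p : ℕ => ((p : ℕ) : ZMod W)) (fun _ _ => Finset.mem_univ _)]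
      exact Finset.sum_le_sum_of_subset_of_nonneg (Finset.subset_univ _) fun _ _ _ => Finset.sum_nonneg fun _ _ => Finset.sum_nonneg fun _ _ => by positivity
    have h3 : (G.card : ℝ) * (Y ^ 2 * g) ≤ ∑ p ∈ P, ∑ q ∈ P, (Nf (p + q) i : ℝ) := by
      refine le_trans ?_ hsum
      rw [← nsmul_eq_mul]
      exact Finset.card_nsmul_le_sum _ _ _ hgc
    have h4 : (W.totient : ℝ) ^ 2 ≤ 4 * W * G.card := by exact_mod_cast hGc
    calc (W.totient : ℝ) ^ 2 * Y ^ 2 * g = (W.totient : ℝ) ^ 2 * (Y ^ 2 * g) := by ring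
      _ ≤ 4 * W * G.card * (Y ^ 2 * g) := by gcongr
      _ = 4 * W * (G.card * (Y ^ 2 * g)) := by ring
      _ ≤ _ := by gcongr
  have h3 := Finset.card_nsmul_le_sum _ _ _ h2
  rw [Finset.card_range, nsmul_eq_mul, ← Finset.mul_sum] at h3
  have h4 : ∑ i ∈ Finset.range (W / 4), ∑ p ∈ P, ∑ q ∈ P, (Nf (p + q) i : ℝ) = (cB P (k + 1) L W J).card := by
    rw [h1]
    push_cast
    rw [Finset.sum_comm]
    refine Finset.sum_congr rfl fun p _ => ?_
    rw [Finset.sum_comm]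
  rw [h4] at h3
  obtain ⟨w, hw⟩ := hW4
  have hw1 : W / 4 = w := by omega
  rw [hw1] at h3
  have hw2 : (W : ℝ) = 4 * w := by rw [hw]; push_cast; ring
  have hw0 : (0 : ℝ) < w := by
    have : 0 < w := by omega
    exact_mod_cast this
  rw [hw2] at h3
  have h5 : (w : ℝ) * ((W.totient : ℝ) ^ 2 * Y ^ 2 * g) ≤ w * (16 * (cB P (k + 1) L W J).card) := by
    refine h3.trans (le_of_eq ?_); ring
  exact le_of_mul_le_mul_left h5 hw0

section D4part
open Filter

theorem cop_small (p n s : ℕ) (hp : p.Prime) (h1 : 1 ≤ n) (h2 : n ≤ s) (h3 : s < p) : p.Coprime n :=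
  (Nat.Prime.coprime_iff_not_dvd hp).2 fun h => by have := Nat.le_of_dvd h1 h; omega

theorem P_upper (B : ℕ) (P : Finset ℕ) (l : ℝ) (hl : 0 < l) (h : ∀ p ∈ P, p.Prime ∧ p ≤ B ∧ l ≤ Real.log p) :
    (P.card : ℝ) ≤ Real.log 4 * B / l := by
  rw [le_div_iff₀ hl]
  have h1 : (P.card : ℝ) * l ≤ ∑ p ∈ P, Real.log p := by
    rw [← nsmul_eq_mul]
    exact Finset.card_nsmul_le_sum _ _ _ fun p hp => (h p hp).2.2
  refine h1.trans (le_trans ?_ (Chebyshev.theta_le_log4_mul_x (x := (B : ℝ)) (by positivity)))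
  rw [Chebyshev.theta_eq_sum_primesLE_log]
  apply Finset.sum_le_sum_of_subset_of_nonneg
  · intro p hp
    rw [Nat.mem_primesLE]
    exact ⟨(by simpa using (h p hp).2.1), (h p hp).1⟩
  · intro p _ _
    exact Real.log_natCast_nonneg p

set_option maxHeartbeats 1000000 in
theorem D_main (k : ℕ) (hk : Odd k) : ∃ c : ℝ, 0 < c ∧ ∃ L0 : ℕ, ∀ L : ℕ, L0 ≤ L → ∃ P : Finset ℕ,
    (∀ p ∈ P, p.Prime ∧ p % 8 = 5 ∧ p ≤ (4 * L) ^ (k + 1)) ∧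
    c * (L : ℝ) ^ (k + 2) / Real.log L ^ 2 ≤ (cA P (k + 1) L).card := by
  obtain ⟨c1, C1, hc1, hC1, hPAP⟩ := PAP
  obtain ⟨C, hC, herr⟩ := err_bound (k + 1) (by omega)
  have hC0 : (0 : ℝ) < C := by exact_mod_cast hC
  have hk1 : 1 ≤ k := hk.pos
  set ca : ℝ := c1 ^ 2 * 4 ^ (2 * k + 2) / (256 * C1 ^ 2 * (k + 1) ^ 3 * 8 ^ k) with hca
  have hca0 : 0 < ca := by positivity
  have hl4 : 0 < Real.log 4 := Real.log_pos (by norm_num)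
  set cb : ℝ := 16 * C * Real.log 4 * 4 ^ (k + 1) with hcb
  have hcb0 : 0 < cb := by positivity
  obtain ⟨R, κ0, s0, hκ0, herr⟩ := herr (ca / (2 * cb)) (by positivity)
  obtain ⟨W, hW, hW8, hWR, hE⟩ := E_main R
  have : NeZero W := ⟨hW⟩
  have hWp : (0 : ℝ) < W := by exact_mod_cast Nat.pos_of_ne_zero hW
  set κ := min κ0 (1 / C1) with hκ
  have hκp : 0 < κ := lt_min hκ0 (by positivity)
  have hκ1 : κ ≤ 1 / C1 := min_le_right _ _
  have hκ2 : κ ≤ κ0 := min_le_left _ _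
  refine ⟨ca / 2, by positivity, ?_⟩
  have hNt : Tendsto (fun L : ℕ => ((4 * L : ℕ) : ℝ) ^ (k + 1) / C1) atTop atTop := by
    apply Tendsto.atTop_div_const (by linarith)
    apply (tendsto_pow_atTop (by omega)).comp
    exact tendsto_natCast_atTop_atTop.comp (tendsto_id.const_mul_atTop' (by norm_num))
  have ev1 : ∀ᶠ L : ℕ in atTop, ∀ c : ZMod W, IsUnit c → c1 * (((4 * L : ℕ) : ℝ) ^ (k + 1) / C1) / (W.totient * Real.log (((4 * L : ℕ) : ℝ) ^ (k + 1) / C1)) ≤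
      (((Finset.Icc ⌈((4 * L : ℕ) : ℝ) ^ (k + 1) / C1⌉₊ ⌊C1 * (((4 * L : ℕ) : ℝ) ^ (k + 1) / C1)⌋₊).filter (fun p : ℕ => p.Prime ∧ ((p : ℕ) : ZMod W) = c)).card : ℝ) := by
    rw [eventually_all]
    intro c
    by_cases hc : IsUnit c
    · obtain ⟨N0, hN0⟩ := hPAP W hW c hc
      filter_upwards [hNt.eventually_ge_atTop N0] with L hL _
      exact hN0 _ hL
    · exact Eventually.of_forall fun L h => absurd h hc
  have ev2 : ∀ᶠ L : ℕ in atTop, (s0 : ℝ) + 1 ≤ Real.log L / (8 * C) := by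
    have : Tendsto (fun L : ℕ => Real.log L / (8 * C)) atTop atTop :=
      (Real.tendsto_log_atTop.comp tendsto_natCast_atTop_atTop).atTop_div_const (by positivity)
    exact this.eventually_ge_atTop _
  have ev3 : ∀ᶠ L : ℕ in atTop, max (max 4 C1) (W * (1 + 2 * (k + 1) * 8 ^ k) / κ) ≤ (L : ℝ) :=
    tendsto_natCast_atTop_atTop.eventually_ge_atTop _
  obtain ⟨L0, hL0⟩ := eventually_atTop.1 (ev1.and (ev2.and ev3))
  refine ⟨L0, fun L hL => ?_⟩
  obtain ⟨h1, h2, h3⟩ := hL0 L hL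
  have hL4 : (4 : ℝ) ≤ L := ((le_max_left _ _).trans (le_max_left _ _)).trans h3
  have hLC : C1 ≤ (L : ℝ) := ((le_max_right _ _).trans (le_max_left _ _)).trans h3
  have hLW : W * (1 + 2 * (k + 1) * 8 ^ k) / κ ≤ (L : ℝ) := (le_max_right _ _).trans h3
  have hLp : (0 : ℝ) < L := by linarith
  have hL1 : 1 ≤ L := by exact_mod_cast (by linarith : (1 : ℝ) ≤ L)
  have hlogL : 0 < Real.log L := Real.log_pos (by linarith)
  set N : ℝ := ((4 * L : ℕ) : ℝ) ^ (k + 1) / C1 with hN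
  have hC1N : C1 * N = (((4 * L) ^ (k + 1) : ℕ) : ℝ) := by rw [hN]; push_cast; field_simp
  have hNL : (L : ℝ) < N := by
    rw [hN, lt_div_iff₀ (by linarith)]
    have : ((4 * L : ℕ) : ℝ) ^ 2 ≤ ((4 * L : ℕ) : ℝ) ^ (k + 1) := by
      apply pow_le_pow_right₀ _ (by omega)
      push_cast; linarith
    refine lt_of_lt_of_le ?_ this
    push_cast
    nlinarith
  have hNp : 0 < N := hLp.trans hNL
  have hlogN1 : Real.log L ≤ Real.log N := Real.log_le_log hLp hNL.le
  have hlogN2 : Real.log N ≤ 2 * (k + 1) * Real.log L := by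
    have e1 : N ≤ (L ^ 2 : ℝ) ^ (k + 1) := by
      rw [hN, div_le_iff₀ (by linarith)]
      calc ((4 * L : ℕ) : ℝ) ^ (k + 1) ≤ (L ^ 2 : ℝ) ^ (k + 1) := by
            gcongr; push_cast; nlinarith
        _ ≤ (L ^ 2 : ℝ) ^ (k + 1) * C1 := le_mul_of_one_le_right (by positivity) hC1.le
    have := Real.log_le_log hNp e1
    rw [Real.log_pow, Real.log_pow] at this
    push_cast at this
    linarith
  have hlogN : 0 < Real.log N := hlogL.trans_le hlogN1
  set P : Finset ℕ := (Finset.Icc ⌈N⌉₊ ⌊C1 * N⌋₊).filter (fun p => p.Prime ∧ p % 8 = 5) with hP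
  have hmemP : ∀ p ∈ P, p.Prime ∧ p % 8 = 5 ∧ p ≤ (4 * L) ^ (k + 1) ∧ N ≤ p := by
    intro p hp
    obtain ⟨hp1, hp2, hp3⟩ := Finset.mem_filter.1 hp
    rw [Finset.mem_Icc, hC1N, Nat.floor_natCast, Nat.ceil_le] at hp1
    exact ⟨hp2, hp3, hp1.2, hp1.1⟩
  refine ⟨P, fun p hp => ⟨(hmemP p hp).1, (hmemP p hp).2.1, (hmemP p hp).2.2.1⟩, ?_⟩
  set J := ⌊κ * (L : ℝ) ^ (k + 1) / W⌋₊ with hJ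
  have hJ1 : (J : ℝ) ≤ κ * (L : ℝ) ^ (k + 1) / W := Nat.floor_le (by positivity)
  have hWJ : (W * J : ℝ) ≤ κ * (L : ℝ) ^ (k + 1) := by
    rw [le_div_iff₀ hWp] at hJ1; linarith
  set D := 2 * (k + 1) * (8 * L) ^ k with hD
  have hDp : 0 < D := by positivity
  have hLk : (1 : ℝ) ≤ (L : ℝ) ^ k := one_le_pow₀ (by linarith)
  have hJD : D ≤ J := by
    apply Nat.le_floor
    rw [le_div_iff₀ hWp]
    rw [div_le_iff₀ hκp] at hLW
    have e : (D : ℝ) = 2 * (k + 1) * 8 ^ k * L ^ k := by rw [hD]; push_cast; rw [mul_pow]; ring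
    rw [e]
    calc 2 * ((k : ℝ) + 1) * 8 ^ k * L ^ k * W ≤ (W * (1 + 2 * (k + 1) * 8 ^ k)) * L ^ k := by nlinarith [mul_pos hWp (by positivity : (0 : ℝ) < L ^ k)]
      _ ≤ (L * κ) * L ^ k := by gcongr
      _ = _ := by ring
  set g := J / D with hg
  have hgD : g * D ≤ J := Nat.div_mul_le_self _ _
  have hg1 : 1 ≤ g := (Nat.one_le_div_iff hDp).2 hJD
  have hgJ : J ≤ 2 * (g * D) := by
    have := Nat.lt_div_mul_add hDp (a := J)
    rw [← hg] at this
    nlinarith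
  have hJp : (0 : ℝ) < J := by exact_mod_cast lt_of_lt_of_le hDp hJD
  set s := ⌊Real.log L / (8 * C)⌋₊ with hs
  have hs0 : s0 + 1 ≤ s := Nat.le_floor (by push_cast; exact h2)
  have hs1 : (s : ℝ) ≤ Real.log L / (8 * C) := Nat.floor_le (by positivity)
  have hs2 : Real.log L / (16 * C) ≤ s := by
    have := Nat.lt_floor_add_one (Real.log L / (8 * C))
    rw [← hs] at this
    have e : Real.log L / (8 * C) = 2 * (Real.log L / (16 * C)) := by field_simp; norm_num
    have : (1 : ℝ) ≤ s := by exact_mod_cast (by omega : 1 ≤ s)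
    linarith
  have h2s : (2 : ℝ) ^ (8 * C * s) ≤ L := by
    have e1 : (2 : ℝ) ≤ Real.exp 1 := by have := Real.add_one_le_exp (1 : ℝ); linarith
    calc (2 : ℝ) ^ (8 * C * s) ≤ Real.exp 1 ^ (8 * C * s) := by gcongr
      _ = Real.exp (8 * C * s) := by rw [← Real.exp_nat_mul]; push_cast; rw [mul_one]
      _ ≤ Real.exp (Real.log L) := by
        apply Real.exp_le_exp.2
        rw [le_div_iff₀ (by positivity)] at hs1
        linarith
      _ = L := Real.exp_log hLp
  have hB := B_lower P k W L J g (c1 * N / (W.totient * Real.log N)) (by positivity) hL1 hW hW8 hk hE (by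
    intro c hc hc5
    refine (h1 c hc).trans ?_
    have hsub : (Finset.Icc ⌈N⌉₊ ⌊C1 * N⌋₊).filter (fun p : ℕ => p.Prime ∧ ((p : ℕ) : ZMod W) = c) ⊆ P.filter (fun p => ((p : ℕ) : ZMod W) = c) := by
      intro p hp
      obtain ⟨hp1, hp2, hp3⟩ := Finset.mem_filter.1 hp
      refine Finset.mem_filter.2 ⟨Finset.mem_filter.2 ⟨hp1, hp2, ?_⟩, hp3⟩
      rw [← ZMod.natCast_zmod_val c, ZMod.natCast_eq_natCast_iff] at hp3
      have := hp3.of_dvd hW8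
      unfold Nat.ModEq at this
      omega
    exact_mod_cast Finset.card_le_card hsub) (by
    calc 2 * (k + 1) * g * (8 * L) ^ k = g * D := by rw [hD]; ring
      _ ≤ J := hgD) (fun p hp => (hmemP p hp).2.2.1) (by
    intro p hp
    have e1 : ((W * g : ℕ) : ℝ) ≤ L / C1 := by
      have e2 : ((g * D : ℕ) : ℝ) ≤ J := by exact_mod_cast hgD
      have e3 : (L : ℝ) ^ k ≤ D := by
        have : L ^ k ≤ D := by
          rw [hD]
          calc L ^ k ≤ (8 * L) ^ k := Nat.pow_le_pow_left (by omega) _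
            _ ≤ _ := Nat.le_mul_of_pos_left _ (by omega)
        exact_mod_cast this
      have e4 : (W * g : ℝ) * (L : ℝ) ^ k ≤ (L / C1) * (L : ℝ) ^ k := by
        calc (W * g : ℝ) * (L : ℝ) ^ k ≤ (W * g : ℝ) * D := by gcongr
          _ = W * ((g * D : ℕ) : ℝ) := by push_cast; ring
          _ ≤ W * J := by gcongr
          _ ≤ κ * (L : ℝ) ^ (k + 1) := hWJ
          _ ≤ (1 / C1) * (L : ℝ) ^ (k + 1) := by gcongr
          _ = _ := by ring
      push_cast
      exact le_of_mul_le_mul_right e4 (by linarith)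
    have e5 : ((W * g : ℕ) : ℝ) ^ (k + 1) ≤ N := by
      calc ((W * g : ℕ) : ℝ) ^ (k + 1) ≤ (L / C1) ^ (k + 1) := by gcongr
        _ = (L : ℝ) ^ (k + 1) / C1 ^ (k + 1) := div_pow _ _ _
        _ ≤ ((4 * L : ℕ) : ℝ) ^ (k + 1) / C1 := by
          gcongr
          · push_cast; linarith
          · exact le_self_pow₀ hC1.le (by omega)
    have := e5.trans (hmemP p hp).2.2.2
    exact_mod_cast this)
  have hA := herr P L W J s hL1 hWR (hWJ.trans (by gcongr)) (by omega) (by omega)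
    (h2s.trans (le_self_pow₀ (by linarith) (by omega))) (by
      intro p hp n hn1 hn2
      refine cop_small p n (2 ^ s) (hmemP p hp).1 hn1 hn2 ?_
      have e1 : (2 : ℝ) ^ s ≤ (2 : ℝ) ^ (8 * C * s) := by
        apply pow_le_pow_right₀ (by norm_num)
        nlinarith
      have : ((2 ^ s : ℕ) : ℝ) < p := by
        push_cast
        exact (e1.trans h2s).trans_lt (hNL.trans_le (hmemP p hp).2.2.2)
      exact_mod_cast this)
  have hPc := P_upper ((4 * L) ^ (k + 1)) P (Real.log L) hlogL (fun p hp => by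
    obtain ⟨a1, a2, a3, a4⟩ := hmemP p hp
    exact ⟨a1, a3, Real.log_le_log hLp (hNL.le.trans a4)⟩)
  have hφ : (0 : ℝ) < W.totient := by exact_mod_cast Nat.totient_pos.2 (Nat.pos_of_ne_zero hW)
  have hsp : (0 : ℝ) < s := by exact_mod_cast (by omega : 0 < s)
  set A : ℝ := ((cA P (k + 1) L).card : ℝ) with hAdef
  set B : ℝ := ((cB P (k + 1) L W J).card : ℝ) with hBdef
  have hDr : (0 : ℝ) < D := by exact_mod_cast hDp
  -- main term
  have m1 : ca * (L : ℝ) ^ (k + 2) / Real.log L ^ 2 * J ≤ B := by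
    have q1 : (W.totient : ℝ) ^ 2 * (c1 * N / (W.totient * Real.log N)) ^ 2 * g = (c1 * N / Real.log N) ^ 2 * g := by
      field_simp
    rw [q1] at hB
    have q2 : (J : ℝ) ≤ 2 * (g * D) := by exact_mod_cast hgJ
    have q3 : c1 * N / (2 * (k + 1) * Real.log L) ≤ c1 * N / Real.log N := by gcongr
    have q4 : ca * (L : ℝ) ^ (k + 2) / Real.log L ^ 2 * (32 * D) = (c1 * N / (2 * (k + 1) * Real.log L)) ^ 2 := by
      rw [hca, hN, hD]
      push_cast
      rw [mul_pow, mul_pow]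
      field_simp
      ring
    have q5 : (c1 * N / (2 * (k + 1) * Real.log L)) ^ 2 * g ≤ 16 * B := by
      refine le_trans ?_ hB
      gcongr
    have q6 : 0 ≤ ca * (L : ℝ) ^ (k + 2) / Real.log L ^ 2 := by positivity
    rw [← q4] at q5
    nlinarith [mul_le_mul_of_nonneg_left q2 q6]
  have m2 : ca / (2 * cb) * (L * J * P.card) / s ≤ ca / 2 * (L : ℝ) ^ (k + 2) / Real.log L ^ 2 * J := by
    calc ca / (2 * cb) * (L * J * P.card) / s ≤ ca / (2 * cb) * (L * J * (Real.log 4 * (((4 * L) ^ (k + 1) : ℕ) : ℝ) / Real.log L)) / (Real.log L / (16 * C)) := by gcongr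
      _ = _ := by
        rw [hcb]
        push_cast
        rw [mul_pow]
        field_simp
        try ring
  have m3 : (ca / 2 * (L : ℝ) ^ (k + 2) / Real.log L ^ 2) * J ≤ A * J := by
    have : ca * (L : ℝ) ^ (k + 2) / Real.log L ^ 2 * J = 2 * (ca / 2 * (L : ℝ) ^ (k + 2) / Real.log L ^ 2 * J) := by ring
    linarith
  exact le_of_mul_le_mul_right m3 hJp

end D4part

theorem cA_image (P : Finset ℕ) (k L : ℕ) (hP : ∀ p ∈ P, p.Prime) :
    (cA P (k + 1) L).card ≤ 2 * ((cA P (k + 1) L).image (fun z => z.1 * z.2.1)).card := by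
  classical
  apply Finset.card_le_mul_card_image
  intro d hd
  have hinj : Set.InjOn (fun z : ℕ × ℕ × ℕ => z.1) ((cA P (k + 1) L).filter (fun z => z.1 * z.2.1 = d)) := by
    rintro ⟨p, q, t⟩ h1 ⟨p', q', t'⟩ h2 h
    simp only [cA, Finset.coe_filter, Finset.mem_filter, Finset.mem_product, Set.mem_ofPred_eq] at h1 h2 h
    subst h
    obtain ⟨⟨⟨hp, hq, ht⟩, e1⟩, e2⟩ := h1
    obtain ⟨⟨⟨hp', hq', ht'⟩, e1'⟩, e2'⟩ := h2
    have hqq : q = q' := Nat.eq_of_mul_eq_mul_left (hP p hp).pos (by rw [e2, e2'])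
    subst hqq
    have h3 : (4 * t + 3) ^ (k + 1) = (4 * t' + 3) ^ (k + 1) := by omega
    have h4 := Nat.pow_left_injective (n := k + 1) (by omega) h3
    have h5 : t = t' := by have h6 : 4*t+3 = 4*t'+3 := h4; omega
    rw [h5]
  rw [← Finset.card_image_of_injOn hinj]
  obtain ⟨⟨p, q, t⟩, hz, rfl⟩ := Finset.mem_image.1 hd
  simp only [cA, Finset.mem_filter, Finset.mem_product] at hz
  have hp := hP p hz.1.1
  have hq := hP q hz.1.2.1
  refine (Finset.card_le_card (t := {p, q}) ?_).trans Finset.card_le_two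
  intro a ha
  obtain ⟨⟨p', q', t'⟩, h1, rfl⟩ := Finset.mem_image.1 ha
  simp only [cA, Finset.mem_filter, Finset.mem_product] at h1
  obtain ⟨⟨⟨hp', _⟩, _⟩, e⟩ := h1
  have hdv : p' ∣ p * q := ⟨q', e.symm⟩
  simp only [Finset.mem_insert, Finset.mem_singleton]
  rcases (hP p' hp').dvd_mul.1 hdv with h | h
  · exact Or.inl ((Nat.prime_dvd_prime_iff_eq (hP p' hp') hp).1 h)
  · exact Or.inr ((Nat.prime_dvd_prime_iff_eq (hP p' hp') hq).1 h)

/-- For every `ℓ ≥ 2` there are `≫ X^(1/2 + 1/2^(ℓ+1)) / (log X)²` squarefree positive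
integers `d ≤ X` whose 2-class group `Cl₂(-d)` is isomorphic to `(ℤ/2ℤ) × (ℤ/2^ℓℤ)`. -/
theorem count_two_class_groups_of_type_two_twoPow (ℓ : ℕ) (hℓ : 2 ≤ ℓ) :
    ∃ c : ℝ, 0 < c ∧ ∃ X₀ : ℝ, ∀ X : ℝ, X₀ ≤ X →
      c * X ^ ((1 : ℝ) / 2 + 1 / 2 ^ (ℓ + 1)) / (Real.log X) ^ 2 ≤
        ({d : ℕ | (d : ℝ) ≤ X ∧ Squarefree d ∧
          twoClassGroupIso d (Multiplicative (ZMod 2 × ZMod (2 ^ ℓ)))}.ncard : ℝ) := by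
  classical
  obtain ⟨k, hkodd, hk⟩ : ∃ k : ℕ, Odd k ∧ k + 1 = 2 ^ (ℓ - 1) := by
    have h1 : 2 ^ (ℓ - 1) = 2 * 2 ^ (ℓ - 2) := by
      rw [← pow_succ']; congr 1; omega
    have h2 : 0 < 2 ^ (ℓ - 2) := by positivity
    exact ⟨2 ^ (ℓ - 1) - 1, Nat.odd_iff.2 (by omega), by omega⟩
  obtain ⟨c, hc, L0, hmain⟩ := D_main k hkodd
  have hK : (2 : ℝ) ^ ℓ = 2 * (k + 1) := by
    have : ((k + 1 : ℕ) : ℝ) = 2 ^ (ℓ - 1) := by rw [hk]; push_cast; rfl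
    push_cast at this
    rw [this, ← pow_succ']; congr 1; omega
  set β : ℝ := 1 / (2 * (k + 1)) with hβ
  have hβ0 : 0 < β := by positivity
  have ht : Filter.Tendsto (fun X : ℝ => X ^ β) Filter.atTop Filter.atTop := tendsto_rpow_atTop hβ0
  obtain ⟨X1, hX1⟩ := Filter.eventually_atTop.1 (ht.eventually_ge_atTop (4 * (L0 + 2 : ℝ)))
  refine ⟨c / (2 * 8 ^ (k + 2)), by positivity, max X1 1, fun X hX => ?_⟩
  have hX2 := hX1 X ((le_max_left _ _).trans hX)
  have hXone : 1 ≤ X := (le_max_right _ _).trans hX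
  have hX0 : 0 < X := by linarith
  set L := ⌊X ^ β / 4⌋₊ with hL
  have hLL0 : L0 + 2 ≤ L := Nat.le_floor (by push_cast; linarith)
  have hL1 : (L : ℝ) ≤ X ^ β / 4 := Nat.floor_le (by positivity)
  have hL2 : X ^ β / 8 ≤ L := by
    have := Nat.lt_floor_add_one (X ^ β / 4)
    rw [← hL] at this
    have : (2 : ℝ) ≤ L := by exact_mod_cast (by omega : 2 ≤ L)
    linarith
  obtain ⟨P, hP, hcount⟩ := hmain L (by omega)
  set S := {d : ℕ | (d : ℝ) ≤ X ∧ Squarefree d ∧ twoClassGroupIso d (Multiplicative (ZMod 2 × ZMod (2 ^ ℓ)))} with hS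
  have hfin : S.Finite := by
    apply (Set.finite_Iic ⌊X⌋₊).subset
    intro d hd
    exact Nat.le_floor hd.1
  have hpow : (((4 * L) ^ (k + 1) : ℕ) : ℝ) ^ 2 ≤ X := by
    push_cast
    calc ((4 * (L : ℝ)) ^ (k + 1)) ^ 2 ≤ ((X ^ β) ^ (k + 1)) ^ 2 := by gcongr; linarith
      _ = X := by
        rw [← Real.rpow_natCast, ← Real.rpow_natCast, ← Real.rpow_mul hX0.le, ← Real.rpow_mul hX0.le]
        have : β * ((k + 1 : ℕ) : ℝ) * ((2 : ℕ) : ℝ) = 1 := by rw [hβ]; push_cast; field_simp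
        rw [this, Real.rpow_one]
  have hsub : (((cA P (k + 1) L).image (fun z => z.1 * z.2.1) : Finset ℕ) : Set ℕ) ⊆ S := by
    intro d hd
    obtain ⟨⟨p, q, t⟩, hz, rfl⟩ := Finset.mem_image.1 (Finset.mem_coe.1 hd)
    simp only [cA, Finset.mem_filter, Finset.mem_product] at hz
    obtain ⟨⟨hp, hq, ht⟩, e⟩ := hz
    obtain ⟨hp1, hp2, hp3⟩ := hP p hp
    obtain ⟨hq1, hq2, hq3⟩ := hP q hq
    have hF := F_main (n := 4 * t + 3) (l := ℓ) hp1 hq1 hp2 hq2 (by omega) hℓ (by rw [← hk]; exact e)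
    refine ⟨?_, hF⟩
    refine le_trans ?_ hpow
    have := Nat.mul_le_mul hp3 hq3
    rw [sq]
    exact_mod_cast this
  have h1 := Set.ncard_le_ncard hsub hfin
  rw [Set.ncard_coe_finset] at h1
  have h2 := cA_image P k L (fun p hp => (hP p hp).1)
  have h3 : ((cA P (k + 1) L).card : ℝ) ≤ 2 * S.ncard := by exact_mod_cast h2.trans (Nat.mul_le_mul_left 2 h1)
  have hLr : (2 : ℝ) ≤ L := by exact_mod_cast (by omega : 2 ≤ L)
  have hlogL : 0 < Real.log L := Real.log_pos (by linarith)
  have hLX : (L : ℝ) ≤ X := by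
    have : X ^ β ≤ X ^ (1 : ℝ) := by
      apply Real.rpow_le_rpow_of_exponent_le hXone
      rw [hβ, div_le_one (by positivity)]
      have : (0 : ℝ) ≤ k := Nat.cast_nonneg k
      linarith
    rw [Real.rpow_one] at this
    have := Real.rpow_pos_of_pos hX0 β
    linarith
  have hlog : Real.log L ≤ Real.log X := Real.log_le_log (by linarith) hLX
  have h4 : X ^ ((1 : ℝ) / 2 + 1 / 2 ^ (ℓ + 1)) ≤ 8 ^ (k + 2) * (L : ℝ) ^ (k + 2) := by
    calc X ^ ((1 : ℝ) / 2 + 1 / 2 ^ (ℓ + 1)) ≤ X ^ (β * ((k + 2 : ℕ) : ℝ)) := by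
          apply Real.rpow_le_rpow_of_exponent_le hXone
          have e1 : β * ((k + 2 : ℕ) : ℝ) = 1 / 2 + 1 / 2 ^ ℓ := by
            rw [hK, hβ]; push_cast; field_simp; ring
          rw [e1]
          gcongr
          · norm_num
          · omega
      _ = (X ^ β) ^ (k + 2) := by rw [Real.rpow_mul hX0.le, Real.rpow_natCast]
      _ ≤ (8 * L) ^ (k + 2) := by gcongr; linarith
      _ = _ := mul_pow _ _ _
  calc c / (2 * 8 ^ (k + 2)) * X ^ ((1 : ℝ) / 2 + 1 / 2 ^ (ℓ + 1)) / (Real.log X) ^ 2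
      ≤ c / (2 * 8 ^ (k + 2)) * (8 ^ (k + 2) * (L : ℝ) ^ (k + 2)) / (Real.log L) ^ 2 := by gcongr
    _ = (c * (L : ℝ) ^ (k + 2) / Real.log L ^ 2) / 2 := by field_simp
    _ ≤ S.ncard := by linarith
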